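/- Let M be a II₁ factor with faithful tracial state τ, and let M₁, M₂ ⊆ M be von Neumann subalgebras which are infinite-dimensional factors such that: xy = yx for all x ∈ M₁, y ∈ M₂; τ(xy) = τ(x)τ(y) for all x ∈ M₁, y ∈ M₂; and M = vN(M₁ ∪ M₂) (these conditions realize M as the tensor product II₁ factor M₁ ⊗̄ M₂). For i = 1, 2 let A_i be a MASA in M_i, and let A := vN(A₁ ∪ A₂) (corresponding to A₁ ⊗̄ A₂). Then N_M(A)'' = vN(N_{M₁}(A₁)'' ∪ N_{M₂}(A₂)''). -/

import Mathlib

open scoped ComplexOrder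

noncomputable section

variable {H : Type*} [NormedAddCommGroup H] [InnerProductSpace ℂ H] [CompleteSpace H]

/-- The von Neumann algebra generated by a set of bounded operators `S`:
the double commutant of `S ∪ S*`. -/
def vNgen (S : Set (H →L[ℂ] H)) : Set (H →L[ℂ] H) :=
  Set.centralizer (Set.centralizer (S ∪ star '' S))

/-- `M` is a von Neumann algebra acting on `H`: a unital *-subalgebra of `B(H)`
equal to its double commutant. -/
structure IsVonNeumannAlgebra (M : Set (H →L[ℂ] H)) : Prop where
  one_mem : (1 : H →L[ℂ] H) ∈ M
  add_mem : ∀ x ∈ M, ∀ y ∈ M, x + y ∈ M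
  mul_mem : ∀ x ∈ M, ∀ y ∈ M, x * y ∈ M
  smul_mem : ∀ (c : ℂ), ∀ x ∈ M, c • x ∈ M
  star_mem : ∀ x ∈ M, star x ∈ M
  double_commutant : Set.centralizer (Set.centralizer M) = M

/-- `τ` is a faithful tracial state on `M`. -/
structure IsFaithfulTracialState (M : Set (H →L[ℂ] H)) (τ : (H →L[ℂ] H) → ℂ) : Prop where
  map_add : ∀ x ∈ M, ∀ y ∈ M, τ (x + y) = τ x + τ y
  map_smul : ∀ (c : ℂ), ∀ x ∈ M, τ (c • x) = c * τ x
  map_one : τ 1 = 1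
  nonneg : ∀ x ∈ M, 0 ≤ τ (star x * x)
  tracial : ∀ x ∈ M, ∀ y ∈ M, τ (x * y) = τ (y * x)
  faithful : ∀ x ∈ M, τ (star x * x) = 0 → x = 0

/-- `M` is infinite dimensional: it is not contained in the span of finitely many operators. -/
def IsInfiniteDimensionalSet (M : Set (H →L[ℂ] H)) : Prop :=
  ∀ s : Finset (H →L[ℂ] H),
    ¬ (M ⊆ (Submodule.span ℂ (s : Set (H →L[ℂ] H)) : Set (H →L[ℂ] H)))

/-- `M` is a factor: its center consists of scalar multiples of the identity. -/
def IsFactor (M : Set (H →L[ℂ] H)) : Prop :=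
  ∀ x ∈ M, (∀ y ∈ M, x * y = y * x) → ∃ c : ℂ, x = c • (1 : H →L[ℂ] H)

/-- `M` is a II₁ factor with faithful tracial state `τ`. -/
structure IsII1Factor (M : Set (H →L[ℂ] H)) (τ : (H →L[ℂ] H) → ℂ) : Prop where
  vna : IsVonNeumannAlgebra M
  factor : IsFactor M
  infdim : IsInfiniteDimensionalSet M
  trace : IsFaithfulTracialState M τ

/-- The 2-norm `‖x‖₂ = τ(x*x)^{1/2}` associated to the trace `τ`. -/
def norm2 (τ : (H →L[ℂ] H) → ℂ) (x : H →L[ℂ] H) : ℝ :=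
  Real.sqrt (τ (star x * x)).re

/-- `E` is the `τ`-preserving conditional expectation of `M` onto `B`. -/
def IsCondExp (M B : Set (H →L[ℂ] H)) (τ : (H →L[ℂ] H) → ℂ)
    (E : (H →L[ℂ] H) → (H →L[ℂ] H)) : Prop :=
  (∀ x ∈ M, E x ∈ B) ∧ (∀ x ∈ M, ∀ b ∈ B, τ ((x - E x) * b) = 0)

/-- `A` is a maximal abelian *-subalgebra (MASA) of `M`. -/
def IsMasa (M A : Set (H →L[ℂ] H)) : Prop :=
  A ⊆ M ∧ (∀ a ∈ A, star a ∈ A) ∧ {x ∈ M | ∀ a ∈ A, x * a = a * x} = A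

/-- `u` is a unitary operator. -/
def IsUnitary (u : H →L[ℂ] H) : Prop :=
  star u * u = 1 ∧ u * star u = 1

/-- The set of normalizing unitaries of `A` in `M`: unitaries `u ∈ M` with `uAu* = A`. -/
def normalizerSet (M A : Set (H →L[ℂ] H)) : Set (H →L[ℂ] H) :=
  {u | u ∈ M ∧ IsUnitary u ∧ (fun a => u * a * star u) '' A = A}

/-- The normalizing algebra `N_M(A)''` of `A` in `M`. -/
def normAlg (M A : Set (H →L[ℂ] H)) : Set (H →L[ℂ] H) :=
  vNgen (normalizerSet M A)

/-- The triple `B ⊆ N ⊆ M` satisfies the relative weak asymptotic homomorphism property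
relative to the trace `τ` and the conditional expectations `EB` and `EN`. -/
def RelWAHP (M N B : Set (H →L[ℂ] H)) (τ : (H →L[ℂ] H) → ℂ)
    (EB EN : (H →L[ℂ] H) → (H →L[ℂ] H)) : Prop :=
  ∀ (n : ℕ) (x : Fin n → (H →L[ℂ] H)), (∀ i, x i ∈ M) →
    ∀ ε : ℝ, 0 < ε → ∃ u ∈ B, IsUnitary u ∧
      ∀ i j, norm2 τ (EB (x i * u * x j) - EB (EN (x i) * u * EN (x j))) < ε

set_option linter.unusedSectionVars false

section

/-! ### Basic facts on von Neumann algebras -/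

theorem isVonNeumannAlgebra_centralizer {S : Set (H →L[ℂ] H)} (hS : ∀ x ∈ S, star x ∈ S) :
    IsVonNeumannAlgebra S.centralizer where
  one_mem := Set.one_mem_centralizer
  add_mem _ hx _ hy := Set.add_mem_centralizer hx hy
  mul_mem _ hx _ hy := Set.mul_mem_centralizer hx hy
  smul_mem c x hx := fun y hy => by
    rw [mul_smul_comm, smul_mul_assoc, hx y hy]
  star_mem x hx := fun y hy => by
    have := congrArg star (hx (star y) (hS y hy))
    simpa using this.symm
  double_commutant := Set.centralizer_centralizer_centralizer S

theorem star_mem_union_star {S : Set (H →L[ℂ] H)} {x : H →L[ℂ] H} (hx : x ∈ S ∪ star '' S) :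
    star x ∈ S ∪ star '' S := by
  rcases hx with hx | ⟨y, hy, rfl⟩
  · exact Or.inr ⟨x, hx, rfl⟩
  · exact Or.inl (by simpa using hy)

theorem isVonNeumannAlgebra_centralizer_union_star (S : Set (H →L[ℂ] H)) :
    IsVonNeumannAlgebra (S ∪ star '' S).centralizer :=
  isVonNeumannAlgebra_centralizer fun _ hx => star_mem_union_star hx

theorem isVonNeumannAlgebra_vNgen (S : Set (H →L[ℂ] H)) : IsVonNeumannAlgebra (vNgen S) :=
  isVonNeumannAlgebra_centralizer (isVonNeumannAlgebra_centralizer_union_star S).star_mem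

theorem subset_vNgen (S : Set (H →L[ℂ] H)) : S ⊆ vNgen S :=
  Set.subset_union_left.trans Set.subset_centralizer_centralizer

namespace IsVonNeumannAlgebra

variable {M : Set (H →L[ℂ] H)} (hM : IsVonNeumannAlgebra M)
include hM

theorem zero_mem : (0 : H →L[ℂ] H) ∈ M := by
  simpa using hM.smul_mem 0 1 hM.one_mem

theorem neg_mem {x : H →L[ℂ] H} (hx : x ∈ M) : -x ∈ M := by
  simpa using hM.smul_mem (-1) x hx

theorem sub_mem {x y : H →L[ℂ] H} (hx : x ∈ M) (hy : y ∈ M) : x - y ∈ M := by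
  rw [sub_eq_add_neg]
  exact hM.add_mem _ hx _ (hM.neg_mem hy)

theorem real_smul_mem (c : ℝ) {x : H →L[ℂ] H} (hx : x ∈ M) : c • x ∈ M := by
  simpa using hM.smul_mem (c : ℂ) x hx

theorem sum_mem {ι : Type*} (s : Finset ι) (f : ι → H →L[ℂ] H) (hf : ∀ i ∈ s, f i ∈ M) :
    ∑ i ∈ s, f i ∈ M := by
  classical
  induction s using Finset.induction_on with
  | empty => simpa using hM.zero_mem
  | insert a s ha ih =>
    rw [Finset.sum_insert ha]
    exact hM.add_mem _ (hf a (by simp)) _ (ih fun i hi => hf i (by simp [hi]))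

theorem mem_of_commute {x : H →L[ℂ] H} (h : ∀ y ∈ M.centralizer, y * x = x * y) : x ∈ M := by
  rw [← hM.double_commutant]
  exact h

theorem star_mem_centralizer {y : H →L[ℂ] H} (hy : y ∈ M.centralizer) : star y ∈ M.centralizer :=
  (isVonNeumannAlgebra_centralizer hM.star_mem).star_mem y hy

theorem cfc_mem {x : H →L[ℂ] H} (hx : x ∈ M) (f : ℝ → ℝ) : cfc f x ∈ M := by
  refine hM.mem_of_commute fun y hy => ?_
  have h : Commute x y := hy x hx
  exact (h.cfc_real f).symm

theorem vNgen_subset {S : Set (H →L[ℂ] H)} (hS : S ⊆ M) : vNgen S ⊆ M := by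
  intro x hx
  refine hM.mem_of_commute fun y hy => hx y ?_
  rintro z (hz | ⟨z, hz, rfl⟩)
  · exact hy z (hS hz)
  · exact hy _ (hM.star_mem z (hS hz))

theorem starProjection_mem (U : Submodule ℂ H) [U.HasOrthogonalProjection]
    (hU : ∀ y ∈ M.centralizer, ∀ h ∈ U, y h ∈ U) : U.starProjection ∈ M := by
  refine hM.mem_of_commute fun y hy => ?_
  have key : ∀ y ∈ M.centralizer,
      U.starProjection * y * U.starProjection = y * U.starProjection := by
    intro y hy
    ext h
    simp only [mul_apply_eq_comp]
    exact Submodule.starProjection_eq_self_iff.2 (hU y hy _ (U.starProjection_apply_mem h))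
  have h1 := key y hy
  have h2 := congrArg star (key (star y) (hM.star_mem_centralizer hy))
  have h3 : star U.starProjection = U.starProjection :=
    (isStarProjection_starProjection (U := U)).isSelfAdjoint.star_eq
  simp only [star_mul, star_star, h3] at h2
  rw [← h1, mul_assoc, h2]

end IsVonNeumannAlgebra

theorem IsMasa.comm {M A : Set (H →L[ℂ] H)} (hA : IsMasa M A) {a b : H →L[ℂ] H} (ha : a ∈ A)
    (hb : b ∈ A) : a * b = b * a := by
  rw [← hA.2.2] at ha
  exact ha.2 b hb

theorem IsMasa.mem {M A : Set (H →L[ℂ] H)} (hA : IsMasa M A) {x : H →L[ℂ] H} (hx : x ∈ M)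
    (h : ∀ a ∈ A, x * a = a * x) : x ∈ A := by
  rw [← hA.2.2]
  exact ⟨hx, h⟩

theorem IsMasa.vna {M A : Set (H →L[ℂ] H)} (hM : IsVonNeumannAlgebra M) (hA : IsMasa M A) :
    IsVonNeumannAlgebra A := by
  have h : A.centralizer = A.centralizer := rfl
  have hAc := isVonNeumannAlgebra_centralizer hA.2.1
  have hE : A = M ∩ A.centralizer := by
    ext x
    constructor
    · exact fun hx => ⟨hA.1 hx, fun a ha => hA.comm ha hx⟩
    · exact fun hx => hA.mem hx.1 fun a ha => (hx.2 a ha).symm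
  have hE' : ∀ x, x ∈ A ↔ x ∈ M ∧ x ∈ A.centralizer := fun x => Set.ext_iff.1 hE x
  refine ⟨?_, ?_, ?_, ?_, hA.2.1, ?_⟩
  · exact (hE' _).2 ⟨hM.one_mem, hAc.one_mem⟩
  · intro x hx y hy
    rw [hE'] at *
    exact ⟨hM.add_mem _ hx.1 _ hy.1, hAc.add_mem _ hx.2 _ hy.2⟩
  · intro x hx y hy
    rw [hE'] at *
    exact ⟨hM.mul_mem _ hx.1 _ hy.1, hAc.mul_mem _ hx.2 _ hy.2⟩
  · intro c x hx
    rw [hE'] at *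
    exact ⟨hM.smul_mem _ _ hx.1, hAc.smul_mem _ _ hx.2⟩
  · refine Set.Subset.antisymm (fun x hx => ?_) Set.subset_centralizer_centralizer
    refine hA.mem ?_ fun a ha => (hx a fun b hb => hA.comm hb ha).symm
    exact hM.mem_of_commute fun y hy => hx y fun a ha => hy a (hA.1 ha)

/-! ### Weak operator limits along filters -/

/-- `f` converges to `x` in the weak operator topology along the filter `F`. -/
def WLim {ι : Type*} (F : Filter ι) (f : ι → H →L[ℂ] H) (x : H →L[ℂ] H) : Prop :=
  ∀ h k : H, Filter.Tendsto (fun i => inner ℂ h (f i k)) F (nhds (inner ℂ h (x k)))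

namespace WLim

variable {ι : Type*} {F : Filter ι} {f g : ι → H →L[ℂ] H} {x y : H →L[ℂ] H}

theorem const (F : Filter ι) (x : H →L[ℂ] H) : WLim F (fun _ => x) x :=
  fun _ _ => tendsto_const_nhds

theorem unique [F.NeBot] (hx : WLim F f x) (hy : WLim F f y) : x = y := by
  ext k
  refine ext_inner_left ℂ fun h => tendsto_nhds_unique (hx h k) (hy h k)

theorem congr' (hx : WLim F f x) (h : ∀ᶠ i in F, f i = g i) : WLim F g x := fun u v =>
  (hx u v).congr' (h.mono fun i hi => by simp [hi])

theorem sub (hx : WLim F f x) (hy : WLim F g y) : WLim F (fun i => f i - g i) (x - y) :=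
  fun h k => by simpa [inner_sub_right] using (hx h k).sub (hy h k)

theorem mul_left (a : H →L[ℂ] H) (hx : WLim F f x) : WLim F (fun i => a * f i) (a * x) :=
  fun h k => by
    simpa [ContinuousLinearMap.star_eq_adjoint, ContinuousLinearMap.adjoint_inner_left]
      using hx (star a h) k

theorem mul_right (a : H →L[ℂ] H) (hx : WLim F f x) : WLim F (fun i => f i * a) (x * a) :=
  fun h k => hx h (a k)

theorem star (hx : WLim F f x) : WLim F (fun i => star (f i)) (star x) := fun h k => by
  have := (Complex.continuous_conj.tendsto _).comp (hx k h)
  simpa [ContinuousLinearMap.star_eq_adjoint, ContinuousLinearMap.adjoint_inner_right,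
    Function.comp_def] using this

theorem mem [F.NeBot] {M : Set (H →L[ℂ] H)} (hM : IsVonNeumannAlgebra M) (hx : WLim F f x)
    (hf : ∀ᶠ i in F, f i ∈ M) : x ∈ M :=
  hM.mem_of_commute fun y hy =>
    (hx.mul_left y).unique ((hx.mul_right y).congr' (hf.mono fun i hi => hy _ hi))

theorem nonneg [F.NeBot] (hx : WLim F f x) (hf : ∀ᶠ i in F, 0 ≤ f i) : 0 ≤ x := by
  rw [ContinuousLinearMap.nonneg_iff_isPositive, ContinuousLinearMap.isPositive_iff_complex]
  have h1 : IsSelfAdjoint x := by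
    refine (hx.star.congr' (hf.mono fun _ hi => ?_)).unique hx
    exact (IsSelfAdjoint.of_nonneg hi).star_eq
  intro k
  have h2 : 0 ≤ inner ℂ k (x k) := ge_of_tendsto (hx k k) (hf.mono fun i hi => by
    rw [ContinuousLinearMap.nonneg_iff_isPositive] at hi
    exact hi.inner_nonneg_right k)
  have h3 : inner ℂ (x k) k = inner ℂ k (x k) := by
    rw [← ContinuousLinearMap.adjoint_inner_right, ← ContinuousLinearMap.star_eq_adjoint,
      h1.star_eq]
  rw [h3]
  have := Complex.nonneg_iff.1 h2
  refine ⟨Complex.ext (by simp) (by simpa using this.2), this.1⟩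

theorem le [F.NeBot] (hx : WLim F f x) (hy : WLim F g y) (h : ∀ᶠ i in F, f i ≤ g i) : x ≤ y := by
  rw [← sub_nonneg]
  exact (hy.sub hx).nonneg (h.mono fun i hi => sub_nonneg.2 hi)

theorem norm_le [F.NeBot] {C : ℝ} (hC : 0 ≤ C) (hx : WLim F f x) (h : ∀ᶠ i in F, ‖f i‖ ≤ C) :
    ‖x‖ ≤ C := by
  refine ContinuousLinearMap.opNorm_le_bound _ hC fun k => ?_
  have h1 : ‖inner ℂ (x k) (x k)‖ ≤ ‖x k‖ * (C * ‖k‖) :=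
    le_of_tendsto (hx (x k) k).norm (h.mono fun i hi => (norm_inner_le_norm _ _).trans
      (by gcongr; exact (f i).le_of_opNorm_le hi k))
  rw [inner_self_eq_norm_sq_to_K] at h1
  rcases (norm_nonneg (x k)).eq_or_lt with h0 | h0
  · rw [← h0]; positivity
  · refine le_of_mul_le_mul_left ?_ h0
    simpa [sq] using h1

theorem exists_of_bounded (U : Ultrafilter ι) {C : ℝ} (hf : ∀ i, ‖f i‖ ≤ C) :
    ∃ x, WLim (U : Filter ι) f x := by
  have h1 : ∀ h k : H, ∃ c : ℂ, Filter.Tendsto (fun i => inner ℂ h (f i k)) U (nhds c) := by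
    intro h k
    have hb : ∀ i, inner ℂ h (f i k) ∈ Metric.closedBall (0 : ℂ) (‖h‖ * (C * ‖k‖)) := by
      intro i
      rw [mem_closedBall_zero_iff]
      exact (norm_inner_le_norm _ _).trans (by gcongr; exact (f i).le_of_opNorm_le (hf i) k)
    obtain ⟨c, -, hc⟩ := (isCompact_closedBall (0 : ℂ) (‖h‖ * (C * ‖k‖))).ultrafilter_le_nhds
      (U.map fun i => inner ℂ h (f i k)) (by
        rw [Filter.le_principal_iff]
        exact Filter.mem_map.2 (Filter.univ_mem' hb))
    exact ⟨c, hc⟩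
  choose B hB using h1
  have hbound : ∀ h k, ‖B h k‖ ≤ C * ‖h‖ * ‖k‖ := fun h k =>
    le_of_tendsto (hB h k).norm (Filter.Eventually.of_forall fun i =>
      (norm_inner_le_norm _ _).trans (by
        rw [mul_comm C, mul_assoc]
        gcongr; exact (f i).le_of_opNorm_le (hf i) k))
  let L : H →ₗ⋆[ℂ] H →ₗ[ℂ] ℂ := LinearMap.mk₂'ₛₗ (starRingEnd ℂ) (RingHom.id ℂ) B
    (fun a b k => tendsto_nhds_unique (hB _ _) (by
      simpa [inner_add_left] using (hB a k).add (hB b k)))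
    (fun c a k => tendsto_nhds_unique (hB _ _) (by
      simpa [inner_smul_left, mul_comm] using (hB a k).const_mul ((starRingEnd ℂ) c)))
    (fun h a b => tendsto_nhds_unique (hB _ _) (by
      simpa [inner_add_right] using (hB h a).add (hB h b)))
    (fun c h a => tendsto_nhds_unique (hB _ _) (by
      simpa [inner_smul_right] using (hB h a).const_mul c))
  let L' : H →L⋆[ℂ] H →L[ℂ] ℂ := LinearMap.mkContinuous₂ L C hbound
  refine ⟨Star.star (InnerProductSpace.continuousLinearMapOfBilin L'), fun h k => ?_⟩
  rw [ContinuousLinearMap.star_eq_adjoint, ContinuousLinearMap.adjoint_inner_right,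
    InnerProductSpace.continuousLinearMapOfBilin_apply]
  exact hB h k

end WLim

end

section

/-! ### Normal faithful tracial states -/

/-- `τ` restricts to a faithful tracial state on the von Neumann algebra `M`. -/
structure TracialState (M : Set (H →L[ℂ] H)) (τ : (H →L[ℂ] H) →ₗ[ℂ] ℂ) : Prop where
  vna : IsVonNeumannAlgebra M
  map_one : τ 1 = 1
  nonneg : ∀ x ∈ M, 0 ≤ τ (star x * x)
  tracial : ∀ x ∈ M, ∀ y ∈ M, τ (x * y) = τ (y * x)
  faithful : ∀ x ∈ M, τ (star x * x) = 0 → x = 0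

/-- A faithful tracial state on `M` which is weakly continuous on bounded sets and for which a
Kaplansky-type 2-norm density property holds. -/
structure NormalTrace (M : Set (H →L[ℂ] H)) (τ : (H →L[ℂ] H) →ₗ[ℂ] ℂ) : Prop
    extends TracialState M τ where
  wcont : ∀ (F : Filter (H →L[ℂ] H)) (C : ℝ) (x : H →L[ℂ] H), (∀ᶠ T in F, T ∈ M ∧ ‖T‖ ≤ C) →
    WLim F id x → Filter.Tendsto τ F (nhds (τ x))
  dense : ∀ D : StarSubalgebra ℂ (H →L[ℂ] H), (D : Set (H →L[ℂ] H)) ⊆ M → ∀ x ∈ M,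
    x ∈ (D : Set (H →L[ℂ] H)).centralizer.centralizer → ∀ ε : ℝ, 0 < ε →
    ∃ d ∈ D, (τ (star (x - d) * (x - d))).re < ε

/-- The square of the 2-norm. -/
def sq2 (τ : (H →L[ℂ] H) →ₗ[ℂ] ℂ) (x : H →L[ℂ] H) : ℝ := (τ (star x * x)).re

namespace IsVonNeumannAlgebra

theorem exists_star_mul_self {M : Set (H →L[ℂ] H)} (hM : IsVonNeumannAlgebra M) {x : H →L[ℂ] H}
    (hx : x ∈ M) (h0 : 0 ≤ x) :
    ∃ s ∈ M, 0 ≤ s ∧ star s = s ∧ s * s = x := by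
  refine ⟨cfc Real.sqrt x, hM.cfc_mem hx _, cfc_nonneg fun _ _ => Real.sqrt_nonneg _,
    (cfc_predicate Real.sqrt x).star_eq, ?_⟩
  have hsa : IsSelfAdjoint x := .of_nonneg h0
  rw [← cfc_mul Real.sqrt Real.sqrt x]
  conv_rhs => rw [← cfc_id ℝ x]
  refine cfc_congr fun t ht => ?_
  exact Real.mul_self_sqrt (spectrum_nonneg_of_nonneg h0 ht)

end IsVonNeumannAlgebra

namespace NormalTrace

variable {M : Set (H →L[ℂ] H)} {τ : (H →L[ℂ] H) →ₗ[ℂ] ℂ} (hτ : NormalTrace M τ)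
include hτ

theorem mono {N : Set (H →L[ℂ] H)} (hN : IsVonNeumannAlgebra N) (h : N ⊆ M) :
    NormalTrace N τ where
  vna := hN
  map_one := hτ.map_one
  nonneg x hx := hτ.nonneg x (h hx)
  tracial x hx y hy := hτ.tracial x (h hx) y (h hy)
  faithful x hx := hτ.faithful x (h hx)
  wcont F C x hF := hτ.wcont F C x (hF.mono fun _ hT => ⟨h hT.1, hT.2⟩)
  dense D hD x hx := hτ.dense D (hD.trans h) x (h hx)

theorem tendsto {ι : Type*} {F : Filter ι} {f : ι → H →L[ℂ] H} {x : H →L[ℂ] H} (C : ℝ)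
    (hf : ∀ᶠ i in F, f i ∈ M ∧ ‖f i‖ ≤ C) (hx : WLim F f x) :
    Filter.Tendsto (fun i => τ (f i)) F (nhds (τ x)) :=
  hτ.wcont (F.map f) C x hf hx

end NormalTrace

namespace TracialState

variable {M : Set (H →L[ℂ] H)} {τ : (H →L[ℂ] H) →ₗ[ℂ] ℂ} (hτ : TracialState M τ)
include hτ

theorem apply_nonneg {x : H →L[ℂ] H} (hx : x ∈ M) (h : 0 ≤ x) : 0 ≤ τ x := by
  obtain ⟨s, hs, -, hss, rfl⟩ := hτ.vna.exists_star_mul_self hx h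
  have := hτ.nonneg s hs
  rwa [hss] at this

theorem apply_mono {x y : H →L[ℂ] H} (hx : x ∈ M) (hy : y ∈ M) (h : x ≤ y) : τ x ≤ τ y := by
  have := hτ.apply_nonneg (hτ.vna.sub_mem hy hx) (sub_nonneg.2 h)
  rwa [map_sub, sub_nonneg] at this

theorem re_mono {x y : H →L[ℂ] H} (hx : x ∈ M) (hy : y ∈ M) (h : x ≤ y) :
    (τ x).re ≤ (τ y).re :=
  (Complex.le_def.1 (hτ.apply_mono hx hy h)).1

theorem re_nonneg {x : H →L[ℂ] H} (hx : x ∈ M) (h : 0 ≤ x) : 0 ≤ (τ x).re :=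
  (Complex.nonneg_iff.1 (hτ.apply_nonneg hx h)).1

theorem re_mul_nonneg {x y : H →L[ℂ] H} (hx : x ∈ M) (hy : y ∈ M) (h : 0 ≤ x) (h' : 0 ≤ y) :
    0 ≤ (τ (x * y)).re := by
  obtain ⟨s, hs, -, hss, rfl⟩ := hτ.vna.exists_star_mul_self hx h
  rw [mul_assoc, hτ.tracial s hs _ (hτ.vna.mul_mem _ hs _ hy)]
  refine hτ.re_nonneg (hτ.vna.mul_mem _ (hτ.vna.mul_mem _ hs _ hy) _ hs) ?_
  have := star_left_conjugate_nonneg h' s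
  rwa [hss] at this

theorem apply_star {x : H →L[ℂ] H} (hx : x ∈ M) : τ (star x) = star (τ x) := by
  have hs := hτ.vna.star_mem x hx
  have key : ∀ c : ℂ, (τ (star (1 + c • x) * (1 + c • x))).im = 0 := fun c =>
    ((Complex.nonneg_iff.1 (hτ.nonneg _
      (hτ.vna.add_mem _ hτ.vna.one_mem _ (hτ.vna.smul_mem c _ hx)))).2).symm
  have h0 : (τ (star x * x)).im = 0 := ((Complex.nonneg_iff.1 (hτ.nonneg x hx)).2).symm
  have h1 := key 1
  have h2 := key Complex.I
  simp [add_mul, mul_add, hτ.map_one, h0, smul_smul] at h1 h2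
  apply Complex.ext
  · simp; linarith
  · simp; linarith

theorem sq2_nonneg {x : H →L[ℂ] H} (hx : x ∈ M) : 0 ≤ sq2 τ x :=
  (Complex.nonneg_iff.1 (hτ.nonneg x hx)).1

theorem apply_star_mul_self {x : H →L[ℂ] H} (hx : x ∈ M) : τ (star x * x) = (sq2 τ x : ℂ) :=
  Complex.ext rfl (by simpa using ((Complex.nonneg_iff.1 (hτ.nonneg x hx)).2).symm)

theorem eq_zero_of_sq2 {x : H →L[ℂ] H} (hx : x ∈ M) (h : sq2 τ x = 0) : x = 0 :=
  hτ.faithful x hx (by rw [hτ.apply_star_mul_self hx, h]; simp)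

theorem eq_zero_of_re {x : H →L[ℂ] H} (hx : x ∈ M) (h : 0 ≤ x) (h0 : (τ x).re = 0) : x = 0 := by
  obtain ⟨s, hs, -, hss, rfl⟩ := hτ.vna.exists_star_mul_self hx h
  have : s = 0 := hτ.eq_zero_of_sq2 hs (by rw [sq2, hss]; exact h0)
  simp [this]

theorem sq2_star {x : H →L[ℂ] H} (hx : x ∈ M) : sq2 τ (star x) = sq2 τ x := by
  rw [sq2, sq2, star_star, hτ.tracial _ hx _ (hτ.vna.star_mem x hx)]

theorem apply_star_mul {x y : H →L[ℂ] H} (hx : x ∈ M) (hy : y ∈ M) :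
    τ (star y * x) = star (τ (star x * y)) := by
  rw [← hτ.apply_star (hτ.vna.mul_mem _ (hτ.vna.star_mem x hx) _ hy)]
  simp

theorem sq2_add_smul {x y : H →L[ℂ] H} (hx : x ∈ M) (hy : y ∈ M) (c : ℂ) :
    sq2 τ (y + c • x) = sq2 τ y + 2 * (c * τ (star y * x)).re + ‖c‖ ^ 2 * sq2 τ x := by
  have h : τ (star (y + c • x) * (y + c • x)) = τ (star y * y) + c * τ (star y * x)
      + star (c * τ (star y * x)) + ((starRingEnd ℂ) c * c) * τ (star x * x) := by
    simp [add_mul, mul_add, smul_smul, hτ.apply_star_mul hy hx]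
    ring
  rw [sq2, h, hτ.apply_star_mul_self hx, hτ.apply_star_mul_self hy, ← Complex.normSq_eq_conj_mul_self,
    Complex.normSq_eq_norm_sq, ← Complex.ofReal_mul]
  simp only [Complex.add_re, Complex.ofReal_re]
  simp
  ring

theorem cauchy_schwarz {x y : H →L[ℂ] H} (hx : x ∈ M) (hy : y ∈ M) :
    ‖τ (star y * x)‖ ^ 2 ≤ sq2 τ y * sq2 τ x := by
  set b := τ (star y * x) with hb
  have key : ∀ t : ℝ, 0 ≤ (‖b‖ ^ 2 * sq2 τ x) * (t * t) + (-2 * ‖b‖ ^ 2) * t + sq2 τ y := by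
    intro t
    have h1 := hτ.sq2_nonneg (hτ.vna.add_mem _ hy _
      (hτ.vna.smul_mem (-(t : ℂ) * (starRingEnd ℂ) b) _ hx))
    rw [hτ.sq2_add_smul hx hy, ← hb] at h1
    have h2 : -(t : ℂ) * (starRingEnd ℂ) b * b = ((-t * ‖b‖ ^ 2 : ℝ) : ℂ) := by
      rw [mul_assoc, ← Complex.normSq_eq_conj_mul_self, Complex.normSq_eq_norm_sq]
      push_cast; ring
    rw [h2, Complex.ofReal_re] at h1
    simp only [norm_mul, norm_neg, Complex.norm_real, RCLike.norm_conj, mul_pow] at h1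
    rw [Real.norm_eq_abs, sq_abs] at h1
    nlinarith
  have h3 := discrim_le_zero key
  rw [discrim] at h3
  rcases (norm_nonneg b).eq_or_lt with h0 | h0
  · rw [← h0]
    simpa using mul_nonneg (hτ.sq2_nonneg hy) (hτ.sq2_nonneg hx)
  · have h4 : 0 < ‖b‖ ^ 2 := by positivity
    nlinarith

theorem sq2_mul_le {a x : H →L[ℂ] H} (ha : a ∈ M) (hx : x ∈ M) :
    sq2 τ (a * x) ≤ ‖a‖ ^ 2 * sq2 τ x := by
  have h1 : star a * a ≤ (‖a‖ ^ 2) • (1 : H →L[ℂ] H) := by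
    have := CStarAlgebra.star_mul_le_algebraMap_norm_sq (a := a)
    rwa [Algebra.algebraMap_eq_smul_one] at this
  have h2 := star_left_conjugate_le_conjugate h1 x
  have hm := hτ.vna.mul_mem
  have hxs := hτ.vna.star_mem x hx
  have has := hτ.vna.star_mem a ha
  have h3 := hτ.re_mono (hm _ (hm _ hxs _ (hm _ has _ ha)) _ hx)
    (hm _ (hm _ hxs _ (hτ.vna.real_smul_mem _ hτ.vna.one_mem)) _ hx) h2
  have h4 : star x * (‖a‖ ^ 2) • (1 : H →L[ℂ] H) * x = ((‖a‖ ^ 2 : ℝ) : ℂ) • (star x * x) := by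
    rw [Complex.coe_smul]
    simp
  rw [h4, map_smul, smul_eq_mul, Complex.re_ofReal_mul] at h3
  rw [sq2, sq2]
  convert h3 using 3
  simp [mul_assoc]

theorem sq2_mul_le' {a x : H →L[ℂ] H} (ha : a ∈ M) (hx : x ∈ M) :
    sq2 τ (x * a) ≤ ‖a‖ ^ 2 * sq2 τ x := by
  have := hτ.sq2_mul_le (hτ.vna.star_mem _ ha) (hτ.vna.star_mem _ hx)
  rwa [← star_mul, hτ.sq2_star (hτ.vna.mul_mem _ hx _ ha), hτ.sq2_star hx, norm_star] at this

end TracialState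

end

section

theorem IsSelfAdjoint.neg_norm_smul_le {a : H →L[ℂ] H} (ha : IsSelfAdjoint a) :
    -(‖a‖ • (1 : H →L[ℂ] H)) ≤ a := by
  have := ha.neg_algebraMap_norm_le_self
  rwa [Algebra.algebraMap_eq_smul_one] at this

theorem IsSelfAdjoint.le_norm_smul {a : H →L[ℂ] H} (ha : IsSelfAdjoint a) :
    a ≤ ‖a‖ • (1 : H →L[ℂ] H) := by
  have := ha.le_algebraMap_norm_self
  rwa [Algebra.algebraMap_eq_smul_one] at this

theorem norm_le_one_of_nonneg {a : H →L[ℂ] H} (h0 : 0 ≤ a) (h1 : a ≤ 1) : ‖a‖ ≤ 1 :=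
  (CStarAlgebra.norm_le_one_iff_of_nonneg a h0).2 h1

namespace IsVonNeumannAlgebra

variable {M : Set (H →L[ℂ] H)} (hM : IsVonNeumannAlgebra M)
include hM

/-- To prove a linear property of all elements of a von Neumann algebra, it suffices to treat
positive contractions. -/
theorem linear_induction {P : (H →L[ℂ] H) → Prop}
    (hadd : ∀ x ∈ M, ∀ y ∈ M, P x → P y → P (x + y))
    (hsmul : ∀ (c : ℂ), ∀ x ∈ M, P x → P (c • x))
    (hpos : ∀ x ∈ M, 0 ≤ x → x ≤ 1 → P x) {x : H →L[ℂ] H} (hx : x ∈ M) : P x := by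
  have hsa : ∀ a ∈ M, IsSelfAdjoint a → P a := by
    intro a ha hsa
    obtain ⟨r, hr, hrn⟩ : ∃ r : ℝ, 0 < r ∧ ‖a‖ ≤ r :=
      ⟨‖a‖ + 1, by positivity, by linarith⟩
    have hle : ‖a‖ • (1 : H →L[ℂ] H) ≤ r • (1 : H →L[ℂ] H) :=
      smul_le_smul_of_nonneg_right hrn zero_le_one
    have h1 : 0 ≤ a + r • (1 : H →L[ℂ] H) := by
      have := hsa.neg_norm_smul_le.trans' (neg_le_neg hle)
      exact neg_le_iff_add_nonneg.1 this
    have h2 : a + r • (1 : H →L[ℂ] H) ≤ (2 * r) • (1 : H →L[ℂ] H) := by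
      rw [two_mul, add_smul]
      exact add_le_add_left (hsa.le_norm_smul.trans hle) _
    have hm : a + r • (1 : H →L[ℂ] H) ∈ M :=
      hM.add_mem _ ha _ (hM.real_smul_mem r hM.one_mem)
    have h3 : P ((2 * r)⁻¹ • (a + r • (1 : H →L[ℂ] H))) := by
      refine hpos _ (hM.real_smul_mem _ hm) (smul_nonneg (by positivity) h1) ?_
      have := smul_le_smul_of_nonneg_left h2 (a := (2 * r)⁻¹) (by positivity)
      rwa [smul_smul, inv_mul_cancel₀ (by positivity), one_smul] at this
    have h4 := hadd _ (hM.smul_mem _ _ (hM.real_smul_mem _ hm)) _ (hM.smul_mem _ _ hM.one_mem)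
      (hsmul ((2 * r : ℝ) : ℂ) _ (hM.real_smul_mem _ hm) h3)
      (hsmul ((-r : ℝ) : ℂ) _ hM.one_mem (hpos 1 hM.one_mem zero_le_one le_rfl))
    rw [Complex.coe_smul, Complex.coe_smul, smul_smul, mul_inv_cancel₀ (by positivity), one_smul,
      neg_smul] at h4
    simpa using h4
  have hxs := hM.star_mem x hx
  have ha : ((1 / 2 : ℂ) • (x + star x)) ∈ M := hM.smul_mem _ _ (hM.add_mem _ hx _ hxs)
  have hb : (((1 / 2 : ℂ) * Complex.I) • (star x - x)) ∈ M :=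
    hM.smul_mem _ _ (hM.sub_mem hxs hx)
  have e : x = (1 / 2 : ℂ) • (x + star x) +
      (-(-Complex.I)) • (((1 / 2 : ℂ) * Complex.I) • (star x - x)) := by
    rw [smul_smul]
    have : -(-Complex.I) * ((1 / 2 : ℂ) * Complex.I) = -(1 / 2) := by
      linear_combination (1 / 2 : ℂ) * Complex.I_mul_I
    have h2 : x + star x - (star x - x) = (2 : ℂ) • x := by
      rw [two_smul]
      abel
    rw [this, neg_smul, ← sub_eq_add_neg, ← smul_sub, h2, smul_smul]
    norm_num
  rw [e]
  refine hadd _ ha _ (hM.smul_mem _ _ hb) (hsa _ ha ?_) (hsmul _ _ hb (hsa _ hb ?_))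
  · rw [IsSelfAdjoint, star_smul, star_add, star_star, add_comm]
    simp
  · rw [IsSelfAdjoint, star_smul, star_sub, star_star, ← neg_sub, smul_neg, ← neg_smul]
    simp

end IsVonNeumannAlgebra

namespace NormalTrace

variable {M : Set (H →L[ℂ] H)} {τ : (H →L[ℂ] H) →ₗ[ℂ] ℂ} (hτ : NormalTrace M τ)
include hτ

theorem sq2_le_of_tendsto {ι : Type*} {F : Filter ι} [F.NeBot] {f : ι → H →L[ℂ] H}
    {x : H →L[ℂ] H} {c : ι → ℝ} {m : ℝ} (C : ℝ) (hf : ∀ᶠ i in F, f i ∈ M ∧ ‖f i‖ ≤ C)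
    (hx : WLim F f x) (hc : ∀ᶠ i in F, sq2 τ (f i) ≤ c i) (hm : Filter.Tendsto c F (nhds m)) :
    sq2 τ x ≤ m := by
  have hxM : x ∈ M := hx.mem hτ.vna (hf.mono fun _ h => h.1)
  have hxs := hτ.vna.star_mem x hxM
  have h1 := hτ.tendsto (‖star x‖ * C) (hf.mono fun i hi => ⟨hτ.vna.mul_mem _ hxs _ hi.1,
    (norm_mul_le _ _).trans (by gcongr; exact hi.2)⟩) (hx.mul_left (star x))
  have h2 : ‖τ (star x * x)‖ ^ 2 ≤ sq2 τ x * m :=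
    le_of_tendsto_of_tendsto (h1.norm.pow 2) (hm.const_mul _) (by
      filter_upwards [hf, hc] with i hi hci
      exact (hτ.cauchy_schwarz hi.1 hxM).trans
        (mul_le_mul_of_nonneg_left hci (hτ.sq2_nonneg hxM)))
  have h0 := hτ.sq2_nonneg hxM
  rw [hτ.apply_star_mul_self hxM, Complex.norm_real, Real.norm_eq_abs, sq_abs] at h2
  rcases h0.eq_or_lt with h | h
  · rw [← h]
    refine ge_of_tendsto hm ?_
    filter_upwards [hf, hc] with i hi hci
    exact (hτ.sq2_nonneg hi.1).trans hci
  · nlinarith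

theorem sq2_clamp_le {x b : H →L[ℂ] H} (hx : x ∈ M) (hb : b ∈ M) (h0 : 0 ≤ x) (h1 : x ≤ 1)
    (hsa : IsSelfAdjoint b) :
    sq2 τ (x - cfc (fun t : ℝ => max 0 (min t 1)) b) ≤ sq2 τ (x - b) := by
  set c := cfc (fun t : ℝ => max 0 (min t 1)) b with hc
  set n := cfc (fun t : ℝ => max 0 (-t)) b with hn
  set p := cfc (fun t : ℝ => max 0 (t - 1)) b with hp
  have hcM : c ∈ M := hτ.vna.cfc_mem hb _
  have hnM : n ∈ M := hτ.vna.cfc_mem hb _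
  have hpM : p ∈ M := hτ.vna.cfc_mem hb _
  have hn0 : 0 ≤ n := cfc_nonneg fun _ _ => le_max_left _ _
  have hp0 : 0 ≤ p := cfc_nonneg fun _ _ => le_max_left _ _
  have e1 : c * n = 0 := by
    rw [hc, hn, ← cfc_mul .., ← cfc_zero ℝ b]
    refine cfc_congr fun t _ => ?_
    rcases le_total t 0 with h | h
    · simp [min_eq_left (h.trans zero_le_one), max_eq_left h]
    · simp [h]
  have e2 : c * p = p := by
    rw [hc, hp, ← cfc_mul ..]
    refine cfc_congr fun t _ => ?_
    rcases le_total t 1 with h | h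
    · simp [h]
    · simp [h]
  have e3 : c - b = n - p := by
    rw [hc, hn, hp]
    conv_lhs => rw [← cfc_id ℝ b]
    rw [cfc_id ℝ b]
    nth_rewrite 2 [← cfc_id ℝ b]
    rw [← cfc_sub .., ← cfc_sub ..]
    refine cfc_congr fun t _ => ?_
    simp only [id]
    rcases le_total t 0 with h | h
    · simp [h, h.trans zero_le_one]
    · rcases le_total t 1 with h' | h'
      · simp [h, h']
      · simp [h, h']
  have hcs : star c = c := (cfc_predicate _ b : IsSelfAdjoint c).star_eq
  have hxs : star x = x := (IsSelfAdjoint.of_nonneg h0).star_eq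
  have hm := hτ.vna.mul_mem
  have key := hτ.sq2_add_smul (hτ.vna.sub_mem hnM hpM) (hτ.vna.sub_mem hx hcM) 1
  rw [one_smul, ← e3] at key
  have e4 : x - c + (c - b) = x - b := by abel
  have e5 : star (x - c) * (c - b) = x * n + (1 - x) * p := by
    rw [e3, star_sub, hcs, hxs, sub_mul, mul_sub, mul_sub, e1, e2, sub_mul, one_mul]
    abel
  rw [e4, e5] at key
  have h2 := hτ.re_mul_nonneg hx hnM h0 hn0
  have h3 := hτ.re_mul_nonneg (hτ.vna.sub_mem hτ.vna.one_mem hx) hpM (sub_nonneg.2 h1) hp0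
  have h4 := hτ.sq2_nonneg (hτ.vna.sub_mem hcM hb)
  simp only [map_add, one_mul, Complex.add_re, norm_one, one_pow] at key
  linarith

theorem exists_condExp_of_nonneg {B : Set (H →L[ℂ] H)} (hB : IsVonNeumannAlgebra B) (hBM : B ⊆ M)
    {x : H →L[ℂ] H} (hx : x ∈ M) (h0 : 0 ≤ x) (h1 : x ≤ 1) :
    ∃ e ∈ B, ∀ b ∈ B, τ ((x - e) * b) = 0 := by
  set K : Set (H →L[ℂ] H) := {b | b ∈ B ∧ 0 ≤ b ∧ b ≤ 1} with hK
  have hbdd : BddBelow ((fun b => sq2 τ (x - b)) '' K) :=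
    ⟨0, by rintro _ ⟨b, hb, rfl⟩; exact hτ.sq2_nonneg (hτ.vna.sub_mem hx (hBM hb.1))⟩
  have hne : ((fun b => sq2 τ (x - b)) '' K).Nonempty :=
    ⟨_, 0, ⟨hB.zero_mem, le_rfl, zero_le_one⟩, rfl⟩
  set m := sInf ((fun b => sq2 τ (x - b)) '' K) with hm
  have hseq : ∀ n : ℕ, ∃ b ∈ K, sq2 τ (x - b) < m + 1 / ((n : ℝ) + 1) := by
    intro n
    obtain ⟨_, ⟨b, hb, rfl⟩, hlt⟩ := exists_lt_of_csInf_lt hne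
      (show m < m + 1 / ((n : ℝ) + 1) by linarith [Nat.one_div_pos_of_nat (α := ℝ) (n := n)])
    exact ⟨b, hb, hlt⟩
  choose f hfK hf using hseq
  obtain ⟨e, he⟩ := WLim.exists_of_bounded (Filter.hyperfilter ℕ)
    (fun n => norm_le_one_of_nonneg (hfK n).2.1 (hfK n).2.2)
  have heB : e ∈ B := he.mem hB (.of_forall fun n => (hfK n).1)
  have he0 : 0 ≤ e := he.nonneg (.of_forall fun n => (hfK n).2.1)
  have he1 : e ≤ 1 := he.le (WLim.const _ 1) (.of_forall fun n => (hfK n).2.2)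
  have hem : sq2 τ (x - e) ≤ m := by
    refine hτ.sq2_le_of_tendsto (F := (Filter.hyperfilter ℕ : Filter ℕ)) (‖x‖ + 1)
      (.of_forall fun n => ?_) ((WLim.const _ x).sub he) (.of_forall fun n => (hf n).le) ?_
    · exact ⟨hτ.vna.sub_mem hx (hBM (hfK n).1), (norm_sub_le _ _).trans
        (by gcongr; exact norm_le_one_of_nonneg (hfK n).2.1 (hfK n).2.2)⟩
    · have h2 := tendsto_one_div_add_atTop_nhds_zero_nat (𝕜 := ℝ)
      have h3 := (h2.const_add m).mono_left Nat.hyperfilter_le_atTop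
      simpa using h3
  have hmin : ∀ b ∈ B, IsSelfAdjoint b → sq2 τ (x - e) ≤ sq2 τ (x - b) := by
    intro b hb hsa
    refine hem.trans (le_trans (csInf_le hbdd ⟨_, ⟨hB.cfc_mem hb _, ?_, ?_⟩, rfl⟩)
      (hτ.sq2_clamp_le hx (hBM hb) h0 h1 hsa))
    · exact cfc_nonneg fun _ _ => le_max_left _ _
    · exact cfc_le_one _ _ fun _ _ => max_le zero_le_one (min_le_right _ _)
  have hxs : star (x - e) = x - e := by
    rw [star_sub, (IsSelfAdjoint.of_nonneg h0).star_eq, (IsSelfAdjoint.of_nonneg he0).star_eq]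
  have hxe : x - e ∈ M := hτ.vna.sub_mem hx (hBM heB)
  have horth : ∀ b ∈ B, IsSelfAdjoint b → τ ((x - e) * b) = 0 := by
    intro b hb hsa
    have him : (τ ((x - e) * b)).im = 0 := by
      have h2 := hτ.apply_star (hτ.vna.mul_mem _ hxe _ (hBM hb))
      rw [star_mul, hxs, hsa.star_eq, hτ.tracial _ (hBM hb) _ hxe] at h2
      have := congrArg Complex.im h2
      simp at this
      linarith
    have hre : ∀ t : ℝ, 0 ≤ sq2 τ b * (t * t) + (2 * (τ ((x - e) * b)).re) * t + 0 := by
      intro t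
      have h2 := hmin (e - (t : ℂ) • b) (hB.sub_mem heB (hB.smul_mem _ _ hb))
        ((IsSelfAdjoint.of_nonneg he0).sub (by
          rw [IsSelfAdjoint, star_smul, hsa.star_eq]
          simp only [RCLike.star_def, Complex.conj_ofReal]))
      have h3 := hτ.sq2_add_smul (hBM hb) hxe (t : ℂ)
      rw [sub_sub_eq_add_sub, add_sub_right_comm, h3, hxs, Complex.re_ofReal_mul,
        Complex.norm_real, Real.norm_eq_abs, sq_abs] at h2
      nlinarith
    have h4 := discrim_le_zero hre
    rw [discrim] at h4
    refine Complex.ext ?_ him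
    have : (τ ((x - e) * b)).re ^ 2 ≤ 0 := by nlinarith
    simpa using this
  refine ⟨e, heB, fun b hb => ?_⟩
  refine hB.linear_induction (P := fun b => τ ((x - e) * b) = 0) ?_ ?_ ?_ hb
  · intro b _ b' _ h h'
    rw [mul_add, map_add, h, h', add_zero]
  · intro c b _ h
    rw [mul_smul_comm, map_smul, h, smul_zero]
  · exact fun b hb h _ => horth b hb (.of_nonneg h)

/-- Existence of trace preserving conditional expectations. -/
theorem exists_condExp {B : Set (H →L[ℂ] H)} (hB : IsVonNeumannAlgebra B) (hBM : B ⊆ M) :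
    ∃ E, IsCondExp M B τ E := by
  have key : ∀ x : H →L[ℂ] H, ∃ e, x ∈ M → (e ∈ B ∧ ∀ b ∈ B, τ ((x - e) * b) = 0) := by
    intro x
    by_cases hx : x ∈ M
    · suffices h : ∃ e ∈ B, ∀ b ∈ B, τ ((x - e) * b) = 0 by
        obtain ⟨e, he⟩ := h
        exact ⟨e, fun _ => he⟩
      refine hτ.vna.linear_induction (P := fun x => ∃ e ∈ B, ∀ b ∈ B, τ ((x - e) * b) = 0)
        ?_ ?_ ?_ hx
      · rintro x - y - ⟨e, he, h⟩ ⟨e', he', h'⟩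
        refine ⟨e + e', hB.add_mem _ he _ he', fun b hb => ?_⟩
        rw [add_sub_add_comm, add_mul, map_add, h b hb, h' b hb, add_zero]
      · rintro c x - ⟨e, he, h⟩
        refine ⟨c • e, hB.smul_mem _ _ he, fun b hb => ?_⟩
        rw [← smul_sub, smul_mul_assoc, map_smul, h b hb, smul_zero]
      · exact fun x hx h0 h1 => hτ.exists_condExp_of_nonneg hB hBM hx h0 h1
    · exact ⟨0, fun h => absurd h hx⟩
  choose E hE using key
  exact ⟨E, fun x hx => (hE x hx).1, fun x hx => (hE x hx).2⟩

theorem mem_of_approx {B : Set (H →L[ℂ] H)} (hB : IsVonNeumannAlgebra B) (hBM : B ⊆ M)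
    {x : H →L[ℂ] H} (hx : x ∈ M) (h : ∀ ε : ℝ, 0 < ε → ∃ b ∈ B, sq2 τ (x - b) < ε) : x ∈ B := by
  obtain ⟨E, hE1, hE2⟩ := hτ.exists_condExp hB hBM
  have hEx := hE1 x hx
  have hd : x - E x ∈ M := hτ.vna.sub_mem hx (hBM hEx)
  suffices h0 : sq2 τ (star (x - E x)) ≤ 0 by
    have h1 := hτ.sq2_star hd
    have h2 := hτ.eq_zero_of_sq2 hd (le_antisymm (h1 ▸ h0) (hτ.sq2_nonneg hd))
    rw [sub_eq_zero.1 h2]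
    exact hEx
  refine le_of_forall_pos_lt_add fun ε hε => ?_
  obtain ⟨b, hb, hlt⟩ := h ε hε
  have hds := hτ.vna.star_mem _ hd
  have hc : star (E x - b) ∈ B := hB.star_mem _ (hB.sub_mem hEx hb)
  have h3 := hτ.sq2_add_smul (hBM hc) hds 1
  have h4 : star (x - E x) + star (E x - b) = star (x - b) := by rw [← star_add]; congr 1; abel
  rw [one_smul, h4, star_star, hE2 x hx _ hc, hτ.sq2_star (hτ.vna.sub_mem hx (hBM hb))] at h3
  have h5 := hτ.sq2_nonneg (hBM hc)
  simp only [mul_zero, Complex.zero_re, norm_one, one_pow, one_mul] at h3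
  linarith

end NormalTrace

end

section

/-! ### Projections of an abelian von Neumann algebra -/

/-- `A` is an abelian von Neumann algebra. -/
class AbelianVN (A : Set (H →L[ℂ] H)) : Prop where
  vna : IsVonNeumannAlgebra A
  comm : ∀ a ∈ A, ∀ b ∈ A, a * b = b * a

/-- The projections belonging to `A`. -/
@[ext]
structure Pr (A : Set (H →L[ℂ] H)) where
  /-- the underlying operator -/
  op : H →L[ℂ] H
  mem : op ∈ A
  idem : op * op = op
  sa : star op = op

theorem map_mem_of_mem_closure_span {H' : Type*} [NormedAddCommGroup H'] [NormedSpace ℂ H']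
    {s : Set H} (T : H →L[ℂ] H') (K : Submodule ℂ H') (hK : IsClosed (K : Set H'))
    (h : ∀ v ∈ s, T v ∈ K) {v : H} (hv : v ∈ (Submodule.span ℂ s).topologicalClosure) :
    T v ∈ K := by
  have h1 : Submodule.span ℂ s ≤ K.comap (T : H →ₗ[ℂ] H') := Submodule.span_le.2 h
  have h2 : IsClosed ((K.comap (T : H →ₗ[ℂ] H') : Submodule ℂ H) : Set H) :=
    hK.preimage T.continuous
  exact Submodule.topologicalClosure_minimal _ h1 h2 hv

theorem eq_zero_of_mem_closure_span {H' : Type*} [NormedAddCommGroup H'] [NormedSpace ℂ H']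
    {s : Set H} (T : H →L[ℂ] H')
    (h : ∀ v ∈ s, T v = 0) {v : H} (hv : v ∈ (Submodule.span ℂ s).topologicalClosure) :
    T v = 0 := by
  have := map_mem_of_mem_closure_span T ⊥ (by simp) (by simpa using h) hv
  simpa using this

/-- The projection onto the closed linear span of a set of vectors. -/
def spanProj (s : Set H) : H →L[ℂ] H := (Submodule.span ℂ s).topologicalClosure.starProjection

theorem spanProj_idem (s : Set H) : spanProj s * spanProj s = spanProj s :=
  (isStarProjection_starProjection (U := (Submodule.span ℂ s).topologicalClosure)).isIdempotentElem

theorem star_spanProj (s : Set H) : star (spanProj s) = spanProj s :=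
  (isStarProjection_starProjection
    (U := (Submodule.span ℂ s).topologicalClosure)).isSelfAdjoint.star_eq

theorem spanProj_apply_of_mem {s : Set H} {v : H} (hv : v ∈ s) : spanProj s v = v :=
  Submodule.starProjection_eq_self_iff.2
    (Submodule.le_topologicalClosure _ (Submodule.subset_span hv))

theorem mul_spanProj_eq_zero {s : Set H} {T : H →L[ℂ] H} (h : ∀ v ∈ s, T v = 0) :
    T * spanProj s = 0 := by
  ext v
  exact eq_zero_of_mem_closure_span T h (Submodule.starProjection_apply_mem _ v)

theorem IsVonNeumannAlgebra.spanProj_mem {M : Set (H →L[ℂ] H)} (hM : IsVonNeumannAlgebra M)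
    {s : Set H} (hs : ∀ y ∈ M.centralizer, ∀ v ∈ s, y v ∈ s) : spanProj s ∈ M := by
  refine hM.starProjection_mem _ fun y hy v hv => ?_
  refine map_mem_of_mem_closure_span y _ (Submodule.isClosed_topologicalClosure _) ?_ hv
  exact fun w hw => Submodule.le_topologicalClosure _ (Submodule.subset_span (hs y hy w hw))

namespace Pr

variable {A : Set (H →L[ℂ] H)} [hA : AbelianVN A]

theorem mul_comm (p q : Pr A) : p.op * q.op = q.op * p.op := hA.comm _ p.mem _ q.mem

instance : PartialOrder (Pr A) where
  le p q := p.op * q.op = p.op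
  le_refl p := p.idem
  le_trans p q r hpq hqr := show _ = _ by rw [← hpq, mul_assoc, hqr]
  le_antisymm p q hpq hqp := Pr.ext (by rw [← hpq, p.mul_comm, hqp])

theorem le_iff {p q : Pr A} : p ≤ q ↔ p.op * q.op = p.op := Iff.rfl

theorem le_iff' {p q : Pr A} : p ≤ q ↔ q.op * p.op = p.op := by rw [le_iff, p.mul_comm]

theorem le_iff_compl {p q : Pr A} : p ≤ q ↔ (1 - q.op) * p.op = 0 := by
  rw [le_iff', sub_mul, one_mul, sub_eq_zero, eq_comm]

instance : Max (Pr A) where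
  max p q := ⟨p.op + q.op - p.op * q.op,
    hA.vna.sub_mem (hA.vna.add_mem _ p.mem _ q.mem) (hA.vna.mul_mem _ p.mem _ q.mem), by
      have e : q.op * p.op * q.op = p.op * q.op := by rw [← p.mul_comm, mul_assoc, q.idem]
      have e' : q.op * (p.op * q.op) = p.op * q.op := by rw [← mul_assoc, e]
      have e'' : p.op * (p.op * q.op) = p.op * q.op := by rw [← mul_assoc, p.idem]
      simp only [mul_add, add_mul, mul_sub, sub_mul, p.idem, q.idem, ← p.mul_comm, mul_assoc, e',
        e'']
      abel, by
      rw [star_sub, star_add, star_mul, p.sa, q.sa, p.mul_comm]⟩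

instance : Min (Pr A) where
  min p q := ⟨p.op * q.op, hA.vna.mul_mem _ p.mem _ q.mem, by
      rw [mul_assoc, ← mul_assoc q.op, ← p.mul_comm, mul_assoc, q.idem, ← mul_assoc, p.idem], by
      rw [star_mul, p.sa, q.sa, p.mul_comm]⟩

instance : Top (Pr A) := ⟨⟨1, hA.vna.one_mem, one_mul 1, star_one _⟩⟩

instance : Bot (Pr A) := ⟨⟨0, hA.vna.zero_mem, zero_mul 0, star_zero _⟩⟩

instance : Compl (Pr A) where
  compl p := ⟨1 - p.op, hA.vna.sub_mem hA.vna.one_mem p.mem, by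
    simp [mul_sub, sub_mul, p.idem], by rw [star_sub, star_one, p.sa]⟩

@[simp] theorem sup_op (p q : Pr A) : (p ⊔ q).op = p.op + q.op - p.op * q.op := rfl
@[simp] theorem inf_op (p q : Pr A) : (p ⊓ q).op = p.op * q.op := rfl
@[simp] theorem top_op : (⊤ : Pr A).op = 1 := rfl
@[simp] theorem bot_op : (⊥ : Pr A).op = 0 := rfl
@[simp] theorem compl_op (p : Pr A) : (pᶜ).op = 1 - p.op := rfl

instance : BooleanAlgebra (Pr A) where
  sup := max
  inf := min
  le_sup_left p q := by
    rw [le_iff, sup_op, mul_sub, mul_add, p.idem, ← mul_assoc, p.idem]; abel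
  le_sup_right p q := by
    rw [le_iff, sup_op, mul_sub, mul_add, q.idem, p.mul_comm, ← mul_assoc, q.idem]; abel
  sup_le p q r hp hq := by
    rw [le_iff] at *
    rw [sup_op, sub_mul, add_mul, hp, mul_assoc, hq]
  inf_le_left p q := by
    rw [le_iff, inf_op, p.mul_comm, mul_assoc, p.idem]
  inf_le_right p q := by
    rw [le_iff, inf_op, mul_assoc, q.idem]
  le_inf p q r hq hr := by
    rw [le_iff] at *
    rw [inf_op, ← mul_assoc, hq, hr]
  le_sup_inf p q r := by
    rw [le_iff]
    simp only [sup_op, inf_op]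
    have e1 : q.op * p.op = p.op * q.op := q.mul_comm p
    have e2 : r.op * p.op = p.op * r.op := r.mul_comm p
    have e3 : r.op * q.op = q.op * r.op := r.mul_comm q
    have f1 : ∀ x, p.op * (p.op * x) = p.op * x := fun x => by rw [← mul_assoc, p.idem]
    have f2 : ∀ x, q.op * (q.op * x) = q.op * x := fun x => by rw [← mul_assoc, q.idem]
    have f3 : ∀ x, r.op * (r.op * x) = r.op * x := fun x => by rw [← mul_assoc, r.idem]
    have g1 : ∀ x, q.op * (p.op * x) = p.op * (q.op * x) := fun x => by
      rw [← mul_assoc, e1, mul_assoc]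
    have g2 : ∀ x, r.op * (p.op * x) = p.op * (r.op * x) := fun x => by
      rw [← mul_assoc, e2, mul_assoc]
    have g3 : ∀ x, r.op * (q.op * x) = q.op * (r.op * x) := fun x => by
      rw [← mul_assoc, e3, mul_assoc]
    simp only [mul_add, add_mul, mul_sub, sub_mul, mul_assoc, p.idem, r.idem, e1, e2,
      f1, f2, g1, g2, g3]
    abel
  top := ⊤
  bot := ⊥
  compl := compl
  inf_compl_le_bot p := by
    rw [le_iff]; simp [mul_sub, p.idem]
  top_le_sup_compl p := by
    rw [le_iff]; simp [mul_sub, p.idem]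
  le_top p := mul_one _
  bot_le p := zero_mul _

instance : SupSet (Pr A) where
  sSup S := ⟨spanProj {v | ∃ p ∈ S, p.op v = v}, hA.vna.spanProj_mem (by
    rintro y hy v ⟨p, hp, hv⟩
    refine ⟨p, hp, ?_⟩
    have := DFunLike.congr_fun (hy p.op p.mem) v
    simp only [mul_apply_eq_comp, hv] at this
    exact this), spanProj_idem _, star_spanProj _⟩

theorem le_sSup' {S : Set (Pr A)} {p : Pr A} (hp : p ∈ S) : p ≤ sSup S := by
  rw [le_iff']
  ext v
  refine spanProj_apply_of_mem ⟨p, hp, ?_⟩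
  exact DFunLike.congr_fun p.idem v

theorem sSup_le' {S : Set (Pr A)} {q : Pr A} (hq : ∀ p ∈ S, p ≤ q) : sSup S ≤ q := by
  rw [le_iff_compl]
  refine mul_spanProj_eq_zero ?_
  rintro v ⟨p, hp, hv⟩
  have := DFunLike.congr_fun (le_iff_compl.1 (hq p hp)) v
  simp only [mul_apply_eq_comp, hv] at this
  simpa using this

instance : CompleteBooleanAlgebra (Pr A) where
  __ := (inferInstance : BooleanAlgebra (Pr A))
  sSup := sSup
  isLUB_sSup S := ⟨fun _ hp => le_sSup' hp, fun _ hq => sSup_le' hq⟩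
  sInf S := (sSup (compl '' S))ᶜ
  isGLB_sInf S := by
    refine ⟨fun p hp => ?_, fun q hq => ?_⟩
    · exact compl_le_of_compl_le (le_sSup' (Set.mem_image_of_mem _ hp))
    · refine le_compl_of_le_compl (sSup_le' ?_)
      rintro _ ⟨p, hp, rfl⟩
      exact compl_le_compl (hq hp)

theorem isStarProjection (p : Pr A) : IsStarProjection p.op := ⟨p.idem, p.sa⟩

theorem nonneg (p : Pr A) : 0 ≤ p.op := p.isStarProjection.nonneg

theorem le_one (p : Pr A) : p.op ≤ 1 := p.isStarProjection.le_one

theorem norm_le (p : Pr A) : ‖p.op‖ ≤ 1 := p.isStarProjection.norm_le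

theorem disjoint_iff_mul {p q : Pr A} : Disjoint p q ↔ p.op * q.op = 0 := by
  rw [disjoint_iff, Pr.ext_iff]
  rfl

theorem mul_eq_conj {a : H →L[ℂ] H} (ha : a ∈ A) (p : Pr A) : a * p.op = p.op * a * p.op := by
  rw [hA.comm _ p.mem _ ha, mul_assoc, p.idem]

theorem mul_nonneg {a : H →L[ℂ] H} (ha : a ∈ A) (h : 0 ≤ a) (p : Pr A) : 0 ≤ a * p.op := by
  rw [mul_eq_conj ha]
  have := star_left_conjugate_nonneg h p.op
  rwa [p.sa] at this

theorem mul_le_mul {a b : H →L[ℂ] H} (ha : a ∈ A) (hb : b ∈ A) (h : a ≤ b) (p : Pr A) :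
    a * p.op ≤ b * p.op := by
  rw [← sub_nonneg, ← sub_mul]
  exact mul_nonneg (hA.vna.sub_mem hb ha) (sub_nonneg.2 h) p

theorem op_mono {p q : Pr A} (h : p ≤ q) : p.op ≤ q.op := by
  have := mul_le_mul p.mem hA.vna.one_mem p.le_one q
  rwa [le_iff.1 h, one_mul] at this

/-- The projection onto the closure of the range of an element of `A`. -/
def range {x : H →L[ℂ] H} (hx : x ∈ A) : Pr A :=
  ⟨spanProj (Set.range x), hA.vna.spanProj_mem (by
    rintro y hy _ ⟨v, rfl⟩
    exact ⟨y v, (DFunLike.congr_fun (hy x hx) v)⟩), spanProj_idem _, star_spanProj _⟩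

theorem range_mul {x : H →L[ℂ] H} (hx : x ∈ A) : (range hx).op * x = x := by
  ext v
  exact spanProj_apply_of_mem ⟨v, rfl⟩

theorem mul_range_eq_zero {x T : H →L[ℂ] H} (hx : x ∈ A) (h : T * x = 0) :
    T * (range hx).op = 0 := by
  refine mul_spanProj_eq_zero ?_
  rintro _ ⟨v, rfl⟩
  exact DFunLike.congr_fun h v

/-- The spectral projection of a self-adjoint element of `A` for the interval `(c, ∞)`. -/
def spec {a : H →L[ℂ] H} (ha : a ∈ A) (c : ℝ) : Pr A :=
  range (hA.vna.cfc_mem ha fun t => max 0 (t - c))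

section

variable {a : H →L[ℂ] H} (ha : a ∈ A) (hsa : IsSelfAdjoint a) (c : ℝ)
include hsa

theorem sub_mul_spec :
    (a - c • (1 : H →L[ℂ] H)) * (spec ha c).op = cfc (fun t : ℝ => max 0 (t - c)) a ∧
    (a - c • (1 : H →L[ℂ] H)) * (1 - (spec ha c).op) = -cfc (fun t : ℝ => max 0 (c - t)) a := by
  set p := cfc (fun t : ℝ => max 0 (t - c)) a with hp
  set n := cfc (fun t : ℝ => max 0 (c - t)) a with hn
  have hpA : p ∈ A := hA.vna.cfc_mem ha _
  have e1 : a - c • (1 : H →L[ℂ] H) = p - n := by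
    rw [hp, hn, ← Algebra.algebraMap_eq_smul_one, ← cfc_const c a]
    nth_rewrite 1 [← cfc_id ℝ a]
    rw [← cfc_sub .., ← cfc_sub ..]
    refine cfc_congr fun t _ => ?_
    simp only [id]
    rcases le_total t c with h | h
    · simp [h]
    · simp [h]
  have e2 : n * p = 0 := by
    rw [hp, hn, ← cfc_mul .., ← cfc_zero ℝ a]
    refine cfc_congr fun t _ => ?_
    rcases le_total t c with h | h
    · simp [h]
    · simp [h]
  have e3 : n * (spec ha c).op = 0 := mul_range_eq_zero _ e2
  have e4 : p * (spec ha c).op = p := by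
    rw [hA.comm _ hpA _ (spec ha c).mem]
    exact range_mul _
  rw [e1, mul_sub, mul_one, sub_mul, e3, e4]
  exact ⟨by abel, by abel⟩

theorem le_mul_spec : c • (spec ha c).op ≤ a * (spec ha c).op := by
  have h := (sub_mul_spec ha hsa c).1
  rw [sub_mul, smul_mul_assoc, one_mul] at h
  rw [← sub_nonneg, h]
  exact cfc_nonneg fun _ _ => le_max_left _ _

theorem mul_compl_spec_le : a * (1 - (spec ha c).op) ≤ c • (1 - (spec ha c).op) := by
  have h := (sub_mul_spec ha hsa c).2
  rw [sub_mul, smul_mul_assoc, one_mul] at h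
  rw [← sub_nonpos, h, neg_nonpos]
  exact cfc_nonneg fun _ _ => le_max_left _ _

theorem spec_le {q : Pr A} (h : a * (1 - q.op) ≤ c • (1 - q.op)) : spec ha c ≤ q := by
  set p := cfc (fun t : ℝ => max 0 (t - c)) a with hp
  have hpA : p ∈ A := hA.vna.cfc_mem ha _
  have h1 := (sub_mul_spec ha hsa c).1
  have h2 : 0 ≤ p * (qᶜ).op := mul_nonneg hpA (cfc_nonneg fun _ _ => le_max_left _ _) _
  have h3 := mul_le_mul (hA.vna.mul_mem _ ha _ (qᶜ).mem) (hA.vna.real_smul_mem c (qᶜ).mem)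
    h (spec ha c)
  have h4 : p * (qᶜ).op ≤ 0 := by
    rw [hp, ← h1, mul_assoc, (spec ha c).mul_comm, ← mul_assoc, sub_mul, smul_mul_assoc, one_mul,
      sub_mul, sub_nonpos]
    exact h3
  have h5 := le_antisymm h4 h2
  rw [le_iff_compl]
  refine mul_range_eq_zero _ ?_
  rw [hA.comm _ hpA _ (qᶜ).mem] at h5
  exact h5

end

theorem spec_mono {a b : H →L[ℂ] H} (ha : a ∈ A) (hb : b ∈ A) (hsa : IsSelfAdjoint a)
    (hsb : IsSelfAdjoint b) (h : a ≤ b) (c : ℝ) : spec ha c ≤ spec hb c :=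
  spec_le ha hsa c ((mul_le_mul ha hb h (spec hb c)ᶜ).trans (mul_compl_spec_le hb hsb c))

theorem exists_approx (n : ℕ) : ∀ a ∈ A, 0 ≤ a → a ≤ 1 →
    ∃ d ∈ Submodule.span ℂ (Set.range (Pr.op : Pr A → H →L[ℂ] H)), ‖a - d‖ ≤ (1 / 2) ^ n := by
  induction n with
  | zero =>
    exact fun a ha h0 h1 => ⟨0, zero_mem _, by simpa using norm_le_one_of_nonneg h0 h1⟩
  | succ n ih =>
    intro a ha h0 h1
    have hsa : IsSelfAdjoint a := .of_nonneg h0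
    set E := spec ha (1 / 2) with hE
    have h2 := le_mul_spec ha hsa (1 / 2)
    have h3 := mul_compl_spec_le ha hsa (1 / 2)
    have h4 := mul_nonneg ha h0 Eᶜ
    have h5 := mul_le_mul ha hA.vna.one_mem h1 E
    rw [← hE] at h2 h3
    rw [compl_op] at h4
    rw [mul_sub, mul_one] at h3 h4
    have e : ∀ x : H →L[ℂ] H, (2 : ℝ) • ((1 / 2 : ℝ) • x) = x := fun x => by
      rw [smul_smul]; norm_num
    have two_nonneg : (0 : ℝ) ≤ 2 := by norm_num
    have g1 : (0 : H →L[ℂ] H) ≤ a - (1 / 2 : ℝ) • E.op := by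
      have := add_le_add h2 h4
      rw [add_zero, add_sub_cancel] at this
      exact sub_nonneg.2 this
    have g2 : a - (1 / 2 : ℝ) • E.op ≤ (1 / 2 : ℝ) • (1 : H →L[ℂ] H) := by
      have := add_le_add h3 h5
      rw [sub_add_cancel, smul_sub, one_mul] at this
      rw [sub_le_iff_le_add]
      refine this.trans (le_of_eq ?_)
      have e' : E.op = (1 / 2 : ℝ) • E.op + (1 / 2 : ℝ) • E.op := by
        rw [← add_smul]; norm_num
      nth_rewrite 2 [e']
      abel
    obtain ⟨d, hd, hle⟩ := ih ((2 : ℝ) • (a - (1 / 2 : ℝ) • E.op))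
      (hA.vna.real_smul_mem _ (hA.vna.sub_mem ha (hA.vna.real_smul_mem _ E.mem)))
      (smul_nonneg two_nonneg g1) (by
        have := smul_le_smul_of_nonneg_left g2 two_nonneg
        rwa [e] at this)
    refine ⟨(1 / 2 : ℂ) • E.op + (1 / 2 : ℂ) • d, add_mem
      (Submodule.smul_mem _ _ (Submodule.subset_span ⟨E, rfl⟩)) (Submodule.smul_mem _ _ hd), ?_⟩
    have e2 : a - ((1 / 2 : ℂ) • E.op + (1 / 2 : ℂ) • d) =
        (1 / 2 : ℂ) • ((2 : ℝ) • (a - (1 / 2 : ℝ) • E.op) - d) := by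
      have c1 : ((1 / 2 : ℝ) • E.op) = (1 / 2 : ℂ) • E.op := by
        rw [← Complex.coe_smul]; norm_num
      rw [smul_sub, c1, ← Complex.coe_smul, smul_smul]
      norm_num
      abel
    rw [e2, norm_smul, pow_succ, _root_.mul_comm]
    norm_num
    simpa using hle

/-- An operator commuting with all projections of `A` commutes with `A`. -/
theorem commute_of_forall {T : H →L[ℂ] H} (h : ∀ p : Pr A, T * p.op = p.op * T) :
    ∀ a ∈ A, T * a = a * T := by
  intro a ha
  refine hA.vna.linear_induction (P := fun a => T * a = a * T) ?_ ?_ ?_ ha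
  · intro x _ y _ hx hy
    rw [mul_add, add_mul, hx, hy]
  · intro c x _ hx
    rw [mul_smul_comm, smul_mul_assoc, hx]
  · intro x hx h0 h1
    have hcl : x ∈ closure (Submodule.span ℂ (Set.range (Pr.op : Pr A → H →L[ℂ] H)) :
        Set (H →L[ℂ] H)) := by
      rw [Metric.mem_closure_iff]
      intro ε hε
      obtain ⟨n, hn⟩ := exists_pow_lt_of_lt_one hε (show (1 / 2 : ℝ) < 1 by norm_num)
      obtain ⟨d, hd, hle⟩ := exists_approx n x hx h0 h1
      exact ⟨d, hd, by rw [dist_eq_norm]; exact hle.trans_lt hn⟩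
    have hsub : (Submodule.span ℂ (Set.range (Pr.op : Pr A → H →L[ℂ] H)) : Set (H →L[ℂ] H)) ⊆
        ({T} : Set (H →L[ℂ] H)).centralizer := by
      intro d hd
      induction hd using Submodule.span_induction with
      | mem d hd =>
        obtain ⟨p, rfl⟩ := hd
        rintro _ rfl
        exact h p
      | zero => exact Set.zero_mem_centralizer
      | add d d' _ _ hd hd' => exact Set.add_mem_centralizer hd hd'
      | smul c d _ hd =>
        rintro _ rfl
        rw [mul_smul_comm, smul_mul_assoc, hd _ rfl]
    exact closure_minimal hsub (Set.isClosed_centralizer _) hcl T rfl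

/-! #### Finite partitions -/

theorem op_sup_id {s : Finset (Pr A)} (hs : (s : Set (Pr A)).PairwiseDisjoint id) :
    (s.sup id).op = ∑ p ∈ s, p.op := by
  classical
  induction s using Finset.induction_on with
  | empty => simp
  | insert p s hp ih =>
    rw [Finset.sup_insert, Finset.sum_insert hp, sup_op, id,
      ← ih (hs.subset (by simp))]
    have : Disjoint p (s.sup id) := by
      rw [Finset.disjoint_sup_right]
      intro q hq
      exact hs (by simp) (by simp [hq]) (by rintro rfl; exact hp hq)
    rw [disjoint_iff_mul.1 this, sub_zero]

theorem sum_parts (P : Finpartition (⊤ : Pr A)) : ∑ p ∈ P.parts, p.op = 1 := by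
  rw [← op_sup_id P.disjoint, P.sup_parts]
  rfl

end Pr

end

section

/-! ### Selection of disjoint images -/

theorem iInf_sup_chain {ι α : Type*} [CompleteBooleanAlgebra α] [Nonempty ι] {f g : ι → α}
    (h : ∀ i j, (f i ≤ f j ∧ g i ≤ g j) ∨ (f j ≤ f i ∧ g j ≤ g i)) :
    ⨅ i, (f i ⊔ g i) = (⨅ i, f i) ⊔ ⨅ i, g i := by
  refine le_antisymm ?_ (le_iInf fun i => sup_le_sup (iInf_le _ i) (iInf_le _ i))
  rw [iInf_sup_eq]
  refine le_iInf fun i => ?_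
  rw [sup_iInf_eq]
  refine le_iInf fun j => ?_
  rcases h i j with h | h
  · exact (iInf_le _ i).trans (sup_le_sup le_rfl h.2)
  · exact (iInf_le _ j).trans (sup_le_sup h.1 le_rfl)

/-- A join preserving map into a complete Boolean algebra dominates a join preserving map with the
same value at the top which sends complements to disjoint elements. -/
theorem exists_disjoint_selection {α β : Type*} [BooleanAlgebra α] [CompleteBooleanAlgebra β]
    (S : α → β) (hS0 : S ⊥ = ⊥) (hS : ∀ p q, S (p ⊔ q) = S p ⊔ S q) :
    ∃ θ : α → β, (∀ p, θ p ≤ S p) ∧ (∀ p q, θ (p ⊔ q) = θ p ⊔ θ q) ∧ θ ⊤ = S ⊤ ∧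
      ∀ p, Disjoint (θ p) (θ pᶜ) := by
  obtain ⟨θ, hle, hmin⟩ := zorn_le_nonempty₀ (α := (α → β)ᵒᵈ)
    {θ | (∀ p q, OrderDual.ofDual θ (p ⊔ q) = OrderDual.ofDual θ p ⊔ OrderDual.ofDual θ q) ∧
      OrderDual.ofDual θ ⊤ = S ⊤} (by
    intro c hc hchain y hy
    have : Nonempty c := ⟨⟨y, hy⟩⟩
    refine ⟨OrderDual.toDual fun p => ⨅ θ : c, OrderDual.ofDual θ.1 p, ⟨fun p q => ?_, ?_⟩, ?_⟩
    · simp only [OrderDual.ofDual_toDual]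
      rw [← iInf_sup_chain]
      · exact iInf_congr fun θ => (hc θ.2).1 p q
      · intro i j
        rcases hchain.total i.2 j.2 with h | h
        · exact Or.inr ⟨h p, h q⟩
        · exact Or.inl ⟨h p, h q⟩
    · simp only [OrderDual.ofDual_toDual]
      rw [iInf_congr fun θ : c => (hc θ.2).2, iInf_const]
    · intro θ hθ p
      exact iInf_le (fun θ : c => OrderDual.ofDual θ.1 p) ⟨θ, hθ⟩) (OrderDual.toDual S) ⟨hS, rfl⟩
  obtain ⟨⟨hsup, htop⟩, hmax⟩ := hmin
  set φ : α → β := OrderDual.ofDual θ with hφ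
  refine ⟨φ, hle, hsup, htop, fun p => ?_⟩
  have hmono : ∀ p q, p ≤ q → φ p ≤ φ q := by
    intro p q h
    rw [← sup_eq_right.2 h, hsup]
    exact le_sup_left
  set r := φ p ⊓ φ pᶜ with hr
  let ψ : α → β := fun q => (φ q ⊓ rᶜ) ⊔ (φ (q ⊓ p) ⊓ r)
  have hψle : ∀ q, ψ q ≤ φ q := fun q =>
    sup_le inf_le_left (inf_le_left.trans (hmono _ _ inf_le_left))
  have hψ : OrderDual.toDual ψ ≤ θ := by
    refine hmax ⟨fun q q' => ?_, ?_⟩ hψle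
    · simp only [OrderDual.ofDual_toDual, ψ]
      rw [hsup, inf_sup_right, inf_sup_right, hsup, inf_sup_right, sup_sup_sup_comm]
    · simp only [OrderDual.ofDual_toDual, ψ]
      rw [top_inf_eq, ← htop]
      have h1 : φ p ⊓ r = r := inf_eq_right.2 inf_le_left
      have h2 : r ≤ φ ⊤ := inf_le_left.trans (hmono _ _ le_top)
      rw [h1, sup_inf_right, compl_sup_eq_top, inf_top_eq, sup_eq_left.2 h2]
  have h3 : φ pᶜ ≤ ψ pᶜ := hψ pᶜ
  have h4 : φ ⊥ = ⊥ := le_bot_iff.1 ((hle ⊥).trans hS0.le)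
  have h5 : r ≤ rᶜ := by
    have h6 : r ≤ ψ pᶜ := inf_le_right.trans h3
    simp only [ψ, compl_inf_eq_bot, h4, bot_inf_eq, sup_bot_eq] at h6
    exact h6.trans inf_le_right
  rw [disjoint_iff]
  exact le_compl_self.1 h5

/-- The partition of the top element into an element and its complement. -/
def complPartition {α : Type*} [BooleanAlgebra α] [DecidableEq α] (p : α) :
    Finpartition (⊤ : α) :=
  Finpartition.ofErase {p, pᶜ} (by
    by_cases h : p = pᶜ
    · rw [← h]; simp
    · rw [Finset.supIndep_pair h]; exact disjoint_compl_right) (by simp)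

theorem le_or_le_compl_of_le {α : Type*} [BooleanAlgebra α] [DecidableEq α] {p : α}
    {P : Finpartition (⊤ : α)} (h : P ≤ complPartition p) {b : α} (hb : b ∈ P.parts) :
    b ≤ p ∨ b ≤ pᶜ := by
  obtain ⟨c, hc, hbc⟩ := h hb
  have : c = p ∨ c = pᶜ := by
    have := Finset.mem_of_mem_erase hc
    simpa using this
  rcases this with rfl | rfl
  · exact Or.inl hbc
  · exact Or.inr hbc

/-- A monotone map into a complete Boolean algebra dominates a join preserving map which sends
complements to disjoint elements and whose top value is the infimum over all finite partitions. -/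
theorem exists_partition_selection {α β : Type*} [BooleanAlgebra α] [CompleteBooleanAlgebra β]
    (s : α → β) (hs : Monotone s) (h0 : s ⊥ = ⊥) :
    ∃ θ : α → β, (∀ p, θ p ≤ s p) ∧ (∀ p q, θ (p ⊔ q) = θ p ⊔ θ q) ∧
      θ ⊤ = ⨅ P : Finpartition (⊤ : α), P.parts.sup s ∧ ∀ p, Disjoint (θ p) (θ pᶜ) := by
  classical
  let R : Finpartition (⊤ : α) → α → β := fun P p => P.parts.sup fun b => s (p ⊓ b)
  have hR : ∀ P p, R P p ≤ s p := fun P p => Finset.sup_le fun b _ => hs inf_le_left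
  have hRle : ∀ P Q p, P ≤ Q → R P p ≤ R Q p := by
    intro P Q p h
    refine Finset.sup_le fun b hb => ?_
    obtain ⟨c, hc, hbc⟩ := h hb
    exact (hs (inf_le_inf_left p hbc)).trans (Finset.le_sup (f := fun b => s (p ⊓ b)) hc)
  have hmono : ∀ P p q, p ≤ q → R P p ≤ R P q := fun P p q h =>
    Finset.sup_mono_fun fun b _ => hs (inf_le_inf_right b h)
  have hS : ∀ p q, (⨅ P, R P (p ⊔ q)) = (⨅ P, R P p) ⊔ ⨅ P, R P q := by
    intro p q
    refine le_antisymm ?_ (sup_le (iInf_mono fun P => hmono P _ _ le_sup_left)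
      (iInf_mono fun P => hmono P _ _ le_sup_right))
    rw [iInf_sup_eq]
    refine le_iInf fun P => ?_
    rw [sup_iInf_eq]
    refine le_iInf fun Q => ?_
    refine (iInf_le _ (P ⊓ Q ⊓ complPartition p)).trans (Finset.sup_le fun b hb => ?_)
    rcases le_or_le_compl_of_le inf_le_right hb with h | h
    · have e : (p ⊔ q) ⊓ b = p ⊓ b := by
        rw [inf_eq_right.2 h, inf_eq_right.2 (h.trans le_sup_left)]
      rw [e]
      exact ((Finset.le_sup (f := fun b => s (p ⊓ b)) hb).trans
        (hRle _ P p (inf_le_left.trans inf_le_left))).trans le_sup_left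
    · have e : (p ⊔ q) ⊓ b = q ⊓ b := by
        rw [inf_sup_right, (disjoint_compl_right.mono_right h).eq_bot, bot_sup_eq]
      rw [e]
      exact ((Finset.le_sup (f := fun b => s (q ⊓ b)) hb).trans
        (hRle _ Q q (inf_le_left.trans inf_le_right))).trans le_sup_right
  have hbot : (⨅ P, R P ⊥) = ⊥ := le_bot_iff.1 ((iInf_le _ (complPartition ⊥)).trans ((hR _ _).trans h0.le))
  obtain ⟨θ, h1, h2, h3, h4⟩ := exists_disjoint_selection (fun p => ⨅ P, R P p) hbot hS
  refine ⟨θ, fun p => (h1 p).trans ((iInf_le _ (complPartition ⊥)).trans (hR _ _)), h2, ?_, h4⟩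
  simp only [h3, R, top_inf_eq]

namespace Pr

variable {A : Set (H →L[ℂ] H)} [hA : AbelianVN A]

theorem op_sup {ι : Type*} {s : Finset ι} {f : ι → Pr A}
    (hs : (s : Set ι).PairwiseDisjoint f) : (s.sup f).op = ∑ i ∈ s, (f i).op := by
  classical
  induction s using Finset.induction_on with
  | empty => simp
  | insert p s hp ih =>
    rw [Finset.sup_insert, Finset.sum_insert hp, sup_op, ← ih (hs.subset (by simp))]
    have : Disjoint (f p) (s.sup f) := by
      rw [Finset.disjoint_sup_right]
      intro q hq
      exact hs (by simp) (by simp [hq]) (by rintro rfl; exact hp hq)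
    rw [disjoint_iff_mul.1 this, sub_zero]

/-- A decreasing family of projections whose traces are bounded below has nonzero infimum. -/
theorem iInf_ne_bot {M : Set (H →L[ℂ] H)} {τ : (H →L[ℂ] H) →ₗ[ℂ] ℂ} (hτ : NormalTrace M τ)
    (hAM : A ⊆ M) {ι : Type*} (F : Ultrafilter ι) (r : ι → Pr A)
    (hr : ∀ j, ∀ᶠ i in (F : Filter ι), r i ≤ r j) {δ : ℝ} (hδ : 0 < δ)
    (h : ∀ i, δ ≤ (τ (r i).op).re) : ⨅ i, r i ≠ ⊥ := by
  obtain ⟨x, hx⟩ := WLim.exists_of_bounded F (f := fun i => (r i).op) (C := 1)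
    (fun i => (r i).norm_le)
  have hxA : x ∈ A := hx.mem hA.vna (.of_forall fun i => (r i).mem)
  have h1 : ∀ j, (1 - (r j).op) * x = 0 := by
    intro j
    have e1 := hx.mul_left (1 - (r j).op)
    refine e1.unique ((WLim.const _ 0).congr' ?_)
    filter_upwards [hr j] with i hi
    exact (le_iff_compl.1 hi).symm
  have h2 : Filter.Tendsto (fun i => τ (r i).op) F (nhds (τ x)) :=
    hτ.tendsto 1 (.of_forall fun i => ⟨hAM (r i).mem, (r i).norm_le⟩) hx
  have h3 : δ ≤ (τ x).re :=
    ge_of_tendsto ((Complex.continuous_re.tendsto _).comp h2) (.of_forall h)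
  have h4 : range hxA ≤ ⨅ i, r i :=
    le_iInf fun i => le_iff_compl.2 (mul_range_eq_zero hxA (h1 i))
  intro h5
  rw [h5, le_bot_iff] at h4
  have h6 := range_mul hxA
  rw [h4, bot_op, zero_mul] at h6
  rw [← h6] at h3
  simp at h3
  linarith

end Pr

end

section

/-! ### Extracting intertwiners -/

namespace NormalTrace

variable {M A : Set (H →L[ℂ] H)} {τ : (H →L[ℂ] H) →ₗ[ℂ] ℂ}

/-- An element of an abelian subalgebra is determined by its pairing with positive elements. -/
theorem eq_zero_of_apply_mul (hτ : NormalTrace M τ) {B : Set (H →L[ℂ] H)}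
    (hB : IsVonNeumannAlgebra B) (hBM : B ⊆ M) {m : H →L[ℂ] H}
    (hm : m ∈ B) (h : ∀ a ∈ B, 0 ≤ a → τ (m * a) = 0) : m = 0 := by
  have h1 : ∀ a ∈ B, τ (m * a) = 0 := fun a ha =>
    hB.linear_induction (P := fun a => τ (m * a) = 0)
      (fun x _ y _ hx hy => by rw [mul_add, map_add, hx, hy, add_zero])
      (fun c x _ hx => by rw [mul_smul_comm, map_smul, hx, smul_zero])
      (fun x hx h0 _ => h x hx h0) ha
  have h2 := h1 _ (hB.star_mem m hm)
  rw [← hτ.tracial _ (hBM (hB.star_mem m hm)) _ (hBM hm)] at h2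
  exact hτ.faithful m (hBM hm) h2

theorem nonneg_of_apply_mul_nonneg (hτ : NormalTrace M τ) {B : Set (H →L[ℂ] H)}
    (hB : IsVonNeumannAlgebra B) (hBM : B ⊆ M) {m : H →L[ℂ] H}
    (hm : m ∈ B) (h : ∀ a ∈ B, 0 ≤ a → 0 ≤ τ (m * a)) : 0 ≤ m := by
  have hms := hB.star_mem m hm
  have hsa : IsSelfAdjoint m := by
    have h0 : star m - m = 0 := by
      refine hτ.eq_zero_of_apply_mul hB hBM (hB.sub_mem hms hm) fun a ha h0 => ?_
      have ea : star a = a := (IsSelfAdjoint.of_nonneg h0).star_eq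
      have e1 : τ (star m * a) = star (τ (m * a)) := by
        rw [← hτ.tracial _ (hBM ha) _ (hBM hm), ← hτ.apply_star (hBM (hB.mul_mem _ ha _ hm)),
          star_mul, ea]
      have e2 : star (τ (m * a)) = τ (m * a) := (IsSelfAdjoint.of_nonneg (h a ha h0)).star_eq
      rw [sub_mul, map_sub, e1, e2, sub_self]
    exact sub_eq_zero.1 h0
  set n := cfc (fun t : ℝ => max 0 (-t)) m with hn
  have hnB : n ∈ B := hB.cfc_mem hm _
  have hn0 : 0 ≤ n := cfc_nonneg fun _ _ => le_max_left _ _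
  have hns : star n = n := (IsSelfAdjoint.of_nonneg hn0).star_eq
  have e1 : m * n = -(star n * n) := by
    rw [hns]
    conv_lhs => rw [← cfc_id ℝ m]
    rw [hn, ← cfc_mul _ _ m, ← cfc_mul _ _ m, ← cfc_neg]
    refine cfc_congr fun t _ => ?_
    rcases le_total t 0 with ht | ht
    · simp [max_eq_right (neg_nonneg.2 ht)]
    · simp [max_eq_left (neg_nonpos.2 ht)]
  have h2 := h n hnB hn0
  rw [e1, map_neg, neg_nonneg] at h2
  have h3 : n = 0 := hτ.faithful n (hBM hnB) (le_antisymm h2 (hτ.nonneg n (hBM hnB)))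
  have h4 : m = cfc (fun t : ℝ => max 0 t) m - n := by
    conv_lhs => rw [← cfc_id ℝ m]
    rw [hn, ← cfc_sub _ _ m]
    refine cfc_congr fun t _ => ?_
    rcases le_total t 0 with ht | ht
    · simp [max_eq_right (neg_nonneg.2 ht), max_eq_left ht]
    · simp [max_eq_left (neg_nonpos.2 ht), max_eq_right ht]
  rw [h4, h3, sub_zero]
  exact cfc_nonneg fun _ _ => le_max_left _ _

end NormalTrace

/-- `μ` represents the functionals `a ↦ τ(x* p x a)` on `A`. -/
structure Represents (A : Set (H →L[ℂ] H)) (τ : (H →L[ℂ] H) →ₗ[ℂ] ℂ) (x : H →L[ℂ] H)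
    (μ : Pr A → H →L[ℂ] H) : Prop where
  mem : ∀ p, μ p ∈ A
  apply : ∀ p, ∀ a ∈ A, τ (μ p * a) = τ (star x * p.op * x * a)

namespace Represents

variable {M A : Set (H →L[ℂ] H)} {τ : (H →L[ℂ] H) →ₗ[ℂ] ℂ} [hA : AbelianVN A]
  {x : H →L[ℂ] H} {μ : Pr A → H →L[ℂ] H} (hτ : NormalTrace M τ) (hAM : A ⊆ M) (hx : x ∈ M)
  (h : Represents A τ x μ)
include hτ hAM hx h

theorem mono : Monotone μ := by
  intro p q hpq
  rw [← sub_nonneg]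
  refine hτ.nonneg_of_apply_mul_nonneg hA.vna hAM (hA.vna.sub_mem (h.mem q) (h.mem p))
    fun a ha h0 => ?_
  have hxs := hτ.vna.star_mem x hx
  have h1 : 0 ≤ star x * (q.op - p.op) * x :=
    star_left_conjugate_nonneg (sub_nonneg.2 (Pr.op_mono hpq)) x
  obtain ⟨s, hs, -, hss, rfl⟩ := hA.vna.exists_star_mul_self ha h0
  rw [sub_mul, map_sub, h.apply _ _ ha, h.apply _ _ ha, ← map_sub, ← sub_mul, ← sub_mul,
    ← mul_sub, ← mul_assoc]
  have hm : star x * (q.op - p.op) * x ∈ M := hτ.vna.mul_mem _ (hτ.vna.mul_mem _ hxs _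
    (hτ.vna.sub_mem (hAM q.mem) (hAM p.mem))) _ hx
  rw [hτ.tracial _ (hτ.vna.mul_mem _ hm _ (hAM hs)) _ (hAM hs), ← mul_assoc]
  refine hτ.apply_nonneg (hτ.vna.mul_mem _ (hτ.vna.mul_mem _ (hAM hs) _ hm) _ (hAM hs)) ?_
  have := star_left_conjugate_nonneg h1 s
  rwa [hss] at this

theorem bot : μ ⊥ = 0 :=
  hτ.eq_zero_of_apply_mul hA.vna hAM (h.mem _) fun a ha _ => by rw [h.apply _ _ ha]; simp

theorem nonneg (p : Pr A) : 0 ≤ μ p := by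
  have := h.mono hτ hAM hx (bot_le : ⊥ ≤ p)
  rwa [h.bot hτ hAM hx] at this

theorem le_one (hx1 : ‖x‖ ≤ 1) (p : Pr A) : μ p ≤ 1 := by
  refine (h.mono hτ hAM hx le_top).trans ?_
  rw [← sub_nonneg]
  refine hτ.nonneg_of_apply_mul_nonneg hA.vna hAM (hA.vna.sub_mem hA.vna.one_mem (h.mem _))
    fun a ha h0 => ?_
  have hxs := hτ.vna.star_mem x hx
  have h1 : star x * x ≤ 1 := by
    have := CStarAlgebra.star_mul_le_algebraMap_norm_sq (a := x)
    rw [Algebra.algebraMap_eq_smul_one] at this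
    refine this.trans ?_
    have h2 : ‖x‖ ^ 2 ≤ 1 := by nlinarith [norm_nonneg x]
    have h3 := smul_le_smul_of_nonneg_right h2 (zero_le_one (α := H →L[ℂ] H))
    rwa [one_smul] at h3
  obtain ⟨s, hs, -, hss, rfl⟩ := hA.vna.exists_star_mul_self ha h0
  have hm : 1 - star x * x ∈ M := hτ.vna.sub_mem hτ.vna.one_mem (hτ.vna.mul_mem _ hxs _ hx)
  rw [sub_mul, map_sub, h.apply _ _ ha, Pr.top_op, mul_one, ← map_sub, ← sub_mul, ← mul_assoc]
  rw [hτ.tracial _ (hτ.vna.mul_mem _ hm _ (hAM hs)) _ (hAM hs), ← mul_assoc]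
  refine hτ.apply_nonneg (hτ.vna.mul_mem _ (hτ.vna.mul_mem _ (hAM hs) _ hm) _ (hAM hs)) ?_
  have := star_left_conjugate_nonneg (sub_nonneg.2 h1) s
  rwa [hss] at this

end Represents

end

section

theorem star_mul_self_le_one {x : H →L[ℂ] H} (hx : ‖x‖ ≤ 1) : star x * x ≤ 1 := by
  have := CStarAlgebra.star_mul_le_algebraMap_norm_sq (a := x)
  rw [Algebra.algebraMap_eq_smul_one] at this
  refine this.trans ?_
  have h2 : ‖x‖ ^ 2 ≤ 1 := by nlinarith [norm_nonneg x]
  have h3 := smul_le_smul_of_nonneg_right h2 (zero_le_one (α := H →L[ℂ] H))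
  rwa [one_smul] at h3

theorem norm_le_one_of_star_mul_self_le {x : H →L[ℂ] H} (hx : star x * x ≤ 1) : ‖x‖ ≤ 1 := by
  have h1 := norm_le_one_of_nonneg (star_mul_self_nonneg x) hx
  rw [CStarRing.norm_star_mul_self] at h1
  nlinarith [norm_nonneg x]

namespace Represents

variable {M A : Set (H →L[ℂ] H)} {τ : (H →L[ℂ] H) →ₗ[ℂ] ℂ} [hA : AbelianVN A]
  {x : H →L[ℂ] H} {μ : Pr A → H →L[ℂ] H} (hτ : NormalTrace M τ) (hAM : A ⊆ M) (hx : x ∈ M)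
  (h : Represents A τ x μ)
include hτ hAM hx h

theorem sum_apply (P : Finpartition (⊤ : Pr A)) {a : H →L[ℂ] H} (ha : a ∈ A) :
    ∑ p ∈ P.parts, τ (μ p * a) = τ (star x * x * a) := by
  rw [Finset.sum_congr rfl fun p _ => h.apply p a ha, ← map_sum, ← Finset.sum_mul,
    ← Finset.sum_mul, ← Finset.mul_sum, Pr.sum_parts, mul_one]

theorem le_trace_sup (hx1 : ‖x‖ ≤ 1) {c : ℝ} (hc : 0 ≤ c) (P : Finpartition (⊤ : Pr A)) :
    ∑ p ∈ P.parts, (τ (μ p * μ p)).re ≤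
      c + (τ (P.parts.sup fun p => Pr.spec (h.mem p) c).op).re := by
  set r := P.parts.sup fun p => Pr.spec (h.mem p) c with hr
  have h1 : ∀ p ∈ P.parts, (τ (μ p * μ p)).re ≤
      c * (τ (μ p * (1 - r.op))).re + (τ (μ p * r.op)).re := by
    intro p hp
    have hm := h.mem p
    have hm0 := h.nonneg hτ hAM hx p
    have hm1 := h.le_one hτ hAM hx hx1 p
    have hsr : Pr.spec hm c ≤ r := Finset.le_sup (f := fun p => Pr.spec (h.mem p) c) hp
    have e1 : μ p * (1 - r.op) ≤ c • (1 - r.op) := by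
      have e2 := Pr.mul_le_mul (hA.vna.mul_mem _ hm _ ((Pr.spec hm c)ᶜ).mem)
        (hA.vna.real_smul_mem c ((Pr.spec hm c)ᶜ).mem)
        (Pr.mul_compl_spec_le hm (.of_nonneg hm0) c) rᶜ
      have e3 : ((Pr.spec hm c)ᶜ).op * (rᶜ).op = (rᶜ).op :=
        Pr.le_iff'.1 (compl_le_compl hsr)
      rw [mul_assoc, smul_mul_assoc, e3] at e2
      exact e2
    have e4 : 0 ≤ (1 - μ p) * r.op :=
      Pr.mul_nonneg (hA.vna.sub_mem hA.vna.one_mem hm) (sub_nonneg.2 hm1) r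
    have e5 := hτ.re_mul_nonneg (hAM hm) (hAM (hA.vna.sub_mem (hA.vna.real_smul_mem c (rᶜ).mem)
      (hA.vna.mul_mem _ hm _ (rᶜ).mem))) hm0 (sub_nonneg.2 e1)
    have e6 := hτ.re_mul_nonneg (hAM hm) (hAM (hA.vna.mul_mem _
      (hA.vna.sub_mem hA.vna.one_mem hm) _ r.mem)) hm0 e4
    rw [Pr.compl_op] at e5
    have e7 : μ p * (c • (1 - r.op) - μ p * (1 - r.op)) =
      (c : ℂ) • (μ p * (1 - r.op)) - (μ p * μ p - μ p * μ p * r.op) := by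
      rw [Complex.coe_smul]
      simp [mul_sub, mul_assoc]
    have e8 : μ p * ((1 - μ p) * r.op) = μ p * r.op - μ p * μ p * r.op := by
      simp [mul_sub, sub_mul, mul_assoc]
    rw [e7, map_sub, map_sub, map_smul, smul_eq_mul, Complex.sub_re, Complex.sub_re,
      Complex.re_ofReal_mul] at e5
    rw [e8, map_sub, Complex.sub_re] at e6
    linarith
  have hxx : star x * x ∈ M := hτ.vna.mul_mem _ (hτ.vna.star_mem x hx) _ hx
  have h2 : ∀ q : Pr A, ∑ p ∈ P.parts, (τ (μ p * q.op)).re ≤ (τ q.op).re := by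
    intro q
    rw [← Complex.re_sum, h.sum_apply hτ hAM hx P q.mem]
    have := hτ.re_mul_nonneg (hτ.vna.sub_mem hτ.vna.one_mem hxx) (hAM q.mem)
      (sub_nonneg.2 (star_mul_self_le_one hx1)) q.nonneg
    rw [sub_mul, one_mul, map_sub, Complex.sub_re] at this
    linarith
  have h3 : (τ (rᶜ).op).re ≤ 1 := by
    have := hτ.re_mono (hAM (rᶜ).mem) hτ.vna.one_mem (rᶜ).le_one
    simpa [hτ.map_one] using this
  have h4 := h2 rᶜ
  have h5 := h2 r
  refine (Finset.sum_le_sum h1).trans ?_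
  rw [Finset.sum_add_distrib, ← Finset.mul_sum]
  rw [Pr.compl_op] at h3 h4
  nlinarith

end Represents

/-- Refining eventually any given partition. -/
theorem exists_ultrafilter_finpartition {α : Type*} [BooleanAlgebra α] :
    ∃ F : Ultrafilter (Finpartition (⊤ : α)), ∀ Q, ∀ᶠ P in (F : Filter (Finpartition (⊤ : α))), P ≤ Q := by
  classical
  have : Nonempty (Finpartition (⊤ : α)) := ⟨complPartition ⊤⟩
  exact ⟨Ultrafilter.of Filter.atBot, fun Q =>
    Ultrafilter.of_le _ (Filter.eventually_le_atBot Q)⟩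

/-- If the mass of `x` does not spread out over `A`, there is an operator which intertwines the
projections of `A` and is not orthogonal to `x`. -/
theorem NormalTrace.exists_intertwiner {M A : Set (H →L[ℂ] H)} {τ : (H →L[ℂ] H) →ₗ[ℂ] ℂ}
    [hA : AbelianVN A] {x : H →L[ℂ] H} {μ : Pr A → H →L[ℂ] H} (hτ : NormalTrace M τ)
    (hAM : A ⊆ M) (hx : x ∈ M) (hx1 : ‖x‖ ≤ 1) (h : Represents A τ x μ) {ε : ℝ} (hε : 0 < ε)
    (hP : ∀ P : Finpartition (⊤ : Pr A), ε ≤ ∑ p ∈ P.parts, (τ (μ p * μ p)).re) :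
    ∃ θ : Pr A → Pr A, ∃ y ∈ M, ‖y‖ ≤ 1 ∧ y ≠ 0 ∧ (∀ p : Pr A, p.op * y = y * (θ p).op) ∧
      (∀ a ∈ A, ∀ b ∈ A, x * b = a * x → y * b = a * y) ∧
      ∀ z ∈ M, (∀ p : Pr A, p.op * z = z * (θ p).op) → τ (star z * x) = τ (star z * y) := by
  classical
  set c := ε / 2 with hc
  have hc0 : 0 < c := by positivity
  have hμ0 := h.nonneg hτ hAM hx
  let s : Pr A → Pr A := fun p => Pr.spec (h.mem p) c
  have hsmono : Monotone s := fun p q hpq => Pr.spec_mono (h.mem p) (h.mem q)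
    (.of_nonneg (hμ0 p)) (.of_nonneg (hμ0 q)) (h.mono hτ hAM hx hpq) c
  have hs0 : s ⊥ = ⊥ := by
    refine le_bot_iff.1 (Pr.spec_le (h.mem _) (.of_nonneg (hμ0 _)) c ?_)
    rw [h.bot hτ hAM hx, zero_mul, Pr.bot_op, sub_zero]
    exact smul_nonneg hc0.le zero_le_one
  obtain ⟨θ, hθs, hθsup, hθtop, hθdisj⟩ := exists_partition_selection s hsmono hs0
  have hθmono : ∀ p q, p ≤ q → θ p ≤ θ q := fun p q hpq => by
    rw [← sup_eq_right.2 hpq, hθsup]; exact le_sup_left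
  have hθd : ∀ p q, Disjoint p q → Disjoint (θ p) (θ q) := fun p q hpq =>
    (hθdisj p).mono_right (hθmono _ _ hpq.symm.le_compl_right)
  have hθbot : θ ⊥ = ⊥ := le_bot_iff.1 ((hθs ⊥).trans hs0.le)
  obtain ⟨F, hF⟩ := exists_ultrafilter_finpartition (α := Pr A)
  have hq : θ ⊤ ≠ ⊥ := by
    rw [hθtop]
    refine Pr.iInf_ne_bot hτ hAM F _ (fun Q => ?_) hc0 fun P => ?_
    · filter_upwards [hF Q] with P hPQ
      refine Finset.sup_le fun b hb => ?_
      obtain ⟨d, hd, hbd⟩ := hPQ hb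
      exact (hsmono hbd).trans (Finset.le_sup hd)
    · have h1 := h.le_trace_sup hτ hAM hx hx1 hc0.le P
      have h2 := hP P
      change c ≤ (τ (P.parts.sup fun p => Pr.spec (h.mem p) c).op).re
      linarith
  let Y : Finpartition (⊤ : Pr A) → H →L[ℂ] H := fun P => ∑ p ∈ P.parts, p.op * x * (θ p).op
  have hYM : ∀ P, Y P ∈ M := fun P => hτ.vna.sum_mem _ _ fun p _ =>
    hτ.vna.mul_mem _ (hτ.vna.mul_mem _ (hAM p.mem) _ hx) _ (hAM (θ p).mem)
  have hpd : ∀ P : Finpartition (⊤ : Pr A), ∀ p ∈ P.parts, ∀ q ∈ P.parts, p ≠ q → Disjoint p q :=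
    fun P p hp q hq hpq => P.disjoint hp hq hpq
  have hθsum : ∀ P : Finpartition (⊤ : Pr A), ∑ p ∈ P.parts, (θ p).op = (θ ⊤).op := by
    intro P
    have e := Pr.op_sup (s := P.parts) (f := θ) fun p hp q hq hpq =>
      hθd _ _ (P.disjoint hp hq hpq)
    have e' := Finset.apply_sup_eq_sup_comp (s := P.parts) (f := id) θ hθsup hθbot
    rw [← e, ← Function.comp_id θ, ← e', P.sup_parts, Function.comp_id]
  have hYnorm : ∀ P, ‖Y P‖ ≤ 1 := by
    intro P
    apply norm_le_one_of_star_mul_self_le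
    have e1 : star (Y P) * Y P = ∑ p ∈ P.parts, star (x * (θ p).op) * p.op * (x * (θ p).op) := by
      rw [star_sum, Finset.sum_mul]
      refine Finset.sum_congr rfl fun p hp => ?_
      rw [Finset.mul_sum, Finset.sum_eq_single_of_mem p hp]
      · simp only [star_mul, (θ p).sa, p.sa, mul_assoc]
        rw [← mul_assoc p.op p.op, p.idem]
      · intro q hq hqp
        simp only [star_mul, (θ p).sa, p.sa, mul_assoc]
        rw [← mul_assoc p.op q.op, Pr.disjoint_iff_mul.1 (hpd P p hp q hq hqp.symm)]
        simp
    rw [e1]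
    have e2 : ∀ p : Pr A, star (x * (θ p).op) * p.op * (x * (θ p).op) ≤ (θ p).op := by
      intro p
      have e3 := star_left_conjugate_le_conjugate p.le_one (x * (θ p).op)
      have e4 := star_left_conjugate_le_conjugate (star_mul_self_le_one hx1) (θ p).op
      rw [mul_one] at e3 e4
      refine e3.trans ?_
      rw [(θ p).sa, (θ p).idem] at e4
      simpa only [star_mul, (θ p).sa, mul_assoc] using e4
    exact (Finset.sum_le_sum fun p _ => e2 p).trans ((hθsum P).le.trans (θ ⊤).le_one)
  obtain ⟨y, hy⟩ := WLim.exists_of_bounded F hYnorm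
  have hyM : y ∈ M := hy.mem hτ.vna (.of_forall hYM)
  have hlim : ∀ z ∈ M, Filter.Tendsto (fun P => τ (star z * Y P)) F (nhds (τ (star z * y))) := by
    intro z hz
    have hzs := hτ.vna.star_mem z hz
    refine hτ.tendsto ‖star z‖ (.of_forall fun P => ⟨hτ.vna.mul_mem _ hzs _ (hYM P), ?_⟩)
      (hy.mul_left _)
    exact (norm_mul_le _ _).trans (mul_le_of_le_one_right (norm_nonneg _) (hYnorm P))
  refine ⟨θ, y, hyM, hy.norm_le zero_le_one (.of_forall hYnorm), ?_, ?_, ?_, ?_⟩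
  · have h1 : c * (τ (θ ⊤).op).re ≤ (τ (star x * y)).re := by
      refine ge_of_tendsto ((Complex.continuous_re.tendsto _).comp (hlim x hx))
        (.of_forall fun P => ?_)
      change _ ≤ (τ (star x * Y P)).re
      rw [← hθsum P, Finset.mul_sum, map_sum, map_sum, Complex.re_sum, Complex.re_sum,
        Finset.mul_sum]
      refine Finset.sum_le_sum fun p _ => ?_
      rw [← mul_assoc, ← mul_assoc, ← h.apply p _ (θ p).mem, ← Complex.re_ofReal_mul,
        ← smul_eq_mul, ← map_smul, Complex.coe_smul]
      have e1 := Pr.mul_le_mul (hA.vna.real_smul_mem c (s p).mem)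
        (hA.vna.mul_mem _ (h.mem p) _ (s p).mem) (Pr.le_mul_spec (h.mem p) (.of_nonneg (hμ0 p)) c)
        (θ p)
      rw [smul_mul_assoc, mul_assoc, Pr.le_iff'.1 (hθs p)] at e1
      exact hτ.re_mono (hAM (hA.vna.real_smul_mem c (θ p).mem))
        (hAM (hA.vna.mul_mem _ (h.mem p) _ (θ p).mem)) e1
    rintro rfl
    have h2 := hτ.re_nonneg (hAM (θ ⊤).mem) (θ ⊤).nonneg
    rw [mul_zero, map_zero, Complex.zero_re] at h1
    have h3 := hτ.eq_zero_of_re (hAM (θ ⊤).mem) (θ ⊤).nonneg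
      (le_antisymm (by nlinarith) h2)
    exact hq (Pr.ext h3)
  · intro p
    refine (hy.mul_left p.op).unique ((hy.mul_right (θ p).op).congr' ?_)
    filter_upwards [hF (complPartition p)] with P hPp
    simp only [Y]
    rw [Finset.sum_mul, Finset.mul_sum]
    refine Finset.sum_congr rfl fun b hb => ?_
    rcases le_or_le_compl_of_le hPp hb with hbp | hbp
    · rw [mul_assoc, Pr.le_iff.1 (hθmono _ _ hbp), ← mul_assoc, ← mul_assoc, Pr.le_iff'.1 hbp]
    · have hd : Disjoint b p := le_compl_iff_disjoint_right.1 hbp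
      rw [mul_assoc, Pr.disjoint_iff_mul.1 (hθd _ _ hd), ← mul_assoc, ← mul_assoc,
        Pr.disjoint_iff_mul.1 hd.symm]
      simp
  · intro a ha b hb hab
    refine (hy.mul_right b).unique ((hy.mul_left a).congr' (.of_forall fun P => ?_))
    simp only [Y]
    rw [Finset.sum_mul, Finset.mul_sum]
    refine Finset.sum_congr rfl fun p _ => Eq.symm ?_
    rw [mul_assoc, hA.comm _ (θ p).mem _ hb, ← mul_assoc, mul_assoc p.op, hab, ← mul_assoc,
      hA.comm _ p.mem _ ha]
    simp only [mul_assoc]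
  · intro z hz hzp
    have hzs := hτ.vna.star_mem z hz
    refine tendsto_nhds_unique ((tendsto_const_nhds).congr fun P => ?_) (hlim z hz)
    have e1 : ∀ p : Pr A, (θ p).op * star z = star z * p.op := by
      intro p
      have := congrArg star (hzp p)
      simpa [p.sa, (θ p).sa] using this.symm
    simp only [Y]
    rw [Finset.mul_sum, map_sum]
    have e2 : ∀ p : Pr A, τ (star z * (p.op * x * (θ p).op)) = τ (star z * (p.op * x)) := by
      intro p
      have hm := hτ.vna.mul_mem _ hzs _ (hτ.vna.mul_mem _ (hAM p.mem) _ hx)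
      rw [← mul_assoc, hτ.tracial _ hm _ (hAM (θ p).mem), ← mul_assoc, ← mul_assoc, e1,
        mul_assoc (star z), p.idem, mul_assoc]
    rw [Finset.sum_congr rfl fun p _ => e2 p, ← map_sum, ← Finset.mul_sum, ← Finset.sum_mul,
      Pr.sum_parts, one_mul]

end

section

/-! ### Normalizing partial isometries -/

theorem mul_eq_self_of_star_mul_self {v e : H →L[ℂ] H} (hv : star v * v = e) (he : e * e = e)
    (hes : star e = e) : v * e = v := by
  have h1 : star (v * e - v) * (v * e - v) = 0 := by
    have e1 : star v * v * e = e := by rw [hv, he]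
    rw [star_sub, star_mul, hes, sub_mul, mul_sub, mul_sub, mul_assoc e, mul_assoc e,
      ← mul_assoc (star v) v e, e1, he, hv, he]
    simp
  exact sub_eq_zero.1 (CStarRing.star_mul_self_eq_zero_iff _ |>.1 h1)

theorem Pr.mul_sSup_eq_zero {A : Set (H →L[ℂ] H)} [AbelianVN A] {S : Set (Pr A)}
    {T : H →L[ℂ] H} (h : ∀ p ∈ S, T * p.op = 0) : T * (sSup S).op = 0 := by
  refine mul_spanProj_eq_zero ?_
  rintro v ⟨p, hp, hv⟩
  have := DFunLike.congr_fun (h p hp) v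
  simpa [hv] using this

theorem normalizerSet_subset (M A : Set (H →L[ℂ] H)) : normalizerSet M A ⊆ M := fun _ h => h.1

theorem IsVonNeumannAlgebra.normAlg_subset {M : Set (H →L[ℂ] H)} (hM : IsVonNeumannAlgebra M)
    (A : Set (H →L[ℂ] H)) : normAlg M A ⊆ M :=
  hM.vNgen_subset (normalizerSet_subset M A)

theorem isVonNeumannAlgebra_normAlg (M A : Set (H →L[ℂ] H)) :
    IsVonNeumannAlgebra (normAlg M A) := isVonNeumannAlgebra_vNgen _

theorem mem_normalizerSet {M A : Set (H →L[ℂ] H)} {u : H →L[ℂ] H} (hu : u ∈ M)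
    (hu' : IsUnitary u) (h1 : ∀ a ∈ A, u * a * star u ∈ A) (h2 : ∀ a ∈ A, star u * a * u ∈ A) :
    u ∈ normalizerSet M A := by
  refine ⟨hu, hu', Set.Subset.antisymm ?_ fun a ha => ⟨_, h2 a ha, ?_⟩⟩
  · rintro _ ⟨a, ha, rfl⟩
    exact h1 a ha
  · simp only [← mul_assoc]
    rw [hu'.2, one_mul, mul_assoc, hu'.2, mul_one]

section

variable {M A : Set (H →L[ℂ] H)} [hAb : AbelianVN A]

theorem subset_normAlg (hAM : A ⊆ M) : A ⊆ normAlg M A := by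
  have hN := isVonNeumannAlgebra_normAlg M A
  have hp : ∀ p : Pr A, p.op ∈ normAlg M A := by
    intro p
    set u : H →L[ℂ] H := 1 - (2 : ℂ) • p.op with hu
    have huA : u ∈ A := hAb.vna.sub_mem hAb.vna.one_mem (hAb.vna.smul_mem 2 _ p.mem)
    have hus : star u = u := by simp [hu, p.sa]
    have huu : u * u = 1 := by
      simp only [hu, mul_sub, sub_mul, mul_one, one_mul, smul_mul_smul_comm, p.idem]
      module
    have h1 : u ∈ normAlg M A := by
      refine subset_vNgen _ (mem_normalizerSet (hAM huA) ⟨by rw [hus, huu], by rw [hus, huu]⟩ ?_ ?_)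
      · intro a ha
        rw [hus]; exact hAb.vna.mul_mem _ (hAb.vna.mul_mem _ huA _ ha) _ huA
      · intro a ha
        rw [hus]; exact hAb.vna.mul_mem _ (hAb.vna.mul_mem _ huA _ ha) _ huA
    have h2 : p.op = (1 / 2 : ℂ) • (1 - u) := by
      rw [hu, sub_sub_cancel, smul_smul]; norm_num
    rw [h2]
    exact hN.smul_mem _ _ (hN.sub_mem hN.one_mem h1)
  intro a ha
  exact hN.mem_of_commute fun y hy => Pr.commute_of_forall (fun p => (hy _ (hp p)).symm) a ha

theorem mem_normAlg_of_mul_eq_zero (hM : IsVonNeumannAlgebra M) (hAM : A ⊆ M) {w : H →L[ℂ] H}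
    (hw : w ∈ M) {e f : Pr A} (he : star w * w = e.op) (hf : w * star w = f.op)
    (hef : e.op * f.op = 0) (h1 : ∀ a ∈ A, w * a * star w ∈ A)
    (h2 : ∀ a ∈ A, star w * a * w ∈ A) : w ∈ normAlg M A := by
  have hws := hM.star_mem w hw
  have hfe : f.op * e.op = 0 := by rw [← e.mul_comm]; exact hef
  have we : w * e.op = w := mul_eq_self_of_star_mul_self he e.idem e.sa
  have wf : star w * f.op = star w :=
    mul_eq_self_of_star_mul_self (by rw [star_star, hf]) f.idem f.sa
  have ew : e.op * star w = star w := by simpa [e.sa] using congrArg star we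
  have fw : f.op * w = w := by simpa [f.sa] using congrArg star wf
  have e1 : w * f.op = 0 := by rw [← we, mul_assoc, hef, mul_zero]
  have e2 : star w * e.op = 0 := by rw [← wf, mul_assoc, hfe, mul_zero]
  have e3 : f.op * star w = 0 := by simpa [f.sa] using congrArg star e1
  have e4 : e.op * w = 0 := by simpa [e.sa] using congrArg star e2
  have ww : w * w = 0 := by
    nth_rewrite 1 [← we]
    rw [mul_assoc, e4, mul_zero]
  have wws : star w * star w = 0 := by simpa using congrArg star ww
  set g : H →L[ℂ] H := 1 - e.op - f.op with hg
  have hgA : g ∈ A := hAb.vna.sub_mem (hAb.vna.sub_mem hAb.vna.one_mem e.mem) f.mem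
  have wg : w * g = 0 := by simp [hg, mul_sub, we, e1]
  have gw : g * w = 0 := by simp [hg, sub_mul, e4, fw]
  have wsg : star w * g = 0 := by simp [hg, mul_sub, wf, e2]
  have gws : g * star w = 0 := by simp [hg, sub_mul, ew, e3]
  have gg : g * g = g := by simp [hg, mul_sub, sub_mul, e.idem, f.idem, hef, hfe]
  have gs : star g = g := by simp [hg, e.sa, f.sa]
  have waw : ∀ a ∈ A, w * a * w = 0 := by
    intro a ha
    rw [← we, mul_assoc w, hAb.comm _ e.mem _ ha, mul_assoc, mul_assoc, ← mul_assoc e.op, e4]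
    simp
  have waws : ∀ a ∈ A, star w * a * star w = 0 := by
    intro a ha
    simpa [mul_assoc] using congrArg star (waw _ (hAb.vna.star_mem a ha))
  have wag : ∀ a ∈ A, w * a * g = 0 := by
    intro a ha
    rw [mul_assoc, hAb.comm a ha g hgA, ← mul_assoc, wg, zero_mul]
  have gaw : ∀ a ∈ A, g * a * w = 0 := by
    intro a ha
    rw [hAb.comm g hgA a ha, mul_assoc, gw, mul_zero]
  have wsag : ∀ a ∈ A, star w * a * g = 0 := by
    intro a ha
    rw [mul_assoc, hAb.comm a ha g hgA, ← mul_assoc, wsg, zero_mul]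
  have gaws : ∀ a ∈ A, g * a * star w = 0 := by
    intro a ha
    rw [hAb.comm g hgA a ha, mul_assoc, gws, mul_zero]
  set u := w + star w + g with hu
  have hus : star u = u := by rw [hu, star_add, star_add, star_star, gs]; abel
  have huu : u * u = 1 := by
    simp only [hu, mul_add, add_mul, ww, wws, wg, gw, wsg, gws, gg, he, hf]
    rw [hg]; abel
  have hua : ∀ a ∈ A, u * a * u ∈ A := by
    intro a ha
    have : u * a * u = w * a * star w + star w * a * w + g * a * g := by
      simp only [hu, mul_add, add_mul, waw a ha, waws a ha, wag a ha, gaw a ha, wsag a ha,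
        gaws a ha]
      abel
    rw [this]
    exact hAb.vna.add_mem _ (hAb.vna.add_mem _ (h1 a ha) _ (h2 a ha)) _
      (hAb.vna.mul_mem _ (hAb.vna.mul_mem _ hgA _ ha) _ hgA)
  have huN : u ∈ normAlg M A := by
    refine subset_vNgen _ (mem_normalizerSet ?_ ⟨by rw [hus, huu], by rw [hus, huu]⟩ ?_ ?_)
    · exact hM.add_mem _ (hM.add_mem _ hw _ hws) _ (hAM hgA)
    · rwa [hus]
    · rwa [hus]
  have hwu : w = u * e.op := by
    simp [hu, add_mul, we, e2, hg, sub_mul, e.idem, hfe]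
  rw [hwu]
  exact (isVonNeumannAlgebra_normAlg M A).mul_mem _ huN _ (subset_normAlg hAM e.mem)

variable {τ : (H →L[ℂ] H) →ₗ[ℂ] ℂ} (hτ : NormalTrace M τ) (hA : IsMasa M A)
include hτ hA

theorem mem_normAlg_of_partial_isometry {v : H →L[ℂ] H} (hv : v ∈ M) {e : Pr A}
    (he : star v * v = e.op) (h1 : ∀ a ∈ A, v * a * star v ∈ A)
    (h2 : ∀ a ∈ A, star v * a * v ∈ A) : v ∈ normAlg M A := by
  have hM := hτ.vna
  have hAM := hA.1
  have hN := isVonNeumannAlgebra_normAlg M A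
  have hAN : A ⊆ normAlg M A := subset_normAlg hAM
  have ve : v * e.op = v := mul_eq_self_of_star_mul_self he e.idem e.sa
  have hvv : ∀ p : Pr A, p ≤ e → star (v * p.op) * (v * p.op) = p.op := by
    intro p hp
    rw [star_mul, p.sa, mul_assoc, ← mul_assoc (star v), he, Pr.le_iff'.1 hp, p.idem]
  have hexφ : ∀ p : Pr A, p ≤ e → ∃ f : Pr A, f.op = v * p.op * star v := by
    intro p hp
    refine ⟨⟨v * p.op * star v, h1 _ p.mem, ?_, ?_⟩, rfl⟩
    · rw [mul_assoc, ← mul_assoc (star v), ← mul_assoc (star v), he, Pr.le_iff'.1 hp,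
        mul_assoc v, ← mul_assoc p.op, p.idem, mul_assoc]
    · simp [p.sa, mul_assoc]
  have hnul : ∀ p : Pr A, p ≤ e → p.op * (v * p.op * star v) = 0 → v * p.op ∈ normAlg M A := by
    intro p hp h0
    obtain ⟨f, hf⟩ := hexφ p hp
    refine mem_normAlg_of_mul_eq_zero hM hAM (hM.mul_mem _ hv _ (hAM p.mem)) (hvv p hp) (f := f)
      ?_ (by rw [hf, h0]) ?_ ?_
    · rw [hf, star_mul, p.sa, mul_assoc, ← mul_assoc p.op, p.idem, mul_assoc]
    · intro a ha
      have := h1 _ (hAb.vna.mul_mem _ (hAb.vna.mul_mem _ p.mem _ ha) _ p.mem)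
      simpa [p.sa, mul_assoc] using this
    · intro a ha
      have := hAb.vna.mul_mem _ (hAb.vna.mul_mem _ p.mem _ (h2 a ha)) _ p.mem
      simpa [p.sa, mul_assoc] using this
  set S : Set (Pr A) := {p | p ≤ e ∧ v * p.op ∈ normAlg M A} with hS
  set e0 := sSup S with he0
  have h0e : e0 ≤ e := sSup_le fun p hp => hp.1
  have h0N : v * e0.op ∈ normAlg M A := by
    refine hN.mem_of_commute fun y hy => ?_
    have hyp : ∀ p : Pr A, p.op * y = y * p.op := fun p => hy _ (hAN p.mem)
    have h3 : (y * v - v * y) * e0.op = 0 := by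
      refine Pr.mul_sSup_eq_zero fun p hp => ?_
      have h4 := hy _ hp.2
      rw [sub_mul, mul_assoc, ← h4, mul_assoc, mul_assoc, hyp, sub_self]
    rw [sub_mul, sub_eq_zero] at h3
    rw [← mul_assoc, h3, mul_assoc, ← hyp, mul_assoc]
  have hmax : ∀ p : Pr A, p ≤ e → p ≤ e0ᶜ → v * p.op ∈ normAlg M A → p = ⊥ := by
    intro p hp hp' hpN
    have h3 : p ≤ e0 := le_sSup ⟨hp, hpN⟩
    exact le_bot_iff.1 ((le_inf h3 hp').trans (inf_compl_eq_bot (a := e0)).le)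
  have hcom : ∀ p : Pr A, p ≤ e → p ≤ e0ᶜ → v * p.op = p.op * v := by
    intro p hp hp'
    obtain ⟨f, hf⟩ := hexφ p hp
    have hpf : p ≤ f := by
      rw [← sdiff_eq_bot_iff, sdiff_eq]
      refine hmax _ (inf_le_left.trans hp) (inf_le_left.trans hp') (hnul _ (inf_le_left.trans hp) ?_)
      obtain ⟨f', hf'⟩ := hexφ (p ⊓ fᶜ) (inf_le_left.trans hp)
      have hff : f' ≤ f := by
        rw [Pr.le_iff, hf, hf', mul_assoc, ← mul_assoc (star v), ← mul_assoc (star v), he,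
          Pr.le_iff'.1 hp, mul_assoc v, ← mul_assoc _ p.op, Pr.le_iff.1 (inf_le_left), mul_assoc]
      rw [← hf', ← Pr.disjoint_iff_mul]
      exact (disjoint_compl_left (a := f)).mono inf_le_right hff
    have htr : τ f.op = τ p.op := by
      rw [hf, hτ.tracial _ (hM.mul_mem _ hv _ (hAM p.mem)) _ (hM.star_mem v hv), ← mul_assoc, he,
        Pr.le_iff'.1 hp]
    have hfp : f.op - p.op = 0 := by
      refine hτ.eq_zero_of_re (hM.sub_mem (hAM f.mem) (hAM p.mem)) (sub_nonneg.2 (Pr.op_mono hpf)) ?_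
      rw [map_sub, htr, sub_self, Complex.zero_re]
    rw [sub_eq_zero, hf] at hfp
    calc v * p.op = v * p.op * star v * v := by
          rw [mul_assoc _ (star v), he, mul_assoc, Pr.le_iff.1 hp]
      _ = p.op * v := by rw [hfp]
  set f := e ⊓ e0ᶜ with hf
  have hvf : v * f.op ∈ A := by
    refine hA.mem (hM.mul_mem _ hv _ (hAM f.mem)) (Pr.commute_of_forall fun p => ?_)
    have h3 := hcom (f ⊓ p) (inf_le_left.trans inf_le_left) (inf_le_left.trans inf_le_right)
    have h4 := hcom f inf_le_left inf_le_right
    rw [Pr.inf_op] at h3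
    rw [mul_assoc, h3, h4, f.mul_comm, mul_assoc]
  have hf0 := hmax f inf_le_left inf_le_right (hAN hvf)
  have h5 : e ≤ e0 := by rwa [← sdiff_eq_bot_iff, sdiff_eq]
  rw [le_antisymm h0e h5, ve] at h0N
  exact h0N

theorem mem_normAlg_of_conj_mem {z : H →L[ℂ] H} (hz : z ∈ M)
    (h1 : ∀ a ∈ A, z * a * star z ∈ A) (h2 : ∀ a ∈ A, star z * a * z ∈ A) :
    z ∈ normAlg M A := by
  have hM := hτ.vna
  have hAM := hA.1
  have hN := isVonNeumannAlgebra_normAlg M A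
  have hAN : A ⊆ normAlg M A := subset_normAlg hAM
  have hkA : star z * z ∈ A := by simpa using h2 1 hAb.vna.one_mem
  obtain ⟨k, hk⟩ : ∃ k, k = star z * z := ⟨_, rfl⟩
  rw [← hk] at hkA
  have hk0 : 0 ≤ k := hk ▸ star_mul_self_nonneg z
  have hksa : IsSelfAdjoint k := .of_nonneg hk0
  refine hτ.mem_of_approx hN (hM.normAlg_subset A) hz fun ε hε => ?_
  set δ := ε / 2 with hδ
  have hδ0 : 0 < δ := by positivity
  set e := Pr.spec hkA δ with he
  have hze : z * e.op ∈ normAlg M A := by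
    set s := cfc (fun t : ℝ => (Real.sqrt (max t δ))⁻¹) k with hs
    set r := cfc (fun t : ℝ => Real.sqrt (max t δ)) k with hr
    have hpos : ∀ t : ℝ, 0 < Real.sqrt (max t δ) := fun t =>
      Real.sqrt_pos.2 (lt_of_lt_of_le hδ0 (le_max_right _ _))
    have hcs : Continuous fun t : ℝ => (Real.sqrt (max t δ))⁻¹ :=
      Continuous.inv₀ (by fun_prop) fun t => (hpos t).ne'
    have hsA : s ∈ A := hAb.vna.cfc_mem hkA _
    have hrA : r ∈ A := hAb.vna.cfc_mem hkA _
    have hss : star s = s := (cfc_predicate (R := ℝ) (fun t : ℝ => (Real.sqrt (max t δ))⁻¹) k).star_eq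
    have hsr : s * r = 1 := by
      rw [hs, hr, ← cfc_mul _ _ k hcs.continuousOn (by fun_prop), ← cfc_const_one ℝ k]
      exact cfc_congr fun t _ => inv_mul_cancel₀ (hpos t).ne'
    have hke : k * e.op = r * r * e.op := by
      have e1 := (Pr.sub_mul_spec hkA hksa δ).1
      have e2 : r * r = cfc (fun t : ℝ => max 0 (t - δ)) k + δ • (1 : H →L[ℂ] H) := by
        rw [hr, ← cfc_mul _ _ k (by fun_prop) (by fun_prop), ← Algebra.algebraMap_eq_smul_one,
          ← cfc_const δ k, ← cfc_add _ _ _]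
        refine cfc_congr fun t _ => ?_
        rw [Real.mul_self_sqrt (le_max_of_le_right hδ0.le)]
        rcases le_total t δ with h | h
        · rw [max_eq_right h, max_eq_left (by linarith)]; ring
        · rw [max_eq_left h, max_eq_right (by linarith)]; ring
      rw [e2, add_mul, ← e1, mul_assoc, he, (Pr.spec hkA δ).idem, ← add_mul, sub_add_cancel]
    have hv : z * s * e.op ∈ normAlg M A := by
      refine mem_normAlg_of_partial_isometry hτ hA (e := e)
        (hM.mul_mem _ (hM.mul_mem _ hz _ (hAM hsA)) _ (hAM e.mem)) ?_ ?_ ?_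
      · have e1 : star (z * s * e.op) * (z * s * e.op) = e.op * s * (k * e.op) * s := by
          rw [star_mul, star_mul, hss, e.sa, mul_assoc z, hAb.comm s hsA _ e.mem, hk]
          simp only [mul_assoc]
        have e3 : e.op * s * (r * r * e.op) * s = e.op * (s * r) * (r * (e.op * s)) := by
          simp only [mul_assoc]
        rw [e1, hke, e3, hsr, hAb.comm _ e.mem _ hsA, ← mul_assoc r, hAb.comm _ hrA _ hsA, hsr]
        simp [e.idem]
      · intro a ha
        have := h1 _ (hAb.vna.mul_mem _ (hAb.vna.mul_mem _ (hAb.vna.mul_mem _ hsA _ e.mem) _ ha) _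
          (hAb.vna.mul_mem _ e.mem _ hsA))
        simpa [e.sa, hss, mul_assoc] using this
      · intro a ha
        have := hAb.vna.mul_mem _ (hAb.vna.mul_mem _ (hAb.vna.mul_mem _ e.mem _ hsA) _ (h2 a ha)) _
          (hAb.vna.mul_mem _ hsA _ e.mem)
        simpa [e.sa, hss, mul_assoc] using this
    have e4 : z * e.op = z * s * e.op * r := by
      rw [mul_assoc _ e.op, hAb.comm _ e.mem _ hrA, mul_assoc z, ← mul_assoc s, hsr, one_mul]
    rw [e4]
    exact hN.mul_mem _ hv _ (hAN hrA)
  refine ⟨_, hze, ?_⟩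
  have e5 : sq2 τ (z - z * e.op) = (τ (k * (1 - e.op))).re := by
    have e6 : z - z * e.op = z * (eᶜ).op := by simp [mul_sub]
    have e7 : z * (eᶜ).op ∈ M := hM.mul_mem _ hz _ (hAM (eᶜ).mem)
    rw [e6, sq2, star_mul, (eᶜ).sa, mul_assoc, hτ.tracial _ (hAM (eᶜ).mem) _
      (hM.mul_mem _ (hM.star_mem z hz) _ e7), hk, mul_assoc, mul_assoc, (eᶜ).idem, ← mul_assoc,
      Pr.compl_op]
  rw [e5]
  have h6 := hτ.re_mono (hAM (hAb.vna.mul_mem _ hkA _ (eᶜ).mem))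
    (hAM (hAb.vna.real_smul_mem δ (eᶜ).mem)) (Pr.mul_compl_spec_le hkA hksa δ)
  have h7 := hτ.re_mono (hAM (eᶜ).mem) hM.one_mem (eᶜ).le_one
  rw [Pr.compl_op] at h6 h7
  rw [hτ.map_one, Complex.one_re] at h7
  rw [← Complex.coe_smul, map_smul, smul_eq_mul, Complex.re_ofReal_mul] at h6
  refine lt_of_le_of_lt h6 ?_
  nlinarith

end

end

section

/-! ### Vectors orthogonal to the normalizing algebra spread out -/

section

variable {M A : Set (H →L[ℂ] H)} [hAb : AbelianVN A] {τ : (H →L[ℂ] H) →ₗ[ℂ] ℂ}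

theorem conj_mem_of_intertwines (hM : IsVonNeumannAlgebra M) (hA : IsMasa M A) {w : H →L[ℂ] H}
    (hw : w ∈ M) {θ : Pr A → Pr A} (h : ∀ p : Pr A, p.op * w = w * (θ p).op) :
    ∀ a ∈ A, w * a * star w ∈ A := by
  intro a ha
  refine hA.mem (hM.mul_mem _ (hM.mul_mem _ hw _ (hA.1 ha)) _ (hM.star_mem w hw))
    (Pr.commute_of_forall fun p => ?_)
  have h1 : star w * p.op = (θ p).op * star w := by
    simpa [p.sa, (θ p).sa] using congrArg star (h p)
  rw [mul_assoc, h1, ← mul_assoc p.op, ← mul_assoc p.op, h, mul_assoc w, mul_assoc w,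
    hAb.comm _ (θ p).mem _ ha]
  simp only [mul_assoc]

theorem sq_sq2_le_sum (hτ : NormalTrace M τ) (hAM : A ⊆ M) {y : H →L[ℂ] H} (hy : y ∈ M)
    (P : Finpartition (⊤ : Pr A)) :
    sq2 τ y ^ 2 ≤ ∑ p ∈ P.parts, (τ (y * p.op * star y * (y * p.op * star y))).re := by
  have hM := hτ.vna
  have hys := hM.star_mem y hy
  set g := star y * y with hg
  have hgM : g ∈ M := hM.mul_mem _ hys _ hy
  have hgs : star g = g := by simp [hg]
  set G := ∑ p ∈ P.parts, p.op * g * p.op with hG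
  have hGM : G ∈ M := hM.sum_mem _ _ fun p _ =>
    hM.mul_mem _ (hM.mul_mem _ (hAM p.mem) _ hgM) _ (hAM p.mem)
  have h1 := hτ.cauchy_schwarz hGM hM.one_mem
  have e1 : τ G = τ g := by
    rw [hG, map_sum]
    have : ∀ p ∈ P.parts, τ (p.op * g * p.op) = τ (g * p.op) := by
      intro p _
      rw [mul_assoc, hτ.tracial _ (hAM p.mem) _ (hM.mul_mem _ hgM _ (hAM p.mem)), mul_assoc, p.idem]
    rw [Finset.sum_congr rfl this, ← map_sum, ← Finset.mul_sum, Pr.sum_parts, mul_one]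
  have e2 : sq2 τ (1 : H →L[ℂ] H) = 1 := by simp [sq2, hτ.map_one]
  have e3 : τ g = (sq2 τ y : ℂ) := hτ.apply_star_mul_self hy
  rw [star_one, one_mul, e1, e2, one_mul, e3, Complex.norm_real, Real.norm_eq_abs, sq_abs] at h1
  refine h1.trans (le_of_eq ?_)
  have e4 : star G * G = ∑ p ∈ P.parts, p.op * g * p.op * (g * p.op) := by
    rw [hG, star_sum, Finset.sum_mul]
    refine Finset.sum_congr rfl fun p hp => ?_
    rw [Finset.mul_sum, Finset.sum_eq_single_of_mem p hp]
    · simp only [star_mul, p.sa, hgs, mul_assoc]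
      rw [← mul_assoc p.op p.op, p.idem]
    · intro q hq hqp
      simp only [star_mul, p.sa, hgs, mul_assoc]
      have hpq : Disjoint p q := P.disjoint hp hq hqp.symm
      rw [← mul_assoc p.op q.op, Pr.disjoint_iff_mul.1 hpq]
      simp
  rw [sq2, e4, map_sum, Complex.re_sum]
  refine Finset.sum_congr rfl fun p _ => ?_
  have hp := hAM p.mem
  congr 1
  have hgp := hM.mul_mem _ hgM _ hp
  rw [← mul_assoc, hτ.tracial _ (hM.mul_mem _ (hM.mul_mem _ (hM.mul_mem _ hp _ hgM) _ hp) _ hgM)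
    _ hp]
  have e5 : p.op * (p.op * g * p.op * g) = (p.op * star y) * (y * p.op * star y * y) := by
    simp only [hg, ← mul_assoc, p.idem]
  rw [e5, hτ.tracial _ (hM.mul_mem _ hp _ hys) _
    (hM.mul_mem _ (hM.mul_mem _ (hM.mul_mem _ hy _ hp) _ hys) _ hy)]
  simp only [mul_assoc]

theorem exists_partition_sum_lt (hτ : NormalTrace M τ) (hA : IsMasa M A) {x : H →L[ℂ] H}
    (hx : x ∈ M) (hx1 : ‖x‖ ≤ 1) {μ : Pr A → H →L[ℂ] H} (hμ : Represents A τ x μ)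
    (hN : ∀ n ∈ normAlg M A, τ (star n * x) = 0) {ε : ℝ} (hε : 0 < ε) :
    ∃ P : Finpartition (⊤ : Pr A), ∑ p ∈ P.parts, (τ (μ p * μ p)).re < ε := by
  by_contra! hcon
  have hM := hτ.vna
  have hAM := hA.1
  obtain ⟨θ, y, hyM, hy1, hy0, hyθ, -, hyx⟩ := hτ.exists_intertwiner hAM hx hx1 hμ hε hcon
  have hys := hM.star_mem y hyM
  have hyθs : ∀ p : Pr A, star y * p.op = (θ p).op * star y := fun p => by
    simpa [p.sa, (θ p).sa] using congrArg star (hyθ p)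
  have hμ' : Represents A τ (star y) fun p => y * p.op * star y :=
    ⟨fun p => conj_mem_of_intertwines hM hA hyM hyθ _ p.mem, fun p a _ => by simp⟩
  have hpos : 0 < sq2 τ y :=
    lt_of_le_of_ne (hτ.sq2_nonneg hyM) fun h => hy0 (hτ.eq_zero_of_sq2 hyM h.symm)
  obtain ⟨θ', w, hwM, -, hw0, hwθ, hwc, hwx⟩ := hτ.exists_intertwiner hAM hys
    (by rwa [norm_star]) hμ' (pow_pos hpos 2) fun P => sq_sq2_le_sum hτ hAM hyM P
  have h1 : ∀ p : Pr A, w * p.op = (θ p).op * w := fun p =>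
    hwc _ (θ p).mem _ p.mem (hyθs p)
  have h2 : ∀ p : Pr A, p.op * star w = star w * (θ p).op := fun p => by
    simpa [p.sa, (θ p).sa] using congrArg star (h1 p)
  have hws := hM.star_mem w hwM
  have h3 : star w ∈ normAlg M A := by
    refine mem_normAlg_of_conj_mem hτ hA hws (conj_mem_of_intertwines hM hA hws h2) ?_
    rw [star_star]
    exact conj_mem_of_intertwines hM hA hwM hwθ
  have h4 := hyx _ hws h2
  have h5 := hwx w hwM hwθ
  rw [hN _ h3, star_star] at h4
  have h6 : τ (star w * star y) = star (τ (y * w)) := by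
    rw [← hτ.apply_star (hM.mul_mem _ hyM _ hwM), star_mul]
  rw [hτ.tracial _ hyM _ hwM, ← h4, star_zero, h5] at h6
  exact hw0 (hτ.faithful w hwM h6)

end

end

section

/-! ### Existence of a normal trace -/

theorem spanProj_commute {s : Set H} {T : H →L[ℂ] H} (h : ∀ v ∈ s, T v ∈ s)
    (h' : ∀ v ∈ s, star T v ∈ s) : spanProj s * T = T * spanProj s := by
  have key : ∀ y : H →L[ℂ] H, (∀ v ∈ s, y v ∈ s) →
      spanProj s * (y * spanProj s) = y * spanProj s := by
    intro y hy
    have h1 : (spanProj s * y - y) * spanProj s = 0 := by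
      refine mul_spanProj_eq_zero fun v hv => ?_
      simp [spanProj_apply_of_mem (hy v hv)]
    rwa [sub_mul, sub_eq_zero, mul_assoc] at h1
  have h2 := congrArg star (key _ h')
  simp only [star_mul, star_star, star_spanProj, mul_assoc] at h2
  rw [← h2, key _ h]

namespace TracialState

variable {M : Set (H →L[ℂ] H)} {τ : (H →L[ℂ] H) →ₗ[ℂ] ℂ} (hτ : TracialState M τ)
include hτ

theorem nontrivial : Nontrivial H := by
  by_contra h
  rw [not_nontrivial_iff_subsingleton] at h
  have h1 : (1 : H →L[ℂ] H) = 0 := Subsingleton.elim _ _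
  have := hτ.map_one
  rw [h1, map_zero] at this
  exact zero_ne_one this

theorem exists_maximal_le_vector (ξ : H) :
    ∃ m, Maximal (fun x => x ∈ M ∧ 0 ≤ x ∧ x ≤ 1 ∧ (inner ℂ ξ (x ξ)).re ≤ (τ x).re) m := by
  refine zorn_le_nonempty₀ {x | x ∈ M ∧ 0 ≤ x ∧ x ≤ 1 ∧ (inner ℂ ξ (x ξ)).re ≤ (τ x).re} ?_ 0
    ⟨hτ.vna.zero_mem, le_rfl, zero_le_one, by simp⟩ |>.imp fun m hm => hm.2
  intro c hc hchain y hy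
  have : Nonempty c := ⟨⟨y, hy⟩⟩
  have : IsDirectedOrder c := ⟨fun a b => by
    rcases hchain.total a.2 b.2 with h | h
    · exact ⟨b, h, le_rfl⟩
    · exact ⟨a, le_rfl, h⟩⟩
  let U : Ultrafilter c := Ultrafilter.of Filter.atTop
  have hU : (U : Filter c) ≤ Filter.atTop := Ultrafilter.of_le _
  obtain ⟨x, hx⟩ := WLim.exists_of_bounded U (f := fun i : c => (i : H →L[ℂ] H)) (C := 1)
    (fun i => norm_le_one_of_nonneg (hc i.2).2.1 (hc i.2).2.2.1)
  have hle : ∀ a ∈ c, a ≤ x := fun a ha =>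
    (WLim.const (U : Filter c) a).le hx (hU (Filter.eventually_ge_atTop (⟨a, ha⟩ : c)))
  have hxM : x ∈ M := hx.mem hτ.vna (Filter.Eventually.of_forall fun i => (hc i.2).1)
  refine ⟨x, ⟨hxM, hx.nonneg (Filter.Eventually.of_forall fun i => (hc i.2).2.1),
    hx.le (WLim.const (U : Filter c) 1) (Filter.Eventually.of_forall fun i => (hc i.2).2.2.1), ?_⟩, hle⟩
  refine le_of_tendsto ((Complex.continuous_re.tendsto _).comp (hx ξ ξ))
    (Filter.Eventually.of_forall fun i => ?_)
  exact (hc i.2).2.2.2.trans (hτ.re_mono (hc i.2).1 hxM (hle _ i.2))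

theorem exists_dominating_vector :
    ∃ s ∈ M, s ≠ 0 ∧ ∃ η : H, ∀ x ∈ M, sq2 τ (x * s) ≤ ‖x η‖ ^ 2 := by
  have := hτ.nontrivial
  obtain ⟨ξ, hξ⟩ := NormedSpace.exists_lt_norm ℂ H 1
  obtain ⟨m, ⟨hmM, hm0, hm1, hm⟩, hmax⟩ := hτ.exists_maximal_le_vector ξ
  have hbM : 1 - m ∈ M := hτ.vna.sub_mem hτ.vna.one_mem hmM
  obtain ⟨s, hs, hs0, hss, hsb⟩ := hτ.vna.exists_star_mul_self hbM (sub_nonneg.2 hm1)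
  refine ⟨s, hs, ?_, s ξ, ?_⟩
  · rintro rfl
    rw [zero_mul, eq_comm, sub_eq_zero] at hsb
    rw [← hsb] at hm
    rw [one_apply_eq_self, hτ.map_one, ← RCLike.re_eq_complex_re,
      inner_self_eq_norm_sq (𝕜 := ℂ), RCLike.one_re] at hm
    nlinarith
  · have key : ∀ x ∈ M, ‖x‖ ≤ 1 → sq2 τ (x * s) ≤ ‖x (s ξ)‖ ^ 2 := by
      intro x hx hx1
      by_contra! hlt
      have hxs := hτ.vna.mul_mem _ hx _ hs
      set y := star (x * s) * (x * s) with hy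
      have hyM : y ∈ M := hτ.vna.mul_mem _ (hτ.vna.star_mem _ hxs) _ hxs
      have hy0 : 0 ≤ y := star_mul_self_nonneg _
      have hyb : y ≤ 1 - m := by
        rw [← hsb]
        have := star_left_conjugate_le_conjugate (star_mul_self_le_one hx1) s
        simpa [hy, mul_assoc, hss] using this
      have hin : (inner ℂ ξ (y ξ)).re = ‖x (s ξ)‖ ^ 2 := by
        rw [hy, ContinuousLinearMap.star_eq_adjoint, mul_apply_eq_comp,
          ContinuousLinearMap.adjoint_inner_right, inner_self_eq_norm_sq_to_K]
        norm_cast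
      have hz := hmax (y := m + y) ⟨hτ.vna.add_mem _ hmM _ hyM, add_nonneg hm0 hy0,
        by simpa using add_le_add_right hyb m, by
          simp only [add_apply, inner_add_right, map_add, Complex.add_re, hin]
          exact add_le_add hm hlt.le⟩ (by simpa using hy0)
      have hy00 : y = 0 := le_antisymm (by simpa using hz) hy0
      have h1 : sq2 τ (x * s) = 0 := by rw [sq2, ← hy, hy00]; simp
      rw [h1] at hlt
      exact absurd hlt (not_lt.2 (by positivity))
    intro x hx
    set r : ℝ := ‖x‖ + 1
    have hr : 0 < r := by positivity
    have h1 := key (((r⁻¹ : ℝ) : ℂ) • x) (hτ.vna.smul_mem _ _ hx) (by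
      rw [norm_smul, Complex.norm_real, Real.norm_of_nonneg (by positivity), inv_mul_le_iff₀ hr]
      simp [r])
    have h2 : sq2 τ ((((r⁻¹ : ℝ) : ℂ) • x) * s) = (r⁻¹) ^ 2 * sq2 τ (x * s) := by
      simp only [sq2, smul_mul_assoc, star_smul, mul_smul_comm, map_smul, smul_eq_mul,
        Complex.star_def, Complex.conj_ofReal, Complex.re_ofReal_mul]
      ring
    rw [h2, smul_apply, norm_smul, Complex.norm_real,
      Real.norm_of_nonneg (by positivity), mul_pow] at h1
    exact le_of_mul_le_mul_left h1 (by positivity)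

end TracialState

end

section

/-! ### The GNS representation of a tracial state -/

/-- A von Neumann algebra as a linear subspace. -/
def IsVonNeumannAlgebra.toSubmodule {M : Set (H →L[ℂ] H)} (hM : IsVonNeumannAlgebra M) :
    Submodule ℂ (H →L[ℂ] H) where
  carrier := M
  add_mem' := fun {x y} hx hy => hM.add_mem x hx y hy
  zero_mem' := hM.zero_mem
  smul_mem' := hM.smul_mem

namespace TracialState

variable {M : Set (H →L[ℂ] H)} {τ : (H →L[ℂ] H) →ₗ[ℂ] ℂ}

/-- A type synonym of `M` carrying the inner product defined by the trace. -/
def PreGNS (hτ : TracialState M τ) : Type _ := hτ.vna.toSubmodule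

variable (hτ : TracialState M τ)

instance : AddCommGroup hτ.PreGNS := inferInstanceAs (AddCommGroup hτ.vna.toSubmodule)
instance : Module ℂ hτ.PreGNS := inferInstanceAs (Module ℂ hτ.vna.toSubmodule)

/-- The identification of `M` with its synonym. -/
def toPreGNS : hτ.vna.toSubmodule ≃ₗ[ℂ] hτ.PreGNS := LinearEquiv.refl ℂ _

/-- The semi-inner product `⟨x, y⟩ = τ (x* y)`. -/
abbrev preGNSCore : PreInnerProductSpace.Core ℂ hτ.PreGNS where
  inner a b := τ (star (hτ.toPreGNS.symm a : H →L[ℂ] H) * hτ.toPreGNS.symm b)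
  conj_inner_symm a b :=
    (hτ.apply_star_mul (hτ.toPreGNS.symm b).2 (hτ.toPreGNS.symm a).2).symm
  re_inner_nonneg a := (Complex.nonneg_iff.1 (hτ.nonneg _ (hτ.toPreGNS.symm a).2)).1
  add_left a b c := by simp [add_mul]
  smul_left a b c := by simp

instance : SeminormedAddCommGroup hτ.PreGNS :=
  InnerProductSpace.Core.toSeminormedAddCommGroup (c := hτ.preGNSCore)
instance : InnerProductSpace ℂ hτ.PreGNS := InnerProductSpace.ofCore hτ.preGNSCore

end TracialState

/-- A linear map `j` from `M` to a Hilbert space exhibiting it as the completion of `M` for the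
inner product given by the trace. -/
structure IsGNS {V : Type*} [NormedAddCommGroup V] [InnerProductSpace ℂ V] (M : Set (H →L[ℂ] H))
    (τ : (H →L[ℂ] H) →ₗ[ℂ] ℂ) (j : (H →L[ℂ] H) →ₗ[ℂ] V) : Prop where
  inner_map : ∀ x ∈ M, ∀ y ∈ M, inner ℂ (j x) (j y) = τ (star x * y)
  dense : Dense (j '' M)

theorem TracialState.exists_isGNS {M : Set (H →L[ℂ] H)} {τ : (H →L[ℂ] H) →ₗ[ℂ] ℂ}
    (hτ : TracialState M τ) : ∃ j : (H →L[ℂ] H) →ₗ[ℂ] UniformSpace.Completion hτ.PreGNS,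
      IsGNS M τ j := by
  obtain ⟨j, hj⟩ := LinearMap.exists_extend
    ((UniformSpace.Completion.toComplL (𝕜 := ℂ) (E := hτ.PreGNS)).toLinearMap ∘ₗ
      hτ.toPreGNS.toLinearMap)
  have hj' : ∀ x : hτ.vna.toSubmodule, j x = ((hτ.toPreGNS x : hτ.PreGNS) :
      UniformSpace.Completion hτ.PreGNS) := fun x => LinearMap.congr_fun hj x
  refine ⟨j, fun x hx y hy => ?_, ?_⟩
  · have h1 := hj' ⟨x, hx⟩
    have h2 := hj' ⟨y, hy⟩
    simp only at h1 h2
    rw [h1, h2, UniformSpace.Completion.inner_coe]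
    rfl
  · refine (UniformSpace.Completion.denseRange_coe (α := hτ.PreGNS)).mono ?_
    rintro _ ⟨x, rfl⟩
    exact ⟨hτ.toPreGNS.symm x, (hτ.toPreGNS.symm x).2, by rw [hj']; simp⟩

namespace IsGNS

variable {V : Type*} [NormedAddCommGroup V] [InnerProductSpace ℂ V]
  {M : Set (H →L[ℂ] H)} {τ : (H →L[ℂ] H) →ₗ[ℂ] ℂ} {j : (H →L[ℂ] H) →ₗ[ℂ] V} (hj : IsGNS M τ j)
include hj

theorem norm_sq {x : H →L[ℂ] H} (hx : x ∈ M) : ‖j x‖ ^ 2 = sq2 τ x := by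
  rw [sq2, ← hj.inner_map x hx x hx, ← RCLike.re_eq_complex_re, inner_self_eq_norm_sq (𝕜 := ℂ)]

theorem ext {W : Type*} [NormedAddCommGroup W] [NormedSpace ℂ W] {S T : V →L[ℂ] W}
    (h : ∀ x ∈ M, S (j x) = T (j x)) : S = T := by
  refine DFunLike.coe_injective (Continuous.ext_on hj.dense S.continuous T.continuous ?_)
  rintro _ ⟨x, hx, rfl⟩
  exact h x hx

theorem exists_extension [CompleteSpace V] (hM : IsVonNeumannAlgebra M)
    (T : (H →L[ℂ] H) →ₗ[ℂ] (H →L[ℂ] H)) (hT : ∀ x ∈ M, T x ∈ M) {C : ℝ} (hC : 0 ≤ C)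
    (hb : ∀ x ∈ M, sq2 τ (T x) ≤ C ^ 2 * sq2 τ x) :
    ∃ L : V →L[ℂ] V, ‖L‖ ≤ C ∧ ∀ x ∈ M, L (j x) = j (T x) := by
  let e : hM.toSubmodule →ₗ[ℂ] V := j.domRestrict hM.toSubmodule
  let f : hM.toSubmodule →ₗ[ℂ] V := (j ∘ₗ T).domRestrict hM.toSubmodule
  have he : DenseRange e := hj.dense.mono (by
    rintro _ ⟨x, hx, rfl⟩
    exact ⟨⟨x, hx⟩, rfl⟩)
  have hn : ∀ x, ‖f x‖ ≤ C * ‖e x‖ := by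
    intro x
    refine (sq_le_sq₀ (norm_nonneg _) (by positivity)).1 ?_
    rw [mul_pow]
    have := hb x x.2
    rwa [← hj.norm_sq x.2, ← hj.norm_sq (hT x x.2)] at this
  refine ⟨f.extendOfNorm e, LinearMap.opNorm_extendOfNorm_le he hC hn, fun x hx => ?_⟩
  exact LinearMap.extendOfNorm_eq he ⟨C, hn⟩ ⟨x, hx⟩

end IsGNS

end

section

/-- `l` and `r` are the left and right regular representations of `M` on its GNS space. -/
structure IsRegularRep {V : Type*} [NormedAddCommGroup V] [InnerProductSpace ℂ V] (M : Set (H →L[ℂ] H))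
    (τ : (H →L[ℂ] H) →ₗ[ℂ] ℂ) (j : (H →L[ℂ] H) →ₗ[ℂ] V)
    (l r : (H →L[ℂ] H) → (V →L[ℂ] V)) : Prop where
  trace : TracialState M τ
  gns : IsGNS M τ j
  norm_left : ∀ x ∈ M, ‖l x‖ ≤ ‖x‖
  left : ∀ x ∈ M, ∀ y ∈ M, l x (j y) = j (x * y)
  right : ∀ x ∈ M, ∀ y ∈ M, r x (j y) = j (y * x)

variable {V : Type*} [NormedAddCommGroup V] [InnerProductSpace ℂ V] [CompleteSpace V]
  {M : Set (H →L[ℂ] H)} {τ : (H →L[ℂ] H) →ₗ[ℂ] ℂ} {j : (H →L[ℂ] H) →ₗ[ℂ] V}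
  {l r : (H →L[ℂ] H) → (V →L[ℂ] V)}

theorem IsGNS.exists_isRegularRep (hτ : TracialState M τ) (hj : IsGNS M τ j) :
    ∃ l r : (H →L[ℂ] H) → (V →L[ℂ] V), IsRegularRep M τ j l r := by
  have h1 : ∀ x : H →L[ℂ] H, ∃ L : V →L[ℂ] V, x ∈ M → ‖L‖ ≤ ‖x‖ ∧ ∀ y ∈ M, L (j y) = j (x * y) := by
    intro x
    by_cases hx : x ∈ M
    · obtain ⟨L, hL⟩ := hj.exists_extension hτ.vna (LinearMap.mulLeft ℂ x)
        (fun y hy => hτ.vna.mul_mem x hx y hy) (norm_nonneg x) (fun y hy => hτ.sq2_mul_le hx hy)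
      exact ⟨L, fun _ => hL⟩
    · exact ⟨0, fun h => absurd h hx⟩
  have h2 : ∀ x : H →L[ℂ] H, ∃ L : V →L[ℂ] V, x ∈ M → ‖L‖ ≤ ‖x‖ ∧ ∀ y ∈ M, L (j y) = j (y * x) := by
    intro x
    by_cases hx : x ∈ M
    · obtain ⟨L, hL⟩ := hj.exists_extension hτ.vna (LinearMap.mulRight ℂ x)
        (fun y hy => hτ.vna.mul_mem y hy x hx) (norm_nonneg x) (fun y hy => hτ.sq2_mul_le' hx hy)
      exact ⟨L, fun _ => hL⟩
    · exact ⟨0, fun h => absurd h hx⟩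
  choose l hl using h1
  choose r hr using h2
  exact ⟨l, r, hτ, hj, fun x hx => (hl x hx).1, fun x hx => (hl x hx).2, fun x hx => (hr x hx).2⟩

omit [CompleteSpace V] in
theorem IsGNS.ext_inner (hj : IsGNS M τ j) {S T : V →L[ℂ] V}
    (h : ∀ x ∈ M, ∀ y ∈ M, inner ℂ (j y) (S (j x)) = inner ℂ (j y) (T (j x))) : S = T := by
  refine hj.ext fun x hx => ?_
  refine hj.dense.eq_of_inner_right (𝕜 := ℂ) ?_
  rintro _ ⟨y, hy, rfl⟩
  exact h x hx y hy

namespace IsRegularRep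

variable (hR : IsRegularRep M τ j l r)
include hR

theorem left_mul {x y : H →L[ℂ] H} (hx : x ∈ M) (hy : y ∈ M) : l (x * y) = l x * l y := by
  have hM := hR.trace.vna
  refine hR.gns.ext fun z hz => ?_
  rw [mul_apply_eq_comp, hR.left _ (hM.mul_mem _ hx _ hy) _ hz, hR.left _ hy _ hz,
    hR.left _ hx _ (hM.mul_mem _ hy _ hz), mul_assoc]

theorem left_add {x y : H →L[ℂ] H} (hx : x ∈ M) (hy : y ∈ M) : l (x + y) = l x + l y := by
  refine hR.gns.ext fun z hz => ?_
  rw [add_apply, hR.left _ (hR.trace.vna.add_mem _ hx _ hy) _ hz, hR.left _ hy _ hz,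
    hR.left _ hx _ hz, add_mul, map_add]

theorem left_smul (c : ℂ) {x : H →L[ℂ] H} (hx : x ∈ M) : l (c • x) = c • l x := by
  refine hR.gns.ext fun z hz => ?_
  rw [smul_apply, hR.left _ (hR.trace.vna.smul_mem _ _ hx) _ hz, hR.left _ hx _ hz,
    smul_mul_assoc, map_smul]

theorem left_sub {x y : H →L[ℂ] H} (hx : x ∈ M) (hy : y ∈ M) : l (x - y) = l x - l y := by
  refine hR.gns.ext fun z hz => ?_
  rw [sub_apply, hR.left _ (hR.trace.vna.sub_mem hx hy) _ hz, hR.left _ hy _ hz,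
    hR.left _ hx _ hz, sub_mul, map_sub]

theorem left_one : l 1 = 1 := by
  refine hR.gns.ext fun z hz => ?_
  rw [hR.left _ hR.trace.vna.one_mem _ hz, one_mul, one_apply_eq_self]

theorem left_right {x y : H →L[ℂ] H} (hx : x ∈ M) (hy : y ∈ M) : l x * r y = r y * l x := by
  have hM := hR.trace.vna
  refine hR.gns.ext fun z hz => ?_
  rw [mul_apply_eq_comp, mul_apply_eq_comp, hR.right _ hy _ hz, hR.left _ hx _ hz,
    hR.left _ hx _ (hM.mul_mem _ hz _ hy), hR.right _ hy _ (hM.mul_mem _ hx _ hz), mul_assoc]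

theorem star_left {x : H →L[ℂ] H} (hx : x ∈ M) : star (l x) = l (star x) := by
  have hM := hR.trace.vna
  refine hR.gns.ext_inner fun y hy z hz => ?_
  rw [ContinuousLinearMap.star_eq_adjoint, ContinuousLinearMap.adjoint_inner_right,
    hR.left _ hx _ hz, hR.left _ (hM.star_mem _ hx) _ hy, hR.gns.inner_map _ (hM.mul_mem _ hx _ hz)
    _ hy, hR.gns.inner_map _ hz _ (hM.mul_mem _ (hM.star_mem _ hx) _ hy), star_mul, mul_assoc]

theorem star_right {x : H →L[ℂ] H} (hx : x ∈ M) : star (r x) = r (star x) := by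
  have hM := hR.trace.vna
  have hxs := hM.star_mem _ hx
  refine hR.gns.ext_inner fun y hy z hz => ?_
  rw [ContinuousLinearMap.star_eq_adjoint, ContinuousLinearMap.adjoint_inner_right,
    hR.right _ hx _ hz, hR.right _ hxs _ hy, hR.gns.inner_map _ (hM.mul_mem _ hz _ hx)
    _ hy, hR.gns.inner_map _ hz _ (hM.mul_mem _ hy _ hxs), star_mul, mul_assoc,
    hR.trace.tracial _ hxs _ (hM.mul_mem _ (hM.star_mem _ hz) _ hy), mul_assoc]

end IsRegularRep

/-- `T` intertwines the inclusion of `M` in `B(H)` with the left regular representation. -/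
def Intertwines (M : Set (H →L[ℂ] H)) (l : (H →L[ℂ] H) → (V →L[ℂ] V)) (T : H →L[ℂ] V) : Prop :=
  ∀ x ∈ M, ∀ h, T (x h) = l x (T h)

/-- The vectors in the ranges of the intertwiners. -/
def normalVectors (M : Set (H →L[ℂ] H)) (l : (H →L[ℂ] H) → (V →L[ℂ] V)) : Set V :=
  {v | ∃ T, Intertwines M l T ∧ ∃ h, T h = v}

namespace IsRegularRep

variable (hR : IsRegularRep M τ j l r)
include hR

theorem exists_intertwines : ∃ T, Intertwines M l T ∧ T ≠ 0 := by
  have hM := hR.trace.vna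
  obtain ⟨s, hs, hs0, η, hη⟩ := hR.trace.exists_dominating_vector
  set O : Set H := (fun x : H →L[ℂ] H => x η) '' M
  set U := (Submodule.span ℂ O).topologicalClosure
  have hmem : ∀ x ∈ M, x η ∈ U := fun x hx =>
    Submodule.le_topologicalClosure _ (Submodule.subset_span ⟨x, hx, rfl⟩)
  let e : hM.toSubmodule →ₗ[ℂ] U :=
    { toFun := fun x => ⟨(x : H →L[ℂ] H) η, hmem _ x.2⟩
      map_add' := fun x y => Subtype.ext (by simp)
      map_smul' := fun c x => Subtype.ext (by simp) }
  let f : hM.toSubmodule →ₗ[ℂ] V := (j ∘ₗ LinearMap.mulRight ℂ s).domRestrict hM.toSubmodule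
  have hrange : Submodule.span ℂ O ≤ (LinearMap.range e).map U.subtype := by
    refine Submodule.span_le.2 ?_
    rintro _ ⟨x, hx, rfl⟩
    exact ⟨e ⟨x, hx⟩, ⟨_, rfl⟩, rfl⟩
  have he : DenseRange e := by
    intro u
    rw [closure_subtype]
    refine closure_mono ?_ u.2
    intro v hv
    obtain ⟨w, ⟨x, rfl⟩, rfl⟩ := hrange hv
    exact ⟨e x, ⟨x, rfl⟩, rfl⟩
  have hn : ∀ x, ‖f x‖ ≤ 1 * ‖e x‖ := by
    intro x
    rw [one_mul]
    refine (sq_le_sq₀ (norm_nonneg _) (norm_nonneg _)).1 ?_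
    have h1 := hR.gns.norm_sq (hM.mul_mem _ x.2 _ hs)
    have h2 := hη x x.2
    rw [← h1] at h2
    exact h2
  set T1 : U →L[ℂ] V := f.extendOfNorm e
  have hT1 : ∀ x (hx : x ∈ M), T1 ⟨x η, hmem x hx⟩ = j (x * s) := fun x hx =>
    LinearMap.extendOfNorm_eq he ⟨1, hn⟩ ⟨x, hx⟩
  have hproj : ∀ x ∈ M, U.starProjection * x = x * U.starProjection := by
    intro x hx
    refine spanProj_commute (s := O) ?_ ?_
    · rintro _ ⟨y, hy, rfl⟩
      exact ⟨x * y, hM.mul_mem _ hx _ hy, rfl⟩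
    · rintro _ ⟨y, hy, rfl⟩
      exact ⟨star x * y, hM.mul_mem _ (hM.star_mem _ hx) _ hy, rfl⟩
  refine ⟨T1 ∘L U.orthogonalProjectionOnto, fun x hx h => ?_, fun h0 => hs0 ?_⟩
  · have hinv : ∀ u : U, x u ∈ U := by
      intro u
      rw [← Submodule.starProjection_eq_self_iff]
      have := DFunLike.congr_fun (hproj x hx) (u : H)
      simp only [mul_apply_eq_comp] at this
      rw [this, Submodule.starProjection_eq_self_iff.2 u.2]
    have h1 : ∀ u : U, T1 ⟨x u, hinv u⟩ = l x (T1 u) := by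
      intro u
      have hc1 : Continuous fun u : U => T1 ⟨x u, hinv u⟩ := T1.continuous.comp
        ((x.continuous.comp continuous_subtype_val).subtype_mk _)
      refine congrFun (he.equalizer hc1 ((l x).continuous.comp T1.continuous) ?_) u
      ext y
      have h2 := hT1 (x * y) (hM.mul_mem _ hx _ y.2)
      have h3 := hT1 y y.2
      have h4 := hR.left x hx _ (hM.mul_mem _ y.2 _ hs)
      calc T1 ⟨x (y.1 η), _⟩ = j (x * y * s) := h2
        _ = l x (T1 ⟨y.1 η, hmem _ y.2⟩) := by rw [h3, h4, mul_assoc]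
    have h5 : U.orthogonalProjectionOnto (x h) = ⟨x (U.orthogonalProjectionOnto h), hinv _⟩ :=
      Subtype.ext (DFunLike.congr_fun (hproj x hx) h)
    simp only [ContinuousLinearMap.comp_apply]
    rw [h5, h1]
  · have h1 := hT1 1 hM.one_mem
    have h2 : U.orthogonalProjectionOnto η = ⟨(1 : H →L[ℂ] H) η, hmem 1 hM.one_mem⟩ :=
      U.orthogonalProjectionOnto_mem_subspace_eq_self ⟨(1 : H →L[ℂ] H) η, hmem 1 hM.one_mem⟩
    have h3 : T1 (U.orthogonalProjectionOnto η) = 0 := DFunLike.congr_fun h0 η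
    rw [h2, h1, one_mul] at h3
    refine hR.trace.eq_zero_of_sq2 hs ?_
    rw [← hR.gns.norm_sq hs, h3]
    simp

end IsRegularRep

end

section

variable {V : Type*} [NormedAddCommGroup V] [InnerProductSpace ℂ V] [CompleteSpace V]
  {M : Set (H →L[ℂ] H)} {τ : (H →L[ℂ] H) →ₗ[ℂ] ℂ} {j : (H →L[ℂ] H) →ₗ[ℂ] V}
  {l r : (H →L[ℂ] H) → (V →L[ℂ] V)}

namespace Intertwines

theorem comp_commutant {T : H →L[ℂ] V} (hT : Intertwines M l T) {m : H →L[ℂ] H}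
    (hm : m ∈ M.centralizer) : Intertwines M l (T ∘L m) := by
  intro x hx h
  have h1 : x (m h) = m (x h) := DFunLike.congr_fun (hm x hx) h
  simp only [ContinuousLinearMap.comp_apply]
  rw [← h1, hT x hx]

end Intertwines

theorem eq_zero_of_normalVectors {a : V →L[ℂ] V}
    (h : ∀ S T, Intertwines M l S → Intertwines M l T → ∀ h k, inner ℂ (S h) (a (T k)) = 0) :
    spanProj (normalVectors M l) * a * spanProj (normalVectors M l) = 0 := by
  refine mul_spanProj_eq_zero ?_
  rintro _ ⟨T, hT, k, rfl⟩
  have h2 : (innerSL ℂ (a (T k))) ∘L spanProj (normalVectors M l) = 0 := by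
    ext v
    refine eq_zero_of_mem_closure_span (innerSL ℂ (a (T k))) ?_
      (Submodule.starProjection_apply_mem _ v)
    rintro _ ⟨S, hS, h', rfl⟩
    rw [innerSL_apply_apply, ← inner_conj_symm, h S T hS hT]
    simp
  refine ext_inner_left ℂ fun v => ?_
  have h3 := DFunLike.congr_fun h2 v
  simp only [ContinuousLinearMap.comp_apply, innerSL_apply_apply, zero_apply] at h3
  rw [mul_apply_eq_comp, inner_zero_right, ← inner_conj_symm, ← star_spanProj,
    ContinuousLinearMap.star_eq_adjoint, ContinuousLinearMap.adjoint_inner_left, h3]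
  simp

namespace IsRegularRep

variable (hR : IsRegularRep M τ j l r)
include hR

theorem commute_left {x : H →L[ℂ] H} (hx : x ∈ M) :
    spanProj (normalVectors M l) * l x = l x * spanProj (normalVectors M l) := by
  refine spanProj_commute ?_ ?_
  · rintro _ ⟨T, hT, h, rfl⟩
    exact ⟨T, hT, x h, hT x hx h⟩
  · rintro _ ⟨T, hT, h, rfl⟩
    have hxs := hR.trace.vna.star_mem _ hx
    rw [hR.star_left hx]
    exact ⟨T, hT, star x h, hT _ hxs h⟩

theorem commute_right {x : H →L[ℂ] H} (hx : x ∈ M) :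
    spanProj (normalVectors M l) * r x = r x * spanProj (normalVectors M l) := by
  have key : ∀ y ∈ M, ∀ v ∈ normalVectors M l, r y v ∈ normalVectors M l := by
    rintro y hy _ ⟨T, hT, h, rfl⟩
    refine ⟨r y ∘L T, fun z hz k => ?_, h, rfl⟩
    have := DFunLike.congr_fun (hR.left_right hz hy) (T k)
    simp only [mul_apply_eq_comp] at this
    simp only [ContinuousLinearMap.comp_apply]
    rw [hT z hz, this]
  refine spanProj_commute (key x hx) ?_
  rw [hR.star_right hx]
  exact key _ (hR.trace.vna.star_mem _ hx)

/-- Every operator annihilated by the normal part of the left regular representation of a factor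
vanishes. -/
theorem eq_zero_of_left_mul (hf : IsFactor M) {x : H →L[ℂ] H} (hx : x ∈ M)
    (h0 : l x * spanProj (normalVectors M l) = 0) : x = 0 := by
  have hM := hR.trace.vna
  obtain ⟨T0, hT0, hne⟩ := hR.exists_intertwines
  set W : Set H := {h | ∀ T, Intertwines M l T → T h = 0} with hW
  have hQM : spanProj W ∈ M := hM.spanProj_mem fun y hy v hv T hT => hv _ (hT.comp_commutant hy)
  have hinv : ∀ y ∈ M, ∀ v ∈ W, y v ∈ W := fun y hy v hv T hT => by
    rw [hT y hy, hv T hT, map_zero]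
  obtain ⟨c, hc⟩ := hf _ hQM fun y hy =>
    spanProj_commute (hinv y hy) (hinv _ (hM.star_mem _ hy))
  have h1 : T0 ∘L spanProj W = 0 := by
    ext h
    refine eq_zero_of_mem_closure_span T0 ?_ (Submodule.starProjection_apply_mem _ h)
    exact fun v hv => hv T0 hT0
  have hc0 : c = 0 := by
    by_contra hc0
    refine hne ?_
    ext h
    have := DFunLike.congr_fun h1 h
    simpa [hc, hc0] using this
  ext h
  have hxW : x h ∈ W := by
    intro T hT
    have h2 : spanProj (normalVectors M l) (T h) = T h :=
      spanProj_apply_of_mem ⟨T, hT, h, rfl⟩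
    have h3 := DFunLike.congr_fun h0 (T h)
    rw [mul_apply_eq_comp, h2] at h3
    rw [hT x hx, h3]
    rfl
  have h4 := spanProj_apply_of_mem hxW
  rw [hc, hc0] at h4
  simpa using h4.symm

/-- The projection of the trace vector to the normal part. -/
theorem left_apply_vector {x : H →L[ℂ] H} (hx : x ∈ M) :
    l x (spanProj (normalVectors M l) (j 1)) = spanProj (normalVectors M l) (j x) := by
  have h1 := DFunLike.congr_fun (hR.commute_left hx) (j 1)
  simp only [mul_apply_eq_comp] at h1
  rw [← h1, hR.left x hx 1 hR.trace.vna.one_mem, mul_one]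

theorem right_apply_vector {x : H →L[ℂ] H} (hx : x ∈ M) :
    r x (spanProj (normalVectors M l) (j 1)) = spanProj (normalVectors M l) (j x) := by
  have h1 := DFunLike.congr_fun (hR.commute_right hx) (j 1)
  simp only [mul_apply_eq_comp] at h1
  rw [← h1, hR.right x hx 1 hR.trace.vna.one_mem, one_mul]

theorem eq_zero_of_left_apply_vector (hf : IsFactor M) {x : H →L[ℂ] H} (hx : x ∈ M)
    (h : l x (spanProj (normalVectors M l) (j 1)) = 0) : x = 0 := by
  refine hR.eq_zero_of_left_mul hf hx (hR.gns.ext fun y hy => ?_)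
  have h1 := DFunLike.congr_fun (hR.left_right hx hy) (spanProj (normalVectors M l) (j 1))
  simp only [mul_apply_eq_comp] at h1
  rw [h, map_zero, hR.right_apply_vector hy] at h1
  simpa using h1

theorem tendsto_left {F : Filter (H →L[ℂ] H)} {C : ℝ} {x : H →L[ℂ] H}
    (hF : ∀ᶠ T in F, T ∈ M ∧ ‖T‖ ≤ C) (hx : WLim F id x) :
    Filter.Tendsto (fun T => inner ℂ (spanProj (normalVectors M l) (j 1))
      (l T (spanProj (normalVectors M l) (j 1)))) F
      (nhds (inner ℂ (spanProj (normalVectors M l) (j 1))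
        (l x (spanProj (normalVectors M l) (j 1))))) := by
  classical
  rw [Filter.tendsto_iff_ultrafilter]
  intro U hU
  have hFU := hU hF
  have hxU : WLim (U : Filter (H →L[ℂ] H)) id x := fun h k => (hx h k).mono_left hU
  have hxM : x ∈ M := hxU.mem hR.trace.vna (Filter.mem_of_superset hFU fun T hT => hT.1)
  set f : (H →L[ℂ] H) → (V →L[ℂ] V) := fun T => if T ∈ M ∧ ‖T‖ ≤ C then l T else 0 with hf
  have hev : ∀ᶠ T in (U : Filter (H →L[ℂ] H)), f T = l T :=
    Filter.mem_of_superset hFU fun T hT => if_pos hT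
  obtain ⟨y, hy⟩ := WLim.exists_of_bounded U (f := f) (C := max C 0) (fun T => by
    by_cases hT : T ∈ M ∧ ‖T‖ ≤ C
    · rw [hf]
      simp only [if_pos hT]
      exact ((hR.norm_left T hT.1).trans hT.2).trans (le_max_left _ _)
    · rw [hf]
      simp only [if_neg hT, norm_zero]
      exact le_max_right _ _)
  have h1 : (y - l x) * spanProj (normalVectors M l) = 0 := by
    refine mul_spanProj_eq_zero ?_
    rintro _ ⟨S, hS, h, rfl⟩
    rw [sub_apply, sub_eq_zero]
    refine ext_inner_left ℂ fun v => ?_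
    refine tendsto_nhds_unique (hy v (S h)) ?_
    have h2 : Filter.Tendsto (fun T : H →L[ℂ] H => inner ℂ (S.adjoint v) (T h)) U
        (nhds (inner ℂ (S.adjoint v) (x h))) := hxU _ _
    simp only [ContinuousLinearMap.adjoint_inner_left] at h2
    rw [hS x hxM] at h2
    refine h2.congr' ?_
    filter_upwards [hev, hFU] with T hT hT'
    rw [hT, hS T hT'.1]
  have h3 : y (spanProj (normalVectors M l) (j 1)) = l x (spanProj (normalVectors M l) (j 1)) := by
    have := DFunLike.congr_fun h1 (j 1)
    simpa [sub_eq_zero] using this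
  rw [← h3]
  refine (hy (spanProj (normalVectors M l) (j 1)) (spanProj (normalVectors M l) (j 1))).congr' ?_
  filter_upwards [hev] with T hT
  rw [hT]

theorem exists_approx (D : StarSubalgebra ℂ (H →L[ℂ] H)) (hDM : (D : Set (H →L[ℂ] H)) ⊆ M)
    {x : H →L[ℂ] H} (hxM : x ∈ M) (hx : x ∈ (D : Set (H →L[ℂ] H)).centralizer.centralizer)
    {ε : ℝ} (hε : 0 < ε) :
    ∃ d ∈ D, ‖l (x - d) (spanProj (normalVectors M l) (j 1))‖ < ε := by
  set P := spanProj (normalVectors M l) with hP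
  set ξ := P (j 1) with hξ
  set O : Set V := (fun d => l d ξ) '' (D : Set (H →L[ℂ] H)) with hO
  have hPl : ∀ y ∈ M, P * l y = l y * P := fun y hy => hR.commute_left hy
  have hPP : P * P = P := spanProj_idem _
  have hPξ : P ξ = ξ := DFunLike.congr_fun hPP (j 1)
  have hQl : ∀ d ∈ D, spanProj O * l d = l d * spanProj O := by
    intro d hd
    refine spanProj_commute ?_ ?_
    · rintro _ ⟨d', hd', rfl⟩
      exact ⟨d * d', D.mul_mem hd hd', by
        simp [hR.left_mul (hDM hd) (hDM hd'), mul_apply_eq_comp]⟩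
    · rintro _ ⟨d', hd', rfl⟩
      have hds : star d ∈ D := star_mem hd
      rw [hR.star_left (hDM hd)]
      exact ⟨star d * d', D.mul_mem hds hd', by
        simp [hR.left_mul (hDM hds) (hDM hd'), mul_apply_eq_comp]⟩
  have h1 : P * (spanProj O * l x - l x * spanProj O) * P = 0 := by
    refine eq_zero_of_normalVectors fun S T hS hT h k => ?_
    have hSl : ∀ y ∈ M, ∀ v, y (S.adjoint v) = S.adjoint (l y v) := by
      intro y hy v
      refine ext_inner_left ℂ fun w => ?_
      have hys := hR.trace.vna.star_mem _ hy
      rw [ContinuousLinearMap.adjoint_inner_right, ← ContinuousLinearMap.adjoint_inner_left y,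
        ContinuousLinearMap.adjoint_inner_right, ← ContinuousLinearMap.star_eq_adjoint, hS _ hys,
        ← hR.star_left hy, ContinuousLinearMap.star_eq_adjoint,
        ContinuousLinearMap.adjoint_inner_left]
    have hc : S.adjoint ∘L spanProj O ∘L T ∈ (D : Set (H →L[ℂ] H)).centralizer := by
      intro d hd
      ext k
      have h2 := DFunLike.congr_fun (hQl d hd) (T k)
      simp only [mul_apply_eq_comp] at h2
      simp only [mul_apply_eq_comp, ContinuousLinearMap.comp_apply]
      rw [hSl d (hDM hd), hT d (hDM hd), h2]
    have h3 := DFunLike.congr_fun (hx _ hc) k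
    simp only [mul_apply_eq_comp, ContinuousLinearMap.comp_apply] at h3
    rw [hSl x hxM, hT x hxM] at h3
    rw [← ContinuousLinearMap.adjoint_inner_right, sub_apply, map_sub, mul_apply_eq_comp,
      mul_apply_eq_comp, h3, sub_self, inner_zero_right]
  have hξO : ξ ∈ O := ⟨1, D.one_mem, by simp [hR.left_one]⟩
  have hQξ : spanProj O ξ = ξ := spanProj_apply_of_mem hξO
  have hPO : P * spanProj O = spanProj O := by
    have : (P - 1) * spanProj O = 0 := by
      refine mul_spanProj_eq_zero ?_
      rintro _ ⟨d, hd, rfl⟩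
      have h2 := DFunLike.congr_fun (hPl d (hDM hd)) ξ
      simp only [mul_apply_eq_comp, hPξ] at h2
      simp [h2]
    rwa [sub_mul, sub_eq_zero, one_mul] at this
  have hmem : l x ξ ∈ (Submodule.span ℂ O).topologicalClosure := by
    rw [← Submodule.starProjection_eq_self_iff]
    change spanProj O (l x ξ) = l x ξ
    have h2 := DFunLike.congr_fun h1 ξ
    have h3 := DFunLike.congr_fun (hPl x hxM) ξ
    have h4 := DFunLike.congr_fun hPO (l x ξ)
    simp only [mul_apply_eq_comp, hPξ] at h2 h3 h4
    rw [sub_apply, map_sub, mul_apply_eq_comp, mul_apply_eq_comp, hQξ, h4, h3] at h2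
    simpa [sub_eq_zero] using h2
  have hspan : ∀ v ∈ Submodule.span ℂ O, v ∈ O := by
    intro v hv
    induction hv using Submodule.span_induction with
    | mem v hv => exact hv
    | zero => exact ⟨0, D.zero_mem, by
        have := hR.left_smul 0 hR.trace.vna.one_mem
        rw [zero_smul, zero_smul] at this
        simp [this]⟩
    | add v w _ _ hv hw =>
      obtain ⟨a, ha, rfl⟩ := hv
      obtain ⟨b, hb, rfl⟩ := hw
      exact ⟨a + b, D.add_mem ha hb, by simp [hR.left_add (hDM ha) (hDM hb)]⟩
    | smul c v _ hv =>
      obtain ⟨a, ha, rfl⟩ := hv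
      exact ⟨c • a, D.smul_mem ha c, by simp [hR.left_smul c (hDM ha)]⟩
  obtain ⟨v, hv, hlt⟩ := Metric.mem_closure_iff.1 hmem ε hε
  obtain ⟨d, hd, rfl⟩ := hspan v hv
  refine ⟨d, hd, ?_⟩
  rw [hR.left_sub hxM (hDM hd), sub_apply, ← dist_eq_norm]
  exact hlt

end IsRegularRep

end

section

variable {M : Set (H →L[ℂ] H)} {τ : (H →L[ℂ] H) →ₗ[ℂ] ℂ}

/-- A factor with a faithful tracial state has a faithful tracial state which is normal. -/
theorem TracialState.exists_normalTrace (hτ : TracialState M τ) (hf : IsFactor M) :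
    ∃ τ' : (H →L[ℂ] H) →ₗ[ℂ] ℂ, NormalTrace M τ' := by
  obtain ⟨j, hj⟩ := hτ.exists_isGNS
  obtain ⟨l, r, hR⟩ := hj.exists_isRegularRep hτ
  have hM := hτ.vna
  have htend := fun (F : Filter (H →L[ℂ] H)) (C : ℝ) x => hR.tendsto_left (F := F) (C := C) (x := x)
  have hdense := fun D hDM x hx hx' ε hε => hR.exists_approx D hDM (x := x) hx hx' (ε := ε) hε
  have hfaith := fun x hx => hR.eq_zero_of_left_apply_vector hf (x := x) hx
  have hlr : ∀ x ∈ M, l x (spanProj (normalVectors M l) (j 1)) =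
      r x (spanProj (normalVectors M l) (j 1)) := fun x hx =>
    (hR.left_apply_vector hx).trans (hR.right_apply_vector hx).symm
  generalize spanProj (normalVectors M l) (j 1) = ξ at *
  have hne : (1 : H →L[ℂ] H) ≠ 0 := fun h => by
    have := hτ.map_one
    rw [h, map_zero] at this
    exact zero_ne_one this
  have hξ : 0 < ‖ξ‖ ^ 2 := by
    have : ξ ≠ 0 := fun h => hne (hfaith 1 hM.one_mem (by rw [h, map_zero]))
    positivity
  let φ : hM.toSubmodule →ₗ[ℂ] ℂ :=
    { toFun := fun x => (((‖ξ‖ ^ 2)⁻¹ : ℝ) : ℂ) * inner ℂ ξ (l x ξ)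
      map_add' := fun x y => by
        rw [Submodule.coe_add, hR.left_add x.2 y.2, add_apply, inner_add_right, mul_add]
      map_smul' := fun c x => by
        rw [Submodule.coe_smul, hR.left_smul c x.2, smul_apply, inner_smul_right, RingHom.id_apply,
          smul_eq_mul]
        ring }
  obtain ⟨τ', hτ'⟩ := LinearMap.exists_extend φ
  have happ : ∀ x ∈ M, τ' x = (((‖ξ‖ ^ 2)⁻¹ : ℝ) : ℂ) * inner ℂ ξ (l x ξ) := fun x hx =>
    LinearMap.congr_fun hτ' ⟨x, hx⟩
  have hadj : ∀ x ∈ M, ∀ v w, inner ℂ v (l x w) = inner ℂ (l (star x) v) w := by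
    intro x hx v w
    rw [← hR.star_left hx, ContinuousLinearMap.star_eq_adjoint,
      ContinuousLinearMap.adjoint_inner_left]
  have hsq : ∀ x ∈ M, τ' (star x * x) = (((‖ξ‖ ^ 2)⁻¹ * ‖l x ξ‖ ^ 2 : ℝ) : ℂ) := by
    intro x hx
    have hxs := hM.star_mem _ hx
    rw [happ _ (hM.mul_mem _ hxs _ hx), hR.left_mul hxs hx, mul_apply_eq_comp, hadj _ hxs,
      star_star, inner_self_eq_norm_sq_to_K]
    push_cast
    rfl
  refine ⟨τ', ⟨hM, ?_, ?_, ?_, ?_⟩, ?_, ?_⟩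
  · have := hsq 1 hM.one_mem
    rw [star_one, one_mul, hR.left_one, one_apply_eq_self, inv_mul_cancel₀ hξ.ne'] at this
    simpa using this
  · intro x hx
    rw [hsq x hx, Complex.zero_le_real]
    positivity
  · intro x hx y hy
    rw [happ _ (hM.mul_mem _ hx _ hy), happ _ (hM.mul_mem _ hy _ hx)]
    congr 1
    have hys := hM.star_mem _ hy
    have h1 := DFunLike.congr_fun (hR.left_right hx hy) ξ
    simp only [mul_apply_eq_comp] at h1
    rw [hR.left_mul hx hy, hR.left_mul hy hx, mul_apply_eq_comp, mul_apply_eq_comp, hlr y hy, h1,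
      hadj y hy, hlr _ hys, ← hR.star_right hy, ContinuousLinearMap.star_eq_adjoint,
      ContinuousLinearMap.adjoint_inner_left]
  · intro x hx h0
    rw [hsq x hx, Complex.ofReal_eq_zero] at h0
    refine hfaith x hx ?_
    have h1 : ‖l x ξ‖ ^ 2 = 0 := (mul_eq_zero.1 h0).resolve_left (inv_ne_zero hξ.ne')
    exact norm_eq_zero.1 (pow_eq_zero_iff two_ne_zero |>.1 h1)
  · intro F C x hF hx
    rcases F.eq_or_neBot with rfl | hne
    · exact Filter.tendsto_bot
    have hxM : x ∈ M := hx.mem hM (hF.mono fun T hT => hT.1)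
    rw [happ x hxM]
    refine ((htend F C x hF hx).const_mul _).congr' ?_
    filter_upwards [hF] with T hT
    rw [happ T hT.1]
  · intro D hDM x hxM hx ε hε
    obtain ⟨d, hd, hlt⟩ := hdense D hDM x hxM hx (Real.sqrt (ε * ‖ξ‖ ^ 2)) (by positivity)
    refine ⟨d, hd, ?_⟩
    rw [hsq _ (hM.sub_mem hxM (hDM hd)), Complex.ofReal_re, inv_mul_lt_iff₀ hξ, mul_comm]
    rwa [Real.lt_sqrt (norm_nonneg _)] at hlt

namespace NormalTrace

variable (hτ : NormalTrace M τ)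
include hτ

/-- The trace is multiplicative over a subfactor and its relative commutant. -/
theorem apply_mul_of_commute {N : Set (H →L[ℂ] H)} (hN : IsVonNeumannAlgebra N) (hNM : N ⊆ M)
    (hf : IsFactor N) {x y : H →L[ℂ] H} (hx : x ∈ N) (hy : y ∈ M) (hc : ∀ z ∈ N, z * y = y * z) :
    τ (x * y) = τ x * τ y := by
  obtain ⟨E, hE⟩ := hτ.exists_condExp hN hNM
  have hM := hτ.vna
  have hEy := hE.1 y hy
  have hEb : ∀ b ∈ N, τ (E y * b) = τ (y * b) := by
    intro b hb
    have := hE.2 y hy b hb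
    rw [sub_mul, map_sub, sub_eq_zero] at this
    exact this.symm
  obtain ⟨c, hc'⟩ := hf (E y) hEy (by
    intro z hz
    set w := E y * z - z * E y with hw
    have hwN : w ∈ N := hN.sub_mem (hN.mul_mem _ hEy _ hz) (hN.mul_mem _ hz _ hEy)
    have key : ∀ b ∈ N, τ (w * b) = 0 := by
      intro b hb
      have h1 : τ (z * E y * b) = τ (E y * (b * z)) := by
        rw [mul_assoc, hτ.tracial _ (hNM hz) _ (hNM (hN.mul_mem _ hEy _ hb)), mul_assoc]
      have h2 : τ (y * (b * z)) = τ (y * (z * b)) := by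
        rw [← mul_assoc, hτ.tracial _ (hM.mul_mem _ hy _ (hNM hb)) _ (hNM hz), ← mul_assoc,
          hc z hz, mul_assoc]
      rw [hw, sub_mul, map_sub, h1, mul_assoc, hEb _ (hN.mul_mem _ hz _ hb),
        hEb _ (hN.mul_mem _ hb _ hz), h2, sub_self]
    have h3 := key _ (hN.star_mem _ hwN)
    rw [hτ.tracial _ (hNM hwN) _ (hNM (hN.star_mem _ hwN))] at h3
    have := hτ.faithful w (hNM hwN) h3
    rwa [hw, sub_eq_zero] at this)
  have h4 : c = τ y := by
    have := hEb 1 hN.one_mem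
    rw [hc'] at this
    simpa [hτ.map_one] using this
  have h5 := hEb x hx
  rw [hc', h4] at h5
  rw [hτ.tracial _ (hNM hx) _ hy, ← h5]
  simp [mul_comm]

end NormalTrace

end

section

/-! ### The algebra generated by two commuting algebras -/

/-- The linear span of the products of two commuting von Neumann algebras. -/
def prodAlgebra {B₁ B₂ : Set (H →L[ℂ] H)} (h₁ : IsVonNeumannAlgebra B₁)
    (h₂ : IsVonNeumannAlgebra B₂) (hc : ∀ x ∈ B₁, ∀ y ∈ B₂, x * y = y * x) :
    StarSubalgebra ℂ (H →L[ℂ] H) where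
  carrier := Submodule.span ℂ {z | ∃ x ∈ B₁, ∃ y ∈ B₂, z = x * y}
  add_mem' := Submodule.add_mem _
  mul_mem' := by
    intro a b ha hb
    have h := Submodule.mul_mem_mul ha hb
    rw [Submodule.span_mul_span] at h
    refine Submodule.span_mono ?_ h
    rintro _ ⟨_, ⟨x, hx, y, hy, rfl⟩, _, ⟨x', hx', y', hy', rfl⟩, rfl⟩
    refine ⟨x * x', h₁.mul_mem _ hx _ hx', y * y', h₂.mul_mem _ hy _ hy', ?_⟩
    change x * y * (x' * y') = _
    rw [mul_assoc, ← mul_assoc y, ← hc x' hx' y hy]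
    simp only [mul_assoc]
  algebraMap_mem' := by
    intro c
    rw [Algebra.algebraMap_eq_smul_one]
    exact Submodule.smul_mem _ _ (Submodule.subset_span
      ⟨1, h₁.one_mem, 1, h₂.one_mem, (one_mul 1).symm⟩)
  star_mem' := by
    intro a ha
    change a ∈ Submodule.span ℂ _ at ha
    change star a ∈ Submodule.span ℂ _
    induction ha using Submodule.span_induction with
    | mem a ha =>
      obtain ⟨x, hx, y, hy, rfl⟩ := ha
      refine Submodule.subset_span ⟨star x, h₁.star_mem _ hx, star y, h₂.star_mem _ hy, ?_⟩
      rw [star_mul, hc _ (h₁.star_mem _ hx) _ (h₂.star_mem _ hy)]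
    | zero => simp
    | add a b _ _ ha hb => rw [star_add]; exact Submodule.add_mem _ ha hb
    | smul c a _ ha => rw [star_smul]; exact Submodule.smul_mem _ _ ha

theorem NormalTrace.apply_mul_eq_zero {M B₁ B₂ : Set (H →L[ℂ] H)} {τ : (H →L[ℂ] H) →ₗ[ℂ] ℂ}
    (hτ : NormalTrace M τ) (h₁ : IsVonNeumannAlgebra B₁) (h₂ : IsVonNeumannAlgebra B₂)
    (h₁M : B₁ ⊆ M) (h₂M : B₂ ⊆ M) (hc : ∀ x ∈ B₁, ∀ y ∈ B₂, x * y = y * x)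
    {z : H →L[ℂ] H} (hz : z ∈ M) (h0 : ∀ x ∈ B₁, ∀ y ∈ B₂, τ (z * (x * y)) = 0)
    {w : H →L[ℂ] H} (hw : w ∈ vNgen (B₁ ∪ B₂)) : τ (z * w) = 0 := by
  have hM := hτ.vna
  have hD0 : ∀ d ∈ prodAlgebra h₁ h₂ hc, d ∈ M ∧ τ (z * d) = 0 := by
    intro d hd
    change d ∈ Submodule.span ℂ _ at hd
    induction hd using Submodule.span_induction with
    | mem a ha =>
      obtain ⟨x, hx, y, hy, rfl⟩ := ha
      exact ⟨hM.mul_mem _ (h₁M hx) _ (h₂M hy), h0 x hx y hy⟩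
    | zero => exact ⟨hM.zero_mem, by simp⟩
    | add a b _ _ ha hb =>
      exact ⟨hM.add_mem _ ha.1 _ hb.1, by rw [mul_add, map_add, ha.2, hb.2, add_zero]⟩
    | smul c a _ ha => exact ⟨hM.smul_mem _ _ ha.1, by rw [mul_smul_comm, map_smul, ha.2, smul_zero]⟩
  have hwM : w ∈ M := hM.vNgen_subset (Set.union_subset h₁M h₂M) hw
  have hsub : B₁ ∪ B₂ ∪ star '' (B₁ ∪ B₂) ⊆ prodAlgebra h₁ h₂ hc := by
    have h3 : B₁ ∪ B₂ ⊆ prodAlgebra h₁ h₂ hc := by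
      rintro x (hx | hx)
      · exact Submodule.subset_span ⟨x, hx, 1, h₂.one_mem, (mul_one x).symm⟩
      · exact Submodule.subset_span ⟨1, h₁.one_mem, x, hx, (one_mul x).symm⟩
    refine Set.union_subset h3 ?_
    rintro _ ⟨x, hx, rfl⟩
    exact star_mem (h3 hx)
  have hwD : w ∈ (prodAlgebra h₁ h₂ hc : Set (H →L[ℂ] H)).centralizer.centralizer :=
    Set.centralizer_subset (Set.centralizer_subset hsub) hw
  have hzs := hM.star_mem _ hz
  have key : ∀ ε : ℝ, 0 < ε → ‖τ (z * w)‖ ^ 2 ≤ sq2 τ (star z) * ε := by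
    intro ε hε
    obtain ⟨d, hd, hlt⟩ := hτ.dense _ (fun d hd => (hD0 d hd).1) w hwM hwD ε hε
    have h4 := hτ.cauchy_schwarz (hM.sub_mem hwM (hD0 d hd).1) hzs
    rw [star_star, mul_sub, map_sub, (hD0 d hd).2, sub_zero] at h4
    exact h4.trans (mul_le_mul_of_nonneg_left hlt.le (hτ.sq2_nonneg hzs))
  have h5 : ‖τ (z * w)‖ ^ 2 ≤ 0 := by
    refine le_of_forall_pos_le_add fun δ hδ => ?_
    have h6 := hτ.sq2_nonneg hzs
    refine (key (δ / (sq2 τ (star z) + 1)) (by positivity)).trans ?_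
    rw [zero_add, mul_div_assoc', div_le_iff₀ (by positivity)]
    nlinarith
  simpa using le_antisymm h5 (by positivity)

theorem conj_mem_vNgen {S : Set (H →L[ℂ] H)} {u : H →L[ℂ] H} (hu : IsUnitary u)
    (h : ∀ s ∈ S, u * s * star u ∈ S) (hS : ∀ s ∈ S, star s ∈ S) {a : H →L[ℂ] H}
    (ha : a ∈ vNgen S) : u * a * star u ∈ vNgen S := by
  have hmem : ∀ s ∈ S ∪ star '' S, s ∈ S := by
    rintro s (hs | ⟨t, ht, rfl⟩)
    · exact hs
    · exact hS t ht
  intro c hc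
  have h1 : star u * c * u ∈ (S ∪ star '' S).centralizer := by
    intro s hs
    have h2 := hc _ (Or.inl (h s (hmem s hs)))
    calc s * (star u * c * u) = star u * (u * s * star u * c) * u := by
          simp only [← mul_assoc, hu.1, one_mul]
      _ = star u * c * u * s := by
          rw [h2]; simp only [mul_assoc]; rw [hu.1, mul_one]
  have h3 := ha _ h1
  calc c * (u * a * star u) = u * (star u * c * u * a) * star u := by
        simp only [← mul_assoc, hu.2, one_mul]
    _ = u * a * star u * c := by
        rw [h3]; simp only [mul_assoc]; rw [hu.2, mul_one]

theorem normalizerSet_left_subset {M M₁ M₂ A₁ A₂ : Set (H →L[ℂ] H)}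
    (hM₁ : IsVonNeumannAlgebra M₁) (hM₁M : M₁ ⊆ M)
    (hcomm : ∀ x ∈ M₁, ∀ y ∈ M₂, x * y = y * x) (hA₁ : IsMasa M₁ A₁) (hA₂ : IsMasa M₂ A₂) :
    normalizerSet M₁ A₁ ⊆ normalizerSet M (vNgen (A₁ ∪ A₂)) := by
  rintro u ⟨huM, hu, huA⟩
  have hS : ∀ s ∈ A₁ ∪ A₂, star s ∈ A₁ ∪ A₂ := by
    rintro s (hs | hs)
    · exact Or.inl (hA₁.2.1 s hs)
    · exact Or.inr (hA₂.2.1 s hs)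
  have hus : star u ∈ M₁ := hM₁.star_mem _ huM
  have h1 : ∀ s ∈ A₁ ∪ A₂, u * s * star u ∈ A₁ ∪ A₂ := by
    rintro s (hs | hs)
    · exact Or.inl (huA ▸ ⟨s, hs, rfl⟩)
    · rw [hcomm u huM s (hA₂.1 hs), mul_assoc, hu.2, mul_one]
      exact Or.inr hs
  have h2 : ∀ s ∈ A₁ ∪ A₂, star u * s * star (star u) ∈ A₁ ∪ A₂ := by
    rintro s (hs | hs)
    · rw [← huA] at hs
      obtain ⟨t, ht, rfl⟩ := hs
      refine Or.inl ?_
      have : star u * (u * t * star u) * star (star u) = t := by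
        rw [star_star, mul_assoc, mul_assoc, mul_assoc, hu.1, mul_one, ← mul_assoc, hu.1, one_mul]
      rwa [this]
    · rw [hcomm _ hus s (hA₂.1 hs), mul_assoc, star_star, hu.1, mul_one]
      exact Or.inr hs
  refine mem_normalizerSet (hM₁M huM) hu (fun a ha => conj_mem_vNgen hu h1 hS ha) fun a ha => ?_
  have hu' : IsUnitary (star u) := ⟨by rw [star_star]; exact hu.2, by rw [star_star]; exact hu.1⟩
  simpa using conj_mem_vNgen hu' h2 hS ha

end

section

/-! ### The normalizing algebra of the tensor product -/

theorem IsMasa.abelianVN {M A : Set (H →L[ℂ] H)} (hM : IsVonNeumannAlgebra M) (hA : IsMasa M A) :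
    AbelianVN A :=
  ⟨hA.vna hM, fun _ ha _ hb => hA.comm ha hb⟩

theorem NormalTrace.two_mul_apply_le {M : Set (H →L[ℂ] H)} {τ : (H →L[ℂ] H) →ₗ[ℂ] ℂ}
    (hτ : NormalTrace M τ) {θ μ : H →L[ℂ] H} (hθ : θ ∈ M) (hμ : μ ∈ M) (hθs : star θ = θ)
    (hμs : star μ = μ) (t : ℝ) :
    2 * t * (τ (μ * θ)).re ≤ (τ (θ * θ)).re + t ^ 2 * (τ (μ * μ)).re := by
  have h1 := hτ.sq2_add_smul hμ hθ (-(t : ℂ))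
  have h2 : 0 ≤ sq2 τ (θ + (-(t : ℂ)) • μ) :=
    hτ.sq2_nonneg (hτ.vna.add_mem _ hθ _ (hτ.vna.smul_mem _ _ hμ))
  rw [h1, hθs, hτ.tracial _ hθ _ hμ, neg_mul, Complex.neg_re, Complex.re_ofReal_mul, norm_neg,
    Complex.norm_real, Real.norm_eq_abs, sq_abs, sq2, sq2, hθs, hμs] at h2
  linarith

section

variable {M M₁ M₂ A₁ A₂ : Set (H →L[ℂ] H)} {τ : (H →L[ℂ] H) →ₗ[ℂ] ℂ}
  (hτ : NormalTrace M τ) (hM₁ : IsVonNeumannAlgebra M₁) (hM₁M : M₁ ⊆ M) (hM₁f : IsFactor M₁)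
  (hM₂ : IsVonNeumannAlgebra M₂) (hM₂M : M₂ ⊆ M) (hcomm : ∀ x ∈ M₁, ∀ y ∈ M₂, x * y = y * x)
  (hA₁ : IsMasa M₁ A₁) (hA₂ : IsMasa M₂ A₂)
include hτ hM₁ hM₁M hM₁f hM₂ hM₂M hcomm hA₁ hA₂

theorem apply_star_mul_mul_eq_zero_of_norm_le {x y u : H →L[ℂ] H} (hx : x ∈ M₁) (hx1 : ‖x‖ ≤ 1)
    (hn : ∀ n ∈ normAlg M₁ A₁, τ (star n * x) = 0) (hy : y ∈ M₂)
    (hu : u ∈ normalizerSet M (vNgen (A₁ ∪ A₂))) : τ (star u * (x * y)) = 0 := by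
  have hM := hτ.vna
  have hτ₁ := hτ.mono hM₁ hM₁M
  have := hA₁.abelianVN hM₁
  have hA₁v := hA₁.vna hM₁
  have hA₂v := hA₂.vna hM₂
  have hA₁M : A₁ ⊆ M := hA₁.1.trans hM₁M
  have hA₂M : A₂ ⊆ M := hA₂.1.trans hM₂M
  have hAM : vNgen (A₁ ∪ A₂) ⊆ M := hM.vNgen_subset (Set.union_subset hA₁M hA₂M)
  obtain ⟨huM, hu1, huA⟩ := hu
  have husM := hM.star_mem u huM
  have hxM := hM₁M hx
  have hyM := hM₂M hy
  obtain ⟨E, hE⟩ := hτ₁.exists_condExp hA₁v hA₁.1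
  have hq : ∀ p : Pr A₁, star x * p.op * x ∈ M₁ := fun p =>
    hM₁.mul_mem _ (hM₁.mul_mem _ (hM₁.star_mem x hx) _ (hA₁.1 p.mem)) _ hx
  set μ : Pr A₁ → H →L[ℂ] H := fun p => E (star x * p.op * x) with hμdef
  have hμ : Represents A₁ τ x μ := by
    refine ⟨fun p => hE.1 _ (hq p), fun p a ha => ?_⟩
    have h1 := hE.2 _ (hq p) a ha
    rw [sub_mul, map_sub, sub_eq_zero] at h1
    exact h1.symm
  have hμM : ∀ p, μ p ∈ M := fun p => hA₁M (hμ.mem p)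
  have hμs : ∀ p, star (μ p) = μ p := fun p =>
    (IsSelfAdjoint.of_nonneg (hμ.nonneg hτ₁ hA₁.1 hx p)).star_eq
  obtain ⟨θ, hθ⟩ : ∃ θ : Pr A₁ → H →L[ℂ] H, ∀ p, θ p = star u * p.op * u := ⟨_, fun _ => rfl⟩
  have hθA : ∀ p, θ p ∈ vNgen (A₁ ∪ A₂) := by
    intro p
    have h1 : p.op ∈ vNgen (A₁ ∪ A₂) := subset_vNgen _ (Or.inl p.mem)
    rw [← huA] at h1
    obtain ⟨b, hb, hb'⟩ := h1
    have h2 : θ p = b := by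
      rw [hθ, ← hb']
      simp only [mul_assoc]
      rw [hu1.1, mul_one, ← mul_assoc, hu1.1, one_mul]
    exact h2 ▸ hb
  have hθM : ∀ p, θ p ∈ M := fun p => hAM (hθA p)
  have hθs : ∀ p, star (θ p) = θ p := fun p => by simp [hθ, p.sa, mul_assoc]
  have hθθ : ∀ p, θ p * θ p = θ p := by
    intro p
    rw [hθ]
    calc star u * p.op * u * (star u * p.op * u)
        = star u * p.op * (u * star u) * p.op * u := by simp only [mul_assoc]
      _ = star u * p.op * u := by rw [hu1.2, mul_one, mul_assoc (star u) p.op p.op, p.idem]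
  have hpair : ∀ p, τ (μ p * θ p) = τ (star x * p.op * x * θ p) := by
    intro p
    have hz : μ p - star x * p.op * x ∈ M₁ := hM₁.sub_mem (hA₁.1 (hμ.mem p)) (hq p)
    rw [← sub_eq_zero, ← map_sub, ← sub_mul]
    refine hτ.apply_mul_eq_zero hA₁v hA₂v hA₁M hA₂M
      (fun a ha b hb => hcomm a (hA₁.1 ha) b (hA₂.1 hb)) (hM₁M hz) (fun a ha b hb => ?_) (hθA p)
    rw [← mul_assoc, hτ.apply_mul_of_commute hM₁ hM₁M hM₁f (hM₁.mul_mem _ hz _ (hA₁.1 ha))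
      (hA₂M hb) (fun z hz => hcomm z hz b (hA₂.1 hb)), sub_mul, map_sub, hμ.apply p a ha, sub_self,
      zero_mul]
  set z := x * y with hz
  have hzM : z ∈ M := hM.mul_mem _ hxM _ hyM
  have hpz : ∀ p : Pr A₁, p.op * z * θ p ∈ M := fun p =>
    hM.mul_mem _ (hM.mul_mem _ (hA₁M p.mem) _ hzM) _ (hθM p)
  have hsq : ∀ p : Pr A₁, sq2 τ (p.op * z * θ p) ≤ ‖y‖ ^ 2 * (τ (μ p * θ p)).re := by
    intro p
    have hpx : p.op * x ∈ M₁ := hM₁.mul_mem _ (hA₁.1 p.mem) _ hx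
    have h1 : p.op * z * θ p = y * (p.op * x * θ p) := by
      rw [hz, ← mul_assoc p.op, hcomm _ hpx y hy, mul_assoc]
    rw [h1]
    refine (hτ.sq2_mul_le hyM (hM.mul_mem _ (hM₁M hpx) _ (hθM p))).trans_eq ?_
    have h2 : star (p.op * x * θ p) * (p.op * x * θ p) = θ p * (star x * p.op * x * θ p) := by
      simp only [star_mul, hθs, p.sa, mul_assoc]
      rw [← mul_assoc p.op p.op, p.idem]
    rw [sq2, h2, hτ.tracial _ (hθM p) _ (hM.mul_mem _ (hM₁M (hq p)) _ (hθM p)), mul_assoc _ (θ p),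
      hθθ, hpair]
  have key : ∀ t : ℝ, 0 < t → ‖τ (star u * z)‖ ^ 2 ≤ ‖y‖ ^ 2 * (1 / t) := by
    intro t ht
    obtain ⟨P, hP⟩ := exists_partition_sum_lt hτ₁ hA₁ hx hx1 hμ hn
      (ε := 1 / t ^ 2) (by positivity)
    have h1 : τ (star u * ∑ p ∈ P.parts, p.op * z * θ p) = τ (star u * z) := by
      have e1 : star u * z = ∑ p ∈ P.parts, star u * (p.op * z) := by
        rw [← Finset.mul_sum, ← Finset.sum_mul, Pr.sum_parts, one_mul]
      rw [e1, Finset.mul_sum, map_sum, map_sum]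
      refine Finset.sum_congr rfl fun p _ => ?_
      have hp := hA₁M p.mem
      rw [← mul_assoc, hτ.tracial _ (hM.mul_mem _ husM _ (hM.mul_mem _ hp _ hzM)) _ (hθM p), hθ]
      congr 1
      calc star u * p.op * u * (star u * (p.op * z))
          = star u * p.op * (u * star u) * (p.op * z) := by simp only [mul_assoc]
        _ = star u * (p.op * z) := by
          rw [hu1.2, mul_one, mul_assoc, ← mul_assoc p.op p.op, p.idem]
    have h2 : sq2 τ (∑ p ∈ P.parts, p.op * z * θ p) = ∑ p ∈ P.parts, sq2 τ (p.op * z * θ p) := by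
      simp only [sq2]
      rw [← Complex.re_sum, ← map_sum]
      congr 2
      rw [star_sum, Finset.sum_mul]
      refine Finset.sum_congr rfl fun p hp => ?_
      rw [Finset.mul_sum, Finset.sum_eq_single_of_mem p hp]
      intro q hq hqp
      have hpq : Disjoint p q := P.disjoint hp hq hqp.symm
      simp only [star_mul, p.sa, mul_assoc]
      rw [← mul_assoc p.op q.op, Pr.disjoint_iff_mul.1 hpq]
      simp
    have h3 := hτ.cauchy_schwarz (hM.sum_mem P.parts _ fun p _ => hpz p) huM
    have h4 : sq2 τ u = 1 := by rw [sq2, hu1.1, hτ.map_one, Complex.one_re]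
    have h5 : ∑ p ∈ P.parts, (τ (θ p)).re = 1 := by
      rw [← Complex.re_sum, ← map_sum]
      simp only [hθ]
      rw [← Finset.sum_mul, ← Finset.mul_sum, Pr.sum_parts, mul_one, hu1.1, hτ.map_one,
        Complex.one_re]
    rw [h1, h2, h4, one_mul] at h3
    refine h3.trans ((Finset.sum_le_sum fun p _ => hsq p).trans ?_)
    rw [← Finset.mul_sum]
    refine mul_le_mul_of_nonneg_left ?_ (by positivity)
    have h6 : 2 * t * ∑ p ∈ P.parts, (τ (μ p * θ p)).re ≤
        1 + t ^ 2 * ∑ p ∈ P.parts, (τ (μ p * μ p)).re := by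
      rw [← h5, Finset.mul_sum, Finset.mul_sum, ← Finset.sum_add_distrib]
      refine Finset.sum_le_sum fun p _ => ?_
      have := hτ.two_mul_apply_le (hθM p) (hμM p) (hθs p) (hμs p) t
      rwa [hθθ] at this
    have h7 : t ^ 2 * ∑ p ∈ P.parts, (τ (μ p * μ p)).re ≤ 1 := by
      rw [lt_div_iff₀ (by positivity)] at hP
      linarith
    rw [le_div_iff₀ ht]
    linarith
  have h8 : ‖τ (star u * z)‖ ^ 2 ≤ 0 := by
    refine le_of_forall_pos_le_add fun δ hδ => ?_
    refine (key ((‖y‖ ^ 2 + 1) / δ) (by positivity)).trans ?_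
    rw [one_div_div, zero_add, mul_div_assoc', div_le_iff₀ (by positivity)]
    nlinarith
  simpa using le_antisymm h8 (by positivity)

theorem apply_star_mul_mul_eq_zero {x y u : H →L[ℂ] H} (hx : x ∈ M₁)
    (hn : ∀ n ∈ normAlg M₁ A₁, τ (star n * x) = 0) (hy : y ∈ M₂)
    (hu : u ∈ normalizerSet M (vNgen (A₁ ∪ A₂))) : τ (star u * (x * y)) = 0 := by
  have hpos : (0 : ℝ) < ‖x‖ + 1 := by positivity
  have hne : ((‖x‖ + 1 : ℝ) : ℂ) ≠ 0 := by exact_mod_cast hpos.ne'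
  have h1 := apply_star_mul_mul_eq_zero_of_norm_le hτ hM₁ hM₁M hM₁f hM₂ hM₂M hcomm hA₁ hA₂
    (x := ((‖x‖ + 1 : ℝ) : ℂ)⁻¹ • x) (hM₁.smul_mem _ _ hx) ?_ (fun n hn' => ?_) hy hu
  · rw [smul_mul_assoc, mul_smul_comm, map_smul, smul_eq_zero] at h1
    exact h1.resolve_left (inv_ne_zero hne)
  · rw [norm_smul, norm_inv, Complex.norm_real, Real.norm_of_nonneg hpos.le, inv_mul_le_iff₀ hpos]
    linarith
  · rw [mul_smul_comm, map_smul, hn n hn', smul_zero]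

end

theorem IsFaithfulTracialState.exists_tracialState {M : Set (H →L[ℂ] H)}
    {τ : (H →L[ℂ] H) → ℂ} (hM : IsVonNeumannAlgebra M) (hτ : IsFaithfulTracialState M τ) :
    ∃ τ' : (H →L[ℂ] H) →ₗ[ℂ] ℂ, TracialState M τ' := by
  let f : hM.toSubmodule →ₗ[ℂ] ℂ :=
    { toFun := fun x => τ x
      map_add' := fun x y => hτ.map_add _ x.2 _ y.2
      map_smul' := fun c x => hτ.map_smul c _ x.2 }
  obtain ⟨g, hg⟩ := f.exists_extend
  have h : ∀ x ∈ M, g x = τ x := fun x hx => LinearMap.congr_fun hg ⟨x, hx⟩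
  refine ⟨g, hM, ?_, ?_, ?_, ?_⟩
  · rw [h _ hM.one_mem, hτ.map_one]
  · intro x hx
    rw [h _ (hM.mul_mem _ (hM.star_mem x hx) _ hx)]
    exact hτ.nonneg x hx
  · intro x hx y hy
    rw [h _ (hM.mul_mem _ hx _ hy), h _ (hM.mul_mem _ hy _ hx), hτ.tracial x hx y hy]
  · intro x hx h0
    rw [h _ (hM.mul_mem _ (hM.star_mem x hx) _ hx)] at h0
    exact hτ.faithful x hx h0

end

section

section

variable {M M₁ M₂ A₁ A₂ : Set (H →L[ℂ] H)} {τ : (H →L[ℂ] H) →ₗ[ℂ] ℂ}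

theorem normAlg_left_subset (hM₁ : IsVonNeumannAlgebra M₁) (hM₁M : M₁ ⊆ M)
    (hcomm : ∀ x ∈ M₁, ∀ y ∈ M₂, x * y = y * x) (hA₁ : IsMasa M₁ A₁) (hA₂ : IsMasa M₂ A₂) :
    normAlg M₁ A₁ ⊆ normAlg M (vNgen (A₁ ∪ A₂)) :=
  (isVonNeumannAlgebra_normAlg _ _).vNgen_subset
    ((normalizerSet_left_subset hM₁ hM₁M hcomm hA₁ hA₂).trans (subset_vNgen _))

theorem normalizerSet_subset_vNgen (hτ : NormalTrace M τ)
    (hM₁ : IsVonNeumannAlgebra M₁) (hM₁M : M₁ ⊆ M) (hM₁f : IsFactor M₁)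
    (hM₂ : IsVonNeumannAlgebra M₂) (hM₂M : M₂ ⊆ M) (hM₂f : IsFactor M₂)
    (hcomm : ∀ x ∈ M₁, ∀ y ∈ M₂, x * y = y * x) (hgen : M = vNgen (M₁ ∪ M₂))
    (hA₁ : IsMasa M₁ A₁) (hA₂ : IsMasa M₂ A₂) :
    normalizerSet M (vNgen (A₁ ∪ A₂)) ⊆ vNgen (normAlg M₁ A₁ ∪ normAlg M₂ A₂) := by
  intro u hu
  have hM := hτ.vna
  have hcomm' : ∀ y ∈ M₂, ∀ x ∈ M₁, y * x = x * y := fun y hy x hx => (hcomm x hx y hy).symm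
  have hN₁ := isVonNeumannAlgebra_normAlg M₁ A₁
  have hN₂ := isVonNeumannAlgebra_normAlg M₂ A₂
  have hN₁M₁ := hM₁.normAlg_subset A₁
  have hN₂M₂ := hM₂.normAlg_subset A₂
  set P := vNgen (normAlg M₁ A₁ ∪ normAlg M₂ A₂) with hPdef
  have hP : IsVonNeumannAlgebra P := isVonNeumannAlgebra_vNgen _
  have hPM : P ⊆ M := hM.vNgen_subset
    (Set.union_subset (hN₁M₁.trans hM₁M) (hN₂M₂.trans hM₂M))
  have huM : u ∈ M := hu.1
  obtain ⟨E, hE⟩ := hτ.exists_condExp hP hPM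
  obtain ⟨E₁, hE₁⟩ := (hτ.mono hM₁ hM₁M).exists_condExp hN₁ hN₁M₁
  obtain ⟨E₂, hE₂⟩ := (hτ.mono hM₂ hM₂M).exists_condExp hN₂ hN₂M₂
  set e := E u with he
  have heP : e ∈ P := hE.1 u huM
  have hesP := hP.star_mem e heP
  have heM := hPM heP
  have hyM : u - e ∈ M := hM.sub_mem huM heM
  have hysM := hM.star_mem _ hyM
  have hyP : ∀ b ∈ P, τ (star (u - e) * b) = 0 := by
    intro b hb
    have h1 := hE.2 u huM _ (hP.star_mem b hb)
    have h2 := hτ.apply_star (hM.mul_mem _ hyM _ (hM.star_mem b (hPM hb)))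
    rw [star_mul, star_star, h1, star_zero] at h2
    rw [hτ.tracial _ hysM _ (hPM hb), h2]
  have hremove : ∀ k ∈ M, ∀ l, l = k → τ (star u * l) = 0 →
      (∀ n₁ ∈ normAlg M₁ A₁, ∀ n₂ ∈ normAlg M₂ A₂, τ (k * (n₁ * n₂)) = 0) →
      τ (star (u - e) * k) = 0 := by
    rintro k hk _ rfl h1 h2
    have h3 := hτ.apply_mul_eq_zero hN₁ hN₂ (hN₁M₁.trans hM₁M) (hN₂M₂.trans hM₂M)
      (fun x hx y hy => hcomm x (hN₁M₁ hx) y (hN₂M₂ hy)) hk h2 hesP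
    rw [star_sub, sub_mul, map_sub, h1, hτ.tracial _ (hM.star_mem e heM) _ hk, h3, sub_self]
  have hw : ∀ x ∈ M₁, ∀ y ∈ M₂, τ (star (u - e) * (x * y)) = 0 := by
    intro x hx y hy
    have hn₁ := hE₁.1 x hx
    have hn₂ := hE₂.1 y hy
    have hk₁ : x - E₁ x ∈ M₁ := hM₁.sub_mem hx (hN₁M₁ hn₁)
    have hk₂ : y - E₂ y ∈ M₂ := hM₂.sub_mem hy (hN₂M₂ hn₂)
    have h1 : x * y = E₁ x * E₂ y + (x - E₁ x) * y + E₁ x * (y - E₂ y) := by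
      simp only [mul_sub, sub_mul]; abel
    have hprod : ∀ a ∈ M₁, ∀ b ∈ M₂, ∀ c ∈ M₁, ∀ d ∈ M₂,
        τ (a * b * (c * d)) = τ (a * c) * τ (b * d) := by
      intro a ha b hb c hc d hd
      have hbd := hM₂.mul_mem _ hb _ hd
      rw [← hτ.apply_mul_of_commute hM₁ hM₁M hM₁f (hM₁.mul_mem _ ha _ hc) (hM₂M hbd)
        fun z hz => hcomm z hz _ hbd]
      congr 1
      simp only [mul_assoc]
      rw [← mul_assoc b c, ← hcomm c hc b hb, mul_assoc c]
    rw [h1, mul_add, mul_add, map_add, map_add, hyP _ (hP.mul_mem _ (subset_vNgen _ (Or.inl hn₁)) _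
      (subset_vNgen _ (Or.inr hn₂))), zero_add]
    have h2 : τ (star (u - e) * ((x - E₁ x) * y)) = 0 := by
      refine hremove _ (hM.mul_mem _ (hM₁M hk₁) _ (hM₂M hy)) _ rfl ?_ ?_
      · refine apply_star_mul_mul_eq_zero hτ hM₁ hM₁M hM₁f hM₂ hM₂M hcomm hA₁ hA₂ hk₁
          (fun n hn => ?_) hy hu
        have hns := hN₁.star_mem n hn
        rw [hτ.tracial _ (hM₁M (hN₁M₁ hns)) _ (hM₁M hk₁), hE₁.2 x hx _ hns]
      · intro n₁ hn₁ n₂ hn₂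
        rw [hprod _ hk₁ _ hy _ (hN₁M₁ hn₁) _ (hN₂M₂ hn₂), hE₁.2 x hx _ hn₁, zero_mul]
    have h3 : τ (star (u - e) * (E₁ x * (y - E₂ y))) = 0 := by
      refine hremove _ (hM.mul_mem _ (hM₁M (hN₁M₁ hn₁)) _ (hM₂M hk₂)) _
        (hcomm _ (hN₁M₁ hn₁) _ hk₂).symm ?_ ?_
      · refine apply_star_mul_mul_eq_zero hτ hM₂ hM₂M hM₂f hM₁ hM₁M hcomm' hA₂ hA₁ hk₂
          (fun n hn => ?_) (hN₁M₁ hn₁) (by rwa [Set.union_comm])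
        have hns := hN₂.star_mem n hn
        rw [hτ.tracial _ (hM₂M (hN₂M₂ hns)) _ (hM₂M hk₂), hE₂.2 y hy _ hns]
      · intro n₁ hn₁' n₂ hn₂'
        rw [hprod _ (hN₁M₁ hn₁) _ hk₂ _ (hN₁M₁ hn₁') _ (hN₂M₂ hn₂'), hE₂.2 y hy _ hn₂', mul_zero]
    rw [h2, h3, add_zero]
  have h4 : τ (star (u - e) * (u - e)) = 0 :=
    hτ.apply_mul_eq_zero hM₁ hM₂ hM₁M hM₂M hcomm hysM hw (hgen ▸ hyM)
  rw [sub_eq_zero.1 (hτ.faithful _ hyM h4)]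
  exact heP

end

end

/-- For MASAs `Aᵢ ⊆ Mᵢ` in II₁ factors realized inside the tensor product
II₁ factor `M = M₁ ⊗̄ M₂`, one has
`N_M(A₁ ⊗̄ A₂)'' = N_{M₁}(A₁)'' ⊗̄ N_{M₂}(A₂)''`. -/
theorem normalizing_algebra_of_tensor_product_masa
    {H : Type*} [NormedAddCommGroup H] [InnerProductSpace ℂ H] [CompleteSpace H]
    (M M₁ M₂ A₁ A₂ : Set (H →L[ℂ] H)) (τ : (H →L[ℂ] H) → ℂ)
    (hM : IsII1Factor M τ)
    (hM₁ : IsVonNeumannAlgebra M₁) (hM₁M : M₁ ⊆ M)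
    (hM₁f : IsFactor M₁) (hM₁i : IsInfiniteDimensionalSet M₁)
    (hM₂ : IsVonNeumannAlgebra M₂) (hM₂M : M₂ ⊆ M)
    (hM₂f : IsFactor M₂) (hM₂i : IsInfiniteDimensionalSet M₂)
    (hcomm : ∀ x ∈ M₁, ∀ y ∈ M₂, x * y = y * x)
    (htens : ∀ x ∈ M₁, ∀ y ∈ M₂, τ (x * y) = τ x * τ y)
    (hgen : M = vNgen (M₁ ∪ M₂))
    (hA₁ : IsMasa M₁ A₁) (hA₂ : IsMasa M₂ A₂) :
    normAlg M (vNgen (A₁ ∪ A₂)) = vNgen (normAlg M₁ A₁ ∪ normAlg M₂ A₂) := by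
  obtain ⟨τ₀, hτ₀⟩ := hM.trace.exists_tracialState hM.vna
  obtain ⟨τ', hτ⟩ := hτ₀.exists_normalTrace hM.factor
  refine Set.Subset.antisymm ?_ ?_
  · exact (isVonNeumannAlgebra_vNgen _).vNgen_subset (normalizerSet_subset_vNgen hτ hM₁ hM₁M hM₁f
      hM₂ hM₂M hM₂f hcomm hgen hA₁ hA₂)
  · refine (isVonNeumannAlgebra_normAlg _ _).vNgen_subset (Set.union_subset ?_ ?_)
    · exact normAlg_left_subset hM₁ hM₁M hcomm hA₁ hA₂
    · rw [Set.union_comm A₁ A₂]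
      exact normAlg_left_subset hM₂ hM₂M (fun y hy x hx => (hcomm x hx y hy).symm) hA₂ hA₁
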